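/- Let A_S be an Artin group of large type with |S| ≥ 2, let g ∈ A_S, and let n be a non-zero integer. Then the parabolic closure of g equals the parabolic closure of gⁿ, i.e. P_g = P_{gⁿ}. -/

import Mathlib

/-- The alternating word `sts⋯` of length `k` in the free group on `S`. -/
def braidWord {S : Type*} (k : ℕ) (s t : S) : FreeGroup S :=
  ((List.range k).map fun i => FreeGroup.of (if i % 2 = 0 then s else t)).prod

/-- The braid relations of the Artin group with Coxeter-type matrix `M`
(`M s t = ⊤` means no relation). -/
def artinRels {S : Type*} (M : S → S → ℕ∞) : Set (FreeGroup S) :=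
  { r | ∃ s t : S, s ≠ t ∧ ∃ k : ℕ, M s t = (k : ℕ∞) ∧
      r = braidWord k s t * (braidWord k t s)⁻¹ }

/-- The Artin group associated to the matrix `M`. -/
abbrev ArtinGroup {S : Type*} (M : S → S → ℕ∞) : Type _ := PresentedGroup (artinRels M)

/-- The standard parabolic subgroup `A_X` generated by the images of elements of `X ⊆ S`. -/
def StandardParabolic {S : Type*} (M : S → S → ℕ∞) (X : Set S) : Subgroup (ArtinGroup M) :=
  Subgroup.closure ((fun s => (PresentedGroup.of s : ArtinGroup M)) '' X)

/-- The conjugate `g H g⁻¹` of a subgroup. -/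
def conjSubgroup {G : Type*} [Group G] (g : G) (H : Subgroup G) : Subgroup G :=
  H.map (MulAut.conj g).toMonoidHom

/-- A parabolic subgroup: a conjugate of a standard parabolic subgroup. -/
def IsParabolic {S : Type*} (M : S → S → ℕ∞) (P : Subgroup (ArtinGroup M)) : Prop :=
  ∃ (g : ArtinGroup M) (X : Set S), P = conjSubgroup g (StandardParabolic M X)

/-- `P` is the parabolic closure of `x`: the minimal parabolic subgroup containing `x`. -/
def IsParabolicClosure {S : Type*} (M : S → S → ℕ∞) (x : ArtinGroup M)
    (P : Subgroup (ArtinGroup M)) : Prop :=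
  IsParabolic M P ∧ x ∈ P ∧
    ∀ Q : Subgroup (ArtinGroup M), IsParabolic M Q → x ∈ Q → P ≤ Q

namespace Artin

/-- The alternating product `x * y * x * ⋯` with `k` factors. -/
def alt {G : Type*} [Monoid G] : ℕ → G → G → G
  | 0, _, _ => 1
  | k + 1, x, y => x * alt k y x

/-- The alternating product `⋯ * x * y * x` with `k` factors. -/
def ralt {G : Type*} [Monoid G] : ℕ → G → G → G
  | 0, _, _ => 1
  | k + 1, x, y => ralt k y x * x

section Alternating

variable {G H : Type*} [Monoid G] [Monoid H]

@[simp] theorem alt_zero (x y : G) : alt 0 x y = 1 := rfl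

theorem alt_succ (k : ℕ) (x y : G) : alt (k + 1) x y = x * alt k y x := rfl

@[simp] theorem ralt_zero (x y : G) : ralt 0 x y = 1 := rfl

theorem ralt_succ (k : ℕ) (x y : G) : ralt (k + 1) x y = ralt k y x * x := rfl

theorem alt_succ_right (k : ℕ) (x y : G) :
    alt (k + 1) x y = alt k x y * if k % 2 = 0 then x else y := by
  induction k generalizing x y with
  | zero => simp [alt]
  | succ k ih =>
    rw [alt_succ, ih y x, alt_succ k x y, mul_assoc]
    rcases Nat.mod_two_eq_zero_or_one k with h | h <;> simp [h, Nat.add_mod]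

theorem alt_eq_ralt (k : ℕ) (x y : G) :
    alt k x y = if k % 2 = 0 then ralt k y x else ralt k x y := by
  induction k generalizing x y with
  | zero => simp
  | succ k ih =>
    rw [alt_succ_right, ih]
    rcases Nat.mod_two_eq_zero_or_one k with h | h <;> simp [h, Nat.add_mod, ralt]

theorem ralt_add (j k : ℕ) (x y : G) :
    ralt (j + k) x y = (if k % 2 = 0 then ralt j x y else ralt j y x) * ralt k x y := by
  induction k generalizing x y with
  | zero => simp
  | succ k ih =>
    rw [← add_assoc, ralt_succ, ih, ralt_succ, mul_assoc]
    rcases Nat.mod_two_eq_zero_or_one k with h | h <;> simp [h, Nat.add_mod]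

theorem map_alt (f : G →* H) (k : ℕ) (x y : G) : f (alt k x y) = alt k (f x) (f y) := by
  induction k generalizing x y with
  | zero => simp
  | succ k ih => simp [alt, ih]

theorem map_ralt (f : G →* H) (k : ℕ) (x y : G) : f (ralt k x y) = ralt k (f x) (f y) := by
  induction k generalizing x y with
  | zero => simp
  | succ k ih => simp [ralt, ih]

theorem alt_comm_iff_ralt_comm (k : ℕ) (x y : G) :
    alt k x y = alt k y x ↔ ralt k x y = ralt k y x := by
  rw [alt_eq_ralt k x y, alt_eq_ralt k y x]
  split_ifs
  · exact eq_comm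
  · rfl

theorem lift_braidWord {S G : Type*} [Group G] (f : S → G) (k : ℕ) (s t : S) :
    FreeGroup.lift f (braidWord k s t) = alt k (f s) (f t) := by
  induction k with
  | zero => simp [braidWord]
  | succ k ih =>
    rw [alt_succ_right, ← ih]
    unfold braidWord
    rw [List.range_succ, List.map_append, List.prod_append, map_mul]
    simp only [List.map_cons, List.map_nil, List.prod_cons, List.prod_nil, mul_one,
      FreeGroup.lift_apply_of]
    split_ifs <;> rfl

end Alternating

section Lift

variable {S : Type*} {M : S → S → ℕ∞} {G : Type*} [Group G]

/-- The image of a generator in the Artin group. -/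
abbrev gen (M : S → S → ℕ∞) (s : S) : ArtinGroup M := PresentedGroup.of s

/-- A family satisfying the braid relations. -/
def SatisfiesBraid (M : S → S → ℕ∞) (f : S → G) : Prop :=
  ∀ s t : S, s ≠ t → ∀ k : ℕ, M s t = k → ralt k (f s) (f t) = ralt k (f t) (f s)

/-- The universal property of the Artin group. -/
def liftHom (f : S → G) (hf : SatisfiesBraid M f) : ArtinGroup M →* G :=
  PresentedGroup.toGroup (f := f) (by
    rintro r ⟨s, t, hst, k, hk, rfl⟩
    rw [map_mul, map_inv, lift_braidWord, lift_braidWord, mul_inv_eq_one,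
      alt_comm_iff_ralt_comm]
    exact hf s t hst k hk)

@[simp] theorem liftHom_gen (f : S → G) (hf : SatisfiesBraid M f) (s : S) :
    liftHom f hf (gen M s) = f s :=
  PresentedGroup.toGroup.of _

theorem satisfiesBraid_gen (M : S → S → ℕ∞) : SatisfiesBraid M (gen M) := by
  intro s t hst k hk
  rw [← alt_comm_iff_ralt_comm]
  have h := PresentedGroup.one_of_mem (rels := artinRels M)
    (x := braidWord k s t * (braidWord k t s)⁻¹) ⟨s, t, hst, k, hk, rfl⟩
  have key : ∀ w : FreeGroup S, PresentedGroup.mk (artinRels M) w = FreeGroup.lift (gen M) w := by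
    intro w
    have : PresentedGroup.mk (artinRels M) = FreeGroup.lift (gen M) := by
      ext s
      simp [gen, PresentedGroup.of]
    rw [this]
  rw [map_mul, map_inv, mul_inv_eq_one, key, key, lift_braidWord, lift_braidWord] at h
  exact h

theorem closure_range_gen (M : S → S → ℕ∞) : Subgroup.closure (Set.range (gen M)) = ⊤ :=
  PresentedGroup.closure_range_of _

/-- Induction over the standard parabolic subgroup. -/
theorem parabolic_induction {X : Set S} {p : ArtinGroup M → Prop}
    (one : p 1) (gen_mul : ∀ s ∈ X, ∀ g, p g → p (gen M s * g))
    (inv_mul : ∀ s ∈ X, ∀ g, p g → p ((gen M s)⁻¹ * g)) {g : ArtinGroup M}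
    (hg : g ∈ StandardParabolic M X) : p g := by
  refine Subgroup.closure_induction_left (p := fun g _ => p g) one ?_ ?_ hg
  · rintro _ ⟨s, hs, rfl⟩ y _ hy
    exact gen_mul s hs y hy
  · rintro _ ⟨s, hs, rfl⟩ y _ hy
    exact inv_mul s hs y hy

theorem gen_mem_standardParabolic {X : Set S} {s : S} (hs : s ∈ X) :
    gen M s ∈ StandardParabolic M X :=
  Subgroup.subset_closure ⟨s, hs, rfl⟩

theorem standardParabolic_univ : StandardParabolic M Set.univ = ⊤ := by
  rw [StandardParabolic, Set.image_univ]
  exact closure_range_gen M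

theorem standardParabolic_mono {X Y : Set S} (h : X ⊆ Y) :
    StandardParabolic M X ≤ StandardParabolic M Y :=
  Subgroup.closure_mono (Set.image_mono h)

/-- Induction over the Artin group. -/
theorem artin_induction {p : ArtinGroup M → Prop}
    (one : p 1) (gen_mul : ∀ s g, p g → p (gen M s * g))
    (inv_mul : ∀ s g, p g → p ((gen M s)⁻¹ * g)) (g : ArtinGroup M) : p g :=
  parabolic_induction (X := Set.univ) one (fun s _ => gen_mul s) (fun s _ => inv_mul s)
    (by rw [standardParabolic_univ]; trivial)

/-- The restriction of the matrix to a subset. -/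
abbrev restrict (M : S → S → ℕ∞) (X : Set S) : X → X → ℕ∞ := fun x y => M x y

/-- The natural map from the Artin group of the restricted matrix. -/
def incl (M : S → S → ℕ∞) (X : Set S) : ArtinGroup (restrict M X) →* ArtinGroup M :=
  liftHom (fun x => gen M x) fun x y hxy k hk =>
    satisfiesBraid_gen M x y (fun h => hxy (Subtype.ext h)) k hk

@[simp] theorem incl_gen (X : Set S) (x : X) : incl M X (gen _ x) = gen M x :=
  liftHom_gen _ _ _

theorem map_incl_standardParabolic (X : Set S) (Y : Set X) :
    (StandardParabolic (restrict M X) Y).map (incl M X) =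
      StandardParabolic M (Subtype.val '' Y) := by
  rw [StandardParabolic, StandardParabolic, MonoidHom.map_closure, Set.image_image,
    Set.image_image]
  congr 1

theorem range_incl (X : Set S) : (incl M X).range = StandardParabolic M X := by
  rw [MonoidHom.range_eq_map, ← standardParabolic_univ, map_incl_standardParabolic]
  simp

end Lift

end Artin

namespace Artin

open Real

/-- Twice the cosine of the angle attached to a label; the value is `2` for the label `⊤`. -/
noncomputable def lam (m : ℕ∞) : ℝ := if m = ⊤ then 2 else 2 * cos (π / m.toNat)

/-- The coefficients of the roots of the dihedral group attached to a label. -/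
noncomputable def dc (m : ℕ∞) (i : ℤ) : ℝ :=
  if m = ⊤ then i else sin (i * (π / m.toNat)) / sin (π / m.toNat)

section Coefficients

theorem lam_top : lam ⊤ = 2 := by simp [lam]

theorem lam_coe (m : ℕ) : lam m = 2 * cos (π / m) := by simp [lam]

theorem dc_top (i : ℤ) : dc ⊤ i = i := by simp [dc]

theorem dc_coe (m : ℕ) (i : ℤ) : dc m i = sin (i * (π / m)) / sin (π / m) := by simp [dc]

theorem sin_label_pos {m : ℕ} (hm : 2 ≤ m) : 0 < sin (π / m) := by
  have : (2 : ℝ) ≤ m := by exact_mod_cast hm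
  apply sin_pos_of_pos_of_lt_pi (by positivity)
  exact div_lt_self pi_pos (by linarith)

theorem two_le_of_coe {m : ℕ} (hm : (2 : ℕ∞) ≤ m) : 2 ≤ m := by exact_mod_cast hm

@[simp] theorem dc_zero (m : ℕ∞) : dc m 0 = 0 := by
  induction m using ENat.recTopCoe <;> simp [dc_top, dc_coe]

theorem dc_one {m : ℕ∞} (hm : 2 ≤ m) : dc m 1 = 1 := by
  induction m using ENat.recTopCoe with
  | top => simp [dc_top]
  | coe m =>
    have := (sin_label_pos (two_le_of_coe hm)).ne'
    simp [dc_coe, this]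

theorem dc_rec (m : ℕ∞) (i : ℤ) : dc m (i + 1) + dc m (i - 1) = lam m * dc m i := by
  induction m using ENat.recTopCoe with
  | top => simp [dc_top, lam_top]; ring
  | coe m =>
    rw [dc_coe, dc_coe, dc_coe, lam_coe]
    push_cast
    rw [add_mul, sub_mul, one_mul, sin_add, sin_sub]
    ring

theorem dc_pos {m : ℕ∞} {i : ℤ} (hi : 0 < i) (him : ∀ k : ℕ, m = k → i < k) : 0 < dc m i := by
  induction m using ENat.recTopCoe with
  | top => simpa [dc_top] using hi
  | coe m =>
    have h1 : (i : ℝ) < m := by exact_mod_cast him m rfl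
    have h0 : (1 : ℝ) ≤ i := by exact_mod_cast hi
    have hm : 2 ≤ m := by have := him m rfl; omega
    rw [dc_coe]
    apply div_pos _ (sin_label_pos hm)
    have hm0 : (0 : ℝ) < m := by linarith
    apply sin_pos_of_pos_of_lt_pi (by positivity)
    rw [← mul_div_assoc, div_lt_iff₀ hm0, mul_comm]
    exact mul_lt_mul_of_pos_left h1 pi_pos

theorem dc_nonneg {m : ℕ∞} {i : ℤ} (hi : 0 ≤ i) (him : ∀ k : ℕ, m = k → i ≤ k) :
    0 ≤ dc m i := by
  rcases hi.eq_or_lt with rfl | hi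
  · simp
  by_cases h : ∀ k : ℕ, m = k → i < k
  · exact (dc_pos hi h).le
  · push Not at h
    obtain ⟨k, rfl, hk⟩ := h
    obtain rfl : i = k := le_antisymm (him k rfl) hk
    have : (k : ℝ) ≠ 0 := by
      have : k ≠ 0 := by omega
      exact_mod_cast this
    rw [dc_coe]
    simp [mul_div_cancel₀ _ this]

theorem dc_reflect {m : ℕ} (hm : 2 ≤ m) (i : ℤ) : dc m (m - i) = dc m i := by
  have : (m : ℝ) ≠ 0 := by
    have : m ≠ 0 := by omega
    exact_mod_cast this
  rw [dc_coe, dc_coe]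
  push_cast
  rw [sub_mul, mul_div_cancel₀ _ this, sin_pi_sub]

theorem dc_add_label {m : ℕ} (hm : 2 ≤ m) (i : ℤ) : dc m (i + m) = -dc m i := by
  have : (m : ℝ) ≠ 0 := by
    have : m ≠ 0 := by omega
    exact_mod_cast this
  rw [dc_coe, dc_coe]
  push_cast
  rw [add_mul, mul_div_cancel₀ _ this, sin_add_pi, neg_div]

theorem dc_label {m : ℕ} (hm : 2 ≤ m) : dc m m = 0 := by
  have := dc_add_label hm 0
  simpa using this

theorem dc_cross {m : ℕ∞} (hm : 2 ≤ m) (i j : ℤ) :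
    dc m (j - 1) * dc m i - dc m (i - 1) * dc m j = dc m (j - i) := by
  induction m using ENat.recTopCoe with
  | top => simp [dc_top]; ring
  | coe m =>
    have := (sin_label_pos (two_le_of_coe hm)).ne'
    simp only [dc_coe]
    push_cast
    simp only [sub_mul, one_mul, sin_sub]
    field_simp
    ring

theorem dc_two {m : ℕ∞} (hm : 2 ≤ m) : dc m 2 = lam m := by
  have := dc_rec m 1
  simpa [dc_one hm] using this

theorem dc_neg (m : ℕ∞) (i : ℤ) : dc m (-i) = -dc m i := by
  induction m using ENat.recTopCoe with
  | top => simp [dc_top]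
  | coe m => simp [dc_coe, neg_div]

theorem lam_nonneg {m : ℕ∞} (hm : 2 ≤ m) : 0 ≤ lam m := by
  rw [← dc_two hm]
  refine dc_nonneg (by norm_num) fun k hk => ?_
  subst hk
  exact_mod_cast hm

theorem lam_pos {m : ℕ∞} (hm : 3 ≤ m) : 0 < lam m := by
  rw [← dc_two (le_trans (by norm_num) hm)]
  refine dc_pos (by norm_num) fun k hk => ?_
  subst hk
  have : 3 ≤ k := by exact_mod_cast hm
  omega

theorem lam_lt_two {m : ℕ} (hm : 2 ≤ m) : lam m < 2 := by
  rw [lam_coe]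
  have h1 := sin_label_pos hm
  have h2 := sin_sq_add_cos_sq (π / m)
  nlinarith

end Coefficients

end Artin

namespace Artin

open Real

/-- The standing hypotheses: a symmetric matrix of large type. -/
structure Large {S : Type*} (M : S → S → ℕ∞) : Prop where
  symm : ∀ s t, M s t = M t s
  three_le : ∀ s t, s ≠ t → 3 ≤ M s t

variable {S : Type*} {M : S → S → ℕ∞}

theorem Large.two_le (hM : Large M) {s t : S} (h : s ≠ t) : 2 ≤ M s t :=
  le_trans (by norm_num) (hM.three_le s t h)

theorem Large.restrict (hM : Large M) (X : Set S) : Large (restrict M X) :=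
  ⟨fun _ _ => hM.symm _ _, fun _ _ h => hM.three_le _ _ fun e => h (Subtype.ext e)⟩

open Classical in
/-- The entries of the Gram matrix of the geometric representation. -/
noncomputable def gram (M : S → S → ℕ∞) (s t : S) : ℝ := if s = t then 2 else -lam (M s t)

@[simp] theorem gram_self (s : S) : gram M s s = 2 := by simp [gram]

theorem gram_of_ne {s t : S} (h : s ≠ t) : gram M s t = -lam (M s t) := by simp [gram, h]

theorem Large.gram_comm (hM : Large M) (s t : S) : gram M s t = gram M t s := by
  by_cases h : s = t
  · rw [h]
  · rw [gram_of_ne h, gram_of_ne (Ne.symm h), hM.symm]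

/-- The simple root attached to a generator. -/
noncomputable abbrev root (s : S) : S →₀ ℝ := Finsupp.single s 1

/-- The bilinear form of the geometric representation. -/
noncomputable def form (M : S → S → ℕ∞) : (S →₀ ℝ) →ₗ[ℝ] (S →₀ ℝ) →ₗ[ℝ] ℝ :=
  Finsupp.linearCombination ℝ fun s => Finsupp.linearCombination ℝ fun t => gram M s t

@[simp] theorem form_root (s t : S) : form M (root s) (root t) = gram M s t := by
  simp [form]

theorem Large.form_comm (hM : Large M) (v w : S →₀ ℝ) : form M v w = form M w v := by
  have : form M = (form M).flip := by
    ext s t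
    simpa using hM.gram_comm s t
  conv_lhs => rw [this]
  rfl

/-- The reflection attached to a generator. -/
noncomputable def refl (M : S → S → ℕ∞) (s : S) : (S →₀ ℝ) ≃ₗ[ℝ] (S →₀ ℝ) :=
  Module.reflection (f := form M (root s)) (x := root s) (by simp)

theorem refl_apply (s : S) (v : S →₀ ℝ) :
    refl M s v = v - form M (root s) v • root s := Module.reflection_apply _ _

@[simp] theorem refl_refl (s : S) (v : S →₀ ℝ) : refl M s (refl M s v) = v :=
  Module.involutive_reflection _ _

@[simp] theorem refl_mul_self (s : S) : refl M s * refl M s = 1 := by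
  refine LinearEquiv.ext fun v => ?_
  rw [LinearEquiv.mul_apply, refl_refl, LinearEquiv.coe_one, id]

@[simp] theorem refl_inv (s : S) : (refl M s)⁻¹ = refl M s :=
  inv_eq_of_mul_eq_one_left (refl_mul_self s)

@[simp] theorem refl_root (s : S) : refl M s (root s) = -root s := by
  rw [refl_apply, form_root, gram_self, two_smul]
  abel

theorem refl_root_of_ne {s t : S} (h : s ≠ t) :
    refl M s (root t) = lam (M s t) • root s + root t := by
  rw [refl_apply, form_root, gram_of_ne h, neg_smul, sub_neg_eq_add, add_comm]

theorem refl_apply_of_ne {s t : S} (h : t ≠ s) (v : S →₀ ℝ) : refl M s v t = v t := by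
  simp [refl_apply, h.symm]

theorem Large.form_refl (hM : Large M) (s : S) (v w : S →₀ ℝ) :
    form M (refl M s v) (refl M s w) = form M v w := by
  simp only [refl_apply, map_sub, map_smul, LinearMap.sub_apply, LinearMap.smul_apply, smul_eq_mul,
    form_root, gram_self]
  rw [hM.form_comm v (root s)]
  ring

theorem alt_refl_root (hM : Large M) {s t : S} (h : s ≠ t) (k : ℕ) :
    alt k (refl M s) (refl M t) (root (if k % 2 = 0 then s else t)) =
      dc (M s t) (k + 1) • root s + dc (M s t) k • root t := by
  induction k generalizing s t with
  | zero => simp [dc_one (hM.two_le h)]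
  | succ k ih =>
    have e : (if (k + 1) % 2 = 0 then s else t) = if k % 2 = 0 then t else s := by
      rcases Nat.mod_two_eq_zero_or_one k with h | h <;> simp [h, Nat.add_mod]
    rw [alt_succ, LinearEquiv.mul_apply, e, ih (Ne.symm h), map_add, map_smul, map_smul,
      refl_root, refl_root_of_ne h, hM.symm t s]
    have := dc_rec (M s t) (k + 1)
    rw [add_sub_cancel_right] at this
    push_cast
    rw [eq_sub_of_add_eq this]
    module

theorem alt_refl_root' (hM : Large M) {s t : S} (h : s ≠ t) (k : ℕ) :
    alt k (refl M s) (refl M t) (root (if k % 2 = 0 then t else s)) =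
      -(dc (M s t) k • root s + dc (M s t) (k - 1) • root t) := by
  cases k with
  | zero => simp [dc_neg, dc_one (hM.two_le h)]
  | succ k =>
    have e : (if (k + 1) % 2 = 0 then t else s) = if k % 2 = 0 then s else t := by
      rcases Nat.mod_two_eq_zero_or_one k with h | h <;> simp [h, Nat.add_mod]
    have := alt_refl_root hM h k
    rw [e, alt_succ_right, LinearEquiv.mul_apply]
    split_ifs at this ⊢ with h2 <;> simp [this]

theorem alt_refl_of_form_eq_zero {s t : S} (k : ℕ) {v : S →₀ ℝ}
    (hs : form M (root s) v = 0) (ht : form M (root t) v = 0) :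
    alt k (refl M s) (refl M t) v = v := by
  induction k generalizing s t with
  | zero => simp
  | succ k ih =>
    rw [alt_succ, LinearEquiv.mul_apply, ih ht hs, refl_apply, hs, zero_smul, sub_zero]

theorem alt_refl_label (hM : Large M) {s t : S} (h : s ≠ t) {k : ℕ} (hk : M s t = k) :
    alt k (refl M s) (refl M t) (root s) = -root (if k % 2 = 0 then s else t) ∧
      alt k (refl M s) (refl M t) (root t) = -root (if k % 2 = 0 then t else s) := by
  have h2 : 2 ≤ k := two_le_of_coe (hk ▸ hM.two_le h)
  have h3 := alt_refl_root hM h k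
  have h4 := alt_refl_root' hM h k
  have e1 : dc k (k + 1) = -1 := by
    rw [add_comm, dc_add_label h2, dc_one (by exact_mod_cast h2)]
  have e2 : dc k (k - 1) = 1 := by
    rw [dc_reflect h2, dc_one (by exact_mod_cast h2)]
  rw [hk, dc_label h2] at h3 h4
  rw [e1] at h3
  rw [e2] at h4
  split_ifs at h3 h4 ⊢ <;> simp_all

theorem form_decomposition (hM : Large M) {s t : S} (h : s ≠ t) {k : ℕ} (hk : M s t = k)
    (v : S →₀ ℝ) : ∃ x y : ℝ, ∃ u, v = x • root s + y • root t + u ∧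
      form M (root s) u = 0 ∧ form M (root t) u = 0 := by
  have h2 : 2 ≤ k := two_le_of_coe (hk ▸ hM.two_le h)
  have l0 : 0 ≤ lam k := lam_nonneg (by exact_mod_cast h2)
  have l2 := lam_lt_two h2
  set l := lam k
  have hd : 4 - l ^ 2 ≠ 0 := by nlinarith
  set p := form M (root s) v
  set q := form M (root t) v
  refine ⟨(2 * p + l * q) / (4 - l ^ 2), (2 * q + l * p) / (4 - l ^ 2), v -
    (((2 * p + l * q) / (4 - l ^ 2)) • root s + ((2 * q + l * p) / (4 - l ^ 2)) • root t),
    by abel, ?_, ?_⟩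
  · simp only [map_sub, map_add, map_smul, form_root, gram_self, smul_eq_mul, gram_of_ne h, hk]
    change p - _ = 0
    field_simp
    ring
  · simp only [map_sub, map_add, map_smul, form_root, gram_self, smul_eq_mul,
      gram_of_ne h.symm, hM.symm t s, hk]
    change q - _ = 0
    field_simp
    ring

theorem Large.satisfiesBraid_refl (hM : Large M) : SatisfiesBraid M (refl M) := by
  intro s t h k hk
  rw [← alt_comm_iff_ralt_comm]
  ext1 v
  obtain ⟨x, y, u, rfl, hs, ht⟩ := form_decomposition hM h hk v
  have hk' : M t s = k := by rw [hM.symm, hk]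
  simp only [map_add, map_smul]
  rw [alt_refl_of_form_eq_zero k hs ht, alt_refl_of_form_eq_zero k ht hs,
    (alt_refl_label hM h hk).1, (alt_refl_label hM h hk).2,
    (alt_refl_label hM h.symm hk').1, (alt_refl_label hM h.symm hk').2]

/-- The Coxeter group, as a group of linear transformations. -/
noncomputable def W (M : S → S → ℕ∞) : Subgroup ((S →₀ ℝ) ≃ₗ[ℝ] (S →₀ ℝ)) :=
  Subgroup.closure (Set.range (refl M))

theorem refl_mem (s : S) : refl M s ∈ W M := Subgroup.subset_closure ⟨s, rfl⟩

theorem W_induction {p : ((S →₀ ℝ) ≃ₗ[ℝ] (S →₀ ℝ)) → Prop} (one : p 1)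
    (mul : ∀ s w, w ∈ W M → p w → p (refl M s * w)) {w} (hw : w ∈ W M) : p w := by
  refine Subgroup.closure_induction_left (p := fun w _ => p w) one ?_ ?_ hw
  · rintro _ ⟨s, rfl⟩ y hy h
    exact mul s y hy h
  · rintro _ ⟨s, rfl⟩ y hy h
    rw [refl_inv]
    exact mul s y hy h

theorem Large.form_W (hM : Large M) {w} (hw : w ∈ W M) (u v : S →₀ ℝ) :
    form M (w u) (w v) = form M u v := by
  revert u v
  refine W_induction (p := fun w => ∀ u v, form M (w u) (w v) = form M u v)
    (fun _ _ => rfl) (fun s w _ ih u v => ?_) hw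
  rw [LinearEquiv.mul_apply, LinearEquiv.mul_apply, hM.form_refl, ih]

end Artin

namespace Artin

variable {S : Type*} {M : S → S → ℕ∞}

/-- The word length on the Coxeter group. -/
noncomputable def len (M : S → S → ℕ∞) (w : (S →₀ ℝ) ≃ₗ[ℝ] (S →₀ ℝ)) : ℕ :=
  sInf {n | ∃ l : List S, l.length = n ∧ (l.map (refl M)).prod = w}

theorem len_prod_le (l : List S) : len M (l.map (refl M)).prod ≤ l.length :=
  Nat.sInf_le ⟨l, rfl, rfl⟩

theorem exists_word {w} (hw : w ∈ W M) :
    ∃ l : List S, l.length = len M w ∧ (l.map (refl M)).prod = w := by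
  have : ({n | ∃ l : List S, l.length = n ∧ (l.map (refl M)).prod = w} : Set ℕ).Nonempty := by
    refine W_induction (p := fun w =>
      ({n | ∃ l : List S, l.length = n ∧ (l.map (refl M)).prod = w} : Set ℕ).Nonempty)
      ⟨0, [], rfl, rfl⟩ ?_ hw
    rintro s w _ ⟨n, l, rfl, rfl⟩
    exact ⟨_, s :: l, rfl, by simp⟩
  exact Nat.sInf_mem this

theorem len_mul_refl_le {w} (hw : w ∈ W M) (s : S) : len M (w * refl M s) ≤ len M w + 1 := by
  obtain ⟨l, hl, rfl⟩ := exists_word hw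
  have := len_prod_le (M := M) (l ++ [s])
  simpa [hl] using this

theorem eq_one_of_len_eq_zero {w} (hw : w ∈ W M) (h : len M w = 0) : w = 1 := by
  obtain ⟨l, hl, rfl⟩ := exists_word hw
  rw [h, List.length_eq_zero_iff] at hl
  simp [hl]

theorem exists_descent {w} (hw : w ∈ W M) (h : len M w ≠ 0) :
    ∃ s, len M (w * refl M s) < len M w := by
  obtain ⟨l, hl, e⟩ := exists_word hw
  rcases l.eq_nil_or_concat with rfl | ⟨l', s, rfl⟩
  · exact absurd hl.symm h
  · refine ⟨s, ?_⟩
    have := len_prod_le (M := M) l'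
    rw [← hl, ← e]
    simp only [List.concat_eq_append, List.map_append, List.prod_append, List.map_cons,
      List.map_nil, List.prod_cons, List.prod_nil, mul_one, List.length_append, mul_assoc,
      refl_mul_self, List.length_singleton]
    omega

theorem ralt_refl_mem (k : ℕ) (s t : S) : ralt k (refl M s) (refl M t) ∈ W M := by
  induction k generalizing s t with
  | zero => exact one_mem _
  | succ k ih => exact mul_mem (ih t s) (refl_mem s)

theorem len_mul_ralt_le {w} (hw : w ∈ W M) (k : ℕ) (s t : S) :
    len M (w * ralt k (refl M s) (refl M t)) ≤ len M w + k := by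
  induction k generalizing s t with
  | zero => simp
  | succ k ih =>
    rw [ralt_succ, ← mul_assoc]
    have := len_mul_refl_le (mul_mem hw (ralt_refl_mem (M := M) k t s)) s
    have := ih t s
    omega

theorem ralt_refl_root (hM : Large M) {s t : S} (h : s ≠ t) (k : ℕ) :
    ralt k (refl M t) (refl M s) (root s) = if k % 2 = 0 then
      dc (M s t) (k + 1) • root s + dc (M s t) k • root t else
      dc (M s t) (k + 1) • root t + dc (M s t) k • root s := by
  split_ifs with hk
  · have := alt_refl_root hM h k
    rwa [alt_eq_ralt, if_pos hk, if_pos hk] at this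
  · have := alt_refl_root hM h.symm k
    rwa [alt_eq_ralt, if_neg hk, if_neg hk, hM.symm] at this

theorem exists_alternating_suffix {w} (hw : w ∈ W M) {s t : S}
    (ht : len M (w * refl M t) < len M w) (hs : len M w ≤ len M (w * refl M s))
    (hM : Large M) :
    ∃ v ∈ W M, ∃ k : ℕ, len M v < len M w ∧ (∀ m : ℕ, M s t = m → k < m) ∧
      w = v * ralt k (refl M t) (refl M s) ∧
      len M v ≤ len M (v * refl M s) ∧ len M v ≤ len M (v * refl M t) := by
  classical
  have hst : s ≠ t := by rintro rfl; omega
  have ex : ∃ n, ∃ v ∈ W M, ∃ k : ℕ, n = len M v ∧ 0 < k ∧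
      w = v * ralt k (refl M t) (refl M s) ∧ len M w = len M v + k := by
    refine ⟨_, w * refl M t, mul_mem hw (refl_mem t), 1, rfl, one_pos, ?_, ?_⟩
    · simp [ralt, mul_assoc]
    · have := len_mul_refl_le (mul_mem hw (refl_mem (M := M) t)) t
      rw [mul_assoc, refl_mul_self, mul_one] at this
      omega
  obtain ⟨v, hv, k, hn, hk, e, hl⟩ := Nat.find_spec ex
  have hmin := fun n (hn' : n < Nat.find ex) => Nat.find_min ex hn'
  rw [hn] at hmin
  have outer : ∀ z, ralt (k + 1) (refl M t) (refl M s) =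
      refl M z * ralt k (refl M t) (refl M s) → len M v ≤ len M (v * refl M z) := by
    intro z hz
    by_contra! hlt
    have e2 : w = v * refl M z * ralt (k + 1) (refl M t) (refl M s) := by
      rw [hz, mul_assoc, ← mul_assoc (refl M z), refl_mul_self, one_mul, e]
    have h1 := len_mul_ralt_le (mul_mem hv (refl_mem (M := M) z)) (k + 1) t s
    rw [← e2] at h1
    exact hmin _ hlt ⟨_, mul_mem hv (refl_mem z), k + 1, rfl, by omega, e2, by omega⟩
  have inner : ∀ z, (∀ j, k = j + 1 → ralt k (refl M t) (refl M s) =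
      refl M z * ralt j (refl M t) (refl M s)) → len M v ≤ len M (v * refl M z) := by
    intro z hz
    obtain ⟨j, rfl⟩ : ∃ j, k = j + 1 := ⟨k - 1, by omega⟩
    have h1 := len_mul_ralt_le (mul_mem hv (refl_mem (M := M) z)) j t s
    rw [mul_assoc, ← hz j rfl, ← e] at h1
    omega
  refine ⟨v, hv, k, by omega, ?_, e, ?_⟩
  · intro m hm
    by_contra! hkm
    obtain ⟨j, rfl⟩ : ∃ j, k = j + m := ⟨k - m, by omega⟩
    obtain ⟨i, rfl⟩ : ∃ i, m = i + 1 := by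
      have := two_le_of_coe (hm ▸ hM.two_le hst)
      exact ⟨m - 1, by omega⟩
    have short : ∀ a b, w = v * ralt j (refl M a) (refl M b) *
        ralt i (refl M t) (refl M s) * refl M s → False := by
      intro a b e3
      have e4 := congrArg (· * refl M s) e3
      simp only [mul_assoc, refl_mul_self, mul_one] at e4
      rw [← mul_assoc] at e4
      have h1 := len_mul_ralt_le hv j a b
      have h2 := len_mul_ralt_le (mul_mem hv (ralt_refl_mem (M := M) j a b)) i t s
      rw [← e4] at h2
      omega
    have e3 := e
    rw [ralt_add, ← hM.satisfiesBraid_refl s t hst _ hm, ralt_succ, ← mul_assoc,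
      ← mul_assoc] at e3
    split_ifs at e3
    · exact short _ _ e3
    · exact short _ _ e3
  · have step : ∀ j, ralt (j + 1) (refl M t) (refl M s) =
        refl M (if j % 2 = 0 then t else s) * ralt j (refl M t) (refl M s) := by
      intro j
      rw [add_comm, ralt_add]
      split_ifs <;> simp [ralt]
    rcases Nat.mod_two_eq_zero_or_one k with h2 | h2
    · refine ⟨inner s fun j hj => ?_, outer t ?_⟩
      · rw [hj, step, if_neg (by omega)]
      · rw [step, if_pos h2]
    · refine ⟨outer s ?_, inner t fun j hj => ?_⟩
      · rw [step, if_neg (by omega)]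
      · rw [hj, step, if_pos (by omega)]

theorem root_nonneg_of_len_le (hM : Large M) {w} (hw : w ∈ W M) {s : S}
    (hs : len M w ≤ len M (w * refl M s)) : 0 ≤ w (root s) := by
  induction hn : len M w using Nat.strong_induction_on generalizing w s with
  | _ n ih =>
    by_cases h0 : len M w = 0
    · rw [eq_one_of_len_eq_zero hw h0, LinearEquiv.coe_one, id, Finsupp.single_nonneg]
      exact zero_le_one
    obtain ⟨t, ht⟩ := exists_descent hw h0
    have hst : s ≠ t := by rintro rfl; omega
    obtain ⟨v, hv, k, hlt, hk, rfl, h1, h2⟩ := exists_alternating_suffix hw ht hs hM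
    have p1 := ih _ (hn ▸ hlt) hv h1 rfl
    have p2 := ih _ (hn ▸ hlt) hv h2 rfl
    have c0 : 0 ≤ dc (M s t) k :=
      dc_nonneg (by positivity) fun m hm => by have := hk m hm; omega
    have c1 : 0 ≤ dc (M s t) (k + 1) :=
      dc_nonneg (by positivity) fun m hm => by have := hk m hm; omega
    rw [LinearEquiv.mul_apply, ralt_refl_root hM hst]
    split_ifs <;> rw [map_add, map_smul, map_smul] <;>
      exact add_nonneg (smul_nonneg ‹_› ‹_›) (smul_nonneg ‹_› ‹_›)

theorem root_nonneg_or_nonpos (hM : Large M) {w} (hw : w ∈ W M) (s : S) :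
    0 ≤ w (root s) ∨ w (root s) ≤ 0 := by
  rcases le_total (len M w) (len M (w * refl M s)) with h | h
  · exact .inl (root_nonneg_of_len_le hM hw h)
  · right
    have := root_nonneg_of_len_le hM (mul_mem hw (refl_mem s)) (s := s)
      (by rwa [mul_assoc, refl_mul_self, mul_one])
    rw [LinearEquiv.mul_apply, refl_root, map_neg] at this
    exact neg_nonneg.mp this

theorem refl_root_nonneg (hM : Large M) {w} (hw : w ∈ W M) {s x : S}
    (h0 : 0 ≤ w (root x)) (hne : w (root x) ≠ root s) : 0 ≤ refl M s (w (root x)) := by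
  rcases root_nonneg_or_nonpos hM (mul_mem (refl_mem s) hw) x with h | h
  · exact h
  exfalso
  rw [LinearEquiv.mul_apply] at h
  have hz : ∀ t, t ≠ s → w (root x) t = 0 := fun t ht => by
    have := h t
    rw [refl_apply_of_ne ht] at this
    exact le_antisymm this (h0 t)
  have e : w (root x) = w (root x) s • root s := by
    ext t
    by_cases ht : t = s
    · simp [ht]
    · simp [hz t ht, Ne.symm ht]
  have hn : form M (w (root x)) (w (root x)) = 2 := by
    rw [hM.form_W hw, form_root, gram_self]
  have hs0 : 0 ≤ w (root x) s := h0 s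
  generalize w (root x) s = c at *
  rw [e] at hn hne
  simp only [map_smul, LinearMap.smul_apply, form_root, gram_self, smul_eq_mul] at hn
  have : c = 1 := by nlinarith
  simp [this] at hne

end Artin

namespace Artin

variable {S : Type*} {M : S → S → ℕ∞} {X : Set S}

/-- The elements of the Coxeter group sending the simple roots of `X` to positive roots. -/
def Chamber (M : S → S → ℕ∞) (X : Set S) : Type _ :=
  {w : (S →₀ ℝ) ≃ₗ[ℝ] (S →₀ ℝ) // w ∈ W M ∧ ∀ x : X, 0 ≤ w (root (x : S))}

theorem root_injective : Function.Injective (root : S → (S →₀ ℝ)) :=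
  Finsupp.single_left_injective one_ne_zero

theorem not_nonneg_neg_root (s : S) : ¬ (0 : S →₀ ℝ) ≤ -root s := fun h => by
  have := h s
  simp at this
  linarith

/-- The simple root of `s` is the image of the simple root of `x`. -/
def Hit (w : Chamber M X) (s : S) (x : X) : Prop := w.1 (root (x : S)) = root s

theorem Hit.unique {w : Chamber M X} {s : S} {x y : X} (hx : Hit w s x) (hy : Hit w s y) :
    x = y :=
  Subtype.ext (root_injective (w.1.injective (hx.trans hy.symm)))

/-- Left multiplication by a simple reflection that stays in the chamber set. -/
noncomputable def move (hM : Large M) (w : Chamber M X) (s : S) (h : ¬ ∃ x, Hit w s x) :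
    Chamber M X :=
  ⟨refl M s * w.1, mul_mem (refl_mem s) w.2.1, fun x => by
    rw [LinearEquiv.mul_apply]
    exact refl_root_nonneg hM w.2.1 (w.2.2 x) fun e => h ⟨x, e⟩⟩

theorem not_hit_of_eq_refl {w w' : Chamber M X} {s : S} (h : w'.1 = refl M s * w.1) :
    ¬ ∃ x, Hit w' s x := by
  rintro ⟨x, hx⟩
  rw [Hit, h, LinearEquiv.mul_apply] at hx
  have h1 := congrArg (refl M s) hx
  rw [refl_refl, refl_root] at h1
  exact not_nonneg_neg_root s (h1 ▸ w.2.2 x)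

open Classical in
/-- The transformation of configurations attached to a generator. -/
noncomputable def actFun (hM : Large M) (u : ArtinGroup (restrict M X) → X → ArtinGroup (restrict M X))
    (s : S) (p : Chamber M X × ArtinGroup (restrict M X)) :
    Chamber M X × ArtinGroup (restrict M X) :=
  if h : ∃ x, Hit p.1 s x then (p.1, u p.2 h.choose) else (move hM p.1 s h, p.2)

theorem actFun_hit (hM : Large M) (u) {s : S} {w : Chamber M X} {x : X} (h : Hit w s x)
    (a : ArtinGroup (restrict M X)) : actFun hM u s (w, a) = (w, u a x) := by
  have h' : ∃ x, Hit w s x := ⟨x, h⟩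
  rw [actFun, dif_pos h', h'.choose_spec.unique h]

theorem actFun_move (hM : Large M) (u) {s : S} {w : Chamber M X} (h : ¬ ∃ x, Hit w s x)
    (a : ArtinGroup (restrict M X)) : actFun hM u s (w, a) = (move hM w s h, a) := by
  rw [actFun, dif_neg h]

theorem move_move (hM : Large M) {s : S} {w : Chamber M X} (h h') :
    move hM (move hM w s h) s h' = w := by
  apply Subtype.ext
  simp [move, ← mul_assoc]

theorem actFun_actFun (hM : Large M) (u v) (huv : ∀ a x, u (v a x) x = a) (s : S)
    (p : Chamber M X × ArtinGroup (restrict M X)) : actFun hM u s (actFun hM v s p) = p := by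
  obtain ⟨w, a⟩ := p
  by_cases h : ∃ x, Hit w s x
  · obtain ⟨x, hx⟩ := h
    rw [actFun_hit hM v hx, actFun_hit hM u hx, huv]
  · rw [actFun_move hM v h, actFun_move hM u (not_hit_of_eq_refl (w := w) rfl), move_move]

/-- The permutation of configurations attached to a generator. -/
noncomputable def act (hM : Large M) (X : Set S) (s : S) :
    Equiv.Perm (Chamber M X × ArtinGroup (restrict M X)) where
  toFun := actFun hM (fun a x => gen _ x * a) s
  invFun := actFun hM (fun a x => (gen _ x)⁻¹ * a) s
  left_inv := actFun_actFun hM _ _ (by simp) s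
  right_inv := actFun_actFun hM _ _ (by simp) s

theorem act_hit (hM : Large M) {s : S} {w : Chamber M X} {x : X} (h : Hit w s x)
    (a : ArtinGroup (restrict M X)) : act hM X s (w, a) = (w, gen _ x * a) :=
  actFun_hit hM (fun a x => gen _ x * a) h a

theorem act_move (hM : Large M) {s : S} {w : Chamber M X} (h : ¬ ∃ x, Hit w s x)
    (a : ArtinGroup (restrict M X)) : act hM X s (w, a) = (move hM w s h, a) :=
  actFun_move hM (fun a x => gen _ x * a) h a

theorem act_inv_hit (hM : Large M) {s : S} {w : Chamber M X} {x : X} (h : Hit w s x)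
    (a : ArtinGroup (restrict M X)) : (act hM X s)⁻¹ (w, a) = (w, (gen _ x)⁻¹ * a) :=
  actFun_hit hM (fun a x => (gen _ x)⁻¹ * a) h a

theorem act_inv_move (hM : Large M) {s : S} {w : Chamber M X} (h : ¬ ∃ x, Hit w s x)
    (a : ArtinGroup (restrict M X)) : (act hM X s)⁻¹ (w, a) = (move hM w s h, a) :=
  actFun_move hM (fun a x => (gen _ x)⁻¹ * a) h a

/-- The positive roots of a dihedral parabolic subgroup. -/
noncomputable def dihedralRoot (M : S → S → ℕ∞) (s t : S) (i : ℕ) : S →₀ ℝ :=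
  dc (M s t) (i + 1) • root s + dc (M s t) i • root t

theorem dihedralRoot_zero (hM : Large M) {s t : S} (h : s ≠ t) :
    dihedralRoot M s t 0 = root s := by
  simp [dihedralRoot, dc_one (hM.two_le h)]

theorem dihedralRoot_reflect (hM : Large M) {s t : S} (h : s ≠ t) {m i j : ℕ} (hm : M s t = m)
    (hi : i + j + 1 = m) : dihedralRoot M s t i = dihedralRoot M t s j := by
  have h2 : 2 ≤ m := two_le_of_coe (hm ▸ hM.two_le h)
  have e1 : (m : ℤ) - (i + 1) = j := by omega
  have e2 : (m : ℤ) - i = j + 1 := by omega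
  rw [dihedralRoot, dihedralRoot, hM.symm t s, hm, ← dc_reflect h2 (i + 1), ← dc_reflect h2 i, e1,
    e2, add_comm]

theorem refl_dihedralRoot (hM : Large M) {s t : S} (h : s ≠ t) (i : ℕ) :
    refl M s (dihedralRoot M t s i) = dihedralRoot M s t (i + 1) := by
  have := dc_rec (M s t) (i + 1)
  rw [add_sub_cancel_right] at this
  simp only [dihedralRoot, map_add, map_smul, refl_root, refl_root_of_ne h, hM.symm t s]
  push_cast
  rw [eq_sub_of_add_eq this]
  module

theorem index_eq_zero_of_hits (hM : Large M) {s t : S} (h : s ≠ t) {m : ℕ} (hm : M s t = m)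
    {w} (hw : w ∈ W M) {x y : S} {i j : ℕ} (hij : i < j) (hj : j < m)
    (hx : w (root x) = dihedralRoot M s t i) (hy : w (root y) = dihedralRoot M s t j) : i = 0 := by
  have h2 : 2 ≤ m := two_le_of_coe (hm ▸ hM.two_le h)
  have hpos : ∀ k : ℕ, 0 < k → k < m → 0 < dc m k := fun k h1 h2 =>
    dc_pos (by omega) fun l hl => by
      have : m = l := by exact_mod_cast hl
      omega
  have hcross := dc_cross (m := (m : ℕ∞)) (by exact_mod_cast h2) (i + 1) (j + 1)
  have hsub := hpos (j - i) (by omega) (by omega)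
  rw [Nat.cast_sub hij.le] at hsub
  rw [add_sub_cancel_right, add_sub_cancel_right, add_sub_add_right_eq_sub] at hcross
  have key : dc m j • w (root x) - dc m i • w (root y) = dc m (j - i) • root s := by
    rw [hx, hy, dihedralRoot, dihedralRoot, hm, ← hcross]
    module
  by_contra hi
  have hxy : x ≠ y := by
    rintro rfl
    have e := hx.symm.trans hy
    have e1 := DFunLike.congr_fun e s
    have e2 := DFunLike.congr_fun e t
    simp [dihedralRoot, h, h.symm, hm] at e1 e2
    rw [e1, e2] at hcross
    linarith
  have key2 : dc m j • root x - dc m i • root y = dc m (j - i) • w⁻¹ (root s) := by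
    apply w.injective
    rw [map_sub, map_smul, map_smul, key, map_smul, ← LinearEquiv.mul_apply, mul_inv_cancel,
      LinearEquiv.coe_one, id]
  have sgn := root_nonneg_or_nonpos hM (inv_mem hw) s
  generalize w⁻¹ (root s) = v at key2 sgn
  have p1 := hpos j (by omega) hj
  have p2 := hpos i (by omega) (by omega)
  have k1 := DFunLike.congr_fun key2 x
  have k2 := DFunLike.congr_fun key2 y
  simp [hxy, hxy.symm] at k1 k2
  rcases sgn with hs | hs
  · have : 0 ≤ v y := hs y
    have : 0 ≤ dc m (j - i) * v y := mul_nonneg hsub.le this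
    linarith
  · have : v x ≤ 0 := hs x
    have : dc m (j - i) * v x ≤ 0 := mul_nonpos_of_nonneg_of_nonpos hsub.le this
    linarith

theorem refl_mul_eq (hM : Large M) {w} (hw : w ∈ W M) {s x : S} (h : w (root x) = root s) :
    refl M s * w = w * refl M x := by
  refine LinearEquiv.ext fun v => ?_
  rw [LinearEquiv.mul_apply, LinearEquiv.mul_apply, refl_apply, refl_apply, map_sub, map_smul, h,
    ← h, hM.form_W hw]

theorem free_run (hM : Large M) (k : ℕ) {s t : S} (h : s ≠ t) (w : Chamber M X)
    (hw : ∀ x : X, ∀ i < k, w.1 (root (x : S)) ≠ dihedralRoot M s t i) :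
    ∃ w' : Chamber M X, w'.1 = ralt k (refl M s) (refl M t) * w.1 ∧
      ∀ a, ralt k (act hM X s) (act hM X t) (w, a) = (w', a) := by
  induction k generalizing s t w with
  | zero => exact ⟨w, by simp, by simp⟩
  | succ k ih =>
    have hs : ¬ ∃ x, Hit w s x := by
      rintro ⟨x, hx⟩
      exact hw x 0 (by omega) (by rw [dihedralRoot_zero hM h]; exact hx)
    obtain ⟨w', e, h'⟩ := ih h.symm (move hM w s hs) fun x i hi hx =>
      hw x (i + 1) (by omega) (by
        have := congrArg (refl M s) hx
        rw [refl_dihedralRoot hM h] at this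
        simpa [move] using this)
    refine ⟨w', by rw [e, ralt_succ, mul_assoc]; rfl, fun a => ?_⟩
    rw [ralt_succ, Equiv.Perm.mul_apply, act_move hM hs, h']

theorem one_hit_run (hM : Large M) (j l : ℕ) {s t : S} (h : s ≠ t) {m : ℕ} (hm : M s t = m)
    (hl : j + 1 + l ≤ m) (w : Chamber M X) (x : X)
    (hx : w.1 (root (x : S)) = dihedralRoot M s t j)
    (hw : ∀ y : X, ∀ i < j, w.1 (root (y : S)) ≠ dihedralRoot M s t i)
    (hj : j = 0 → ∀ y, ¬ Hit w t y) :
    ∃ w' : Chamber M X, w'.1 = ralt (j + 1 + l) (refl M s) (refl M t) * w.1 * refl M (x : S) ∧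
      ∀ a, ralt (j + 1 + l) (act hM X s) (act hM X t) (w, a) = (w', gen _ x * a) := by
  induction j generalizing s t w with
  | zero =>
    rw [dihedralRoot_zero hM h] at hx
    have hm' : M t s = m := by rw [hM.symm, hm]
    obtain ⟨w', e, h'⟩ := free_run hM l h.symm w fun y i hi hy => by
      have := index_eq_zero_of_hits hM h.symm hm' w.2.1 (j := m - 1) (by omega) (by omega) hy
        (by rw [hx, ← dihedralRoot_reflect hM h hm (i := 0) (by omega), dihedralRoot_zero hM h])
      subst this
      rw [dihedralRoot_zero hM h.symm] at hy
      exact hj rfl y hy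
    refine ⟨w', ?_, fun a => ?_⟩
    · rw [e, add_comm, zero_add, ralt_succ, mul_assoc, mul_assoc, ← refl_mul_eq hM w.2.1 hx,
        ← mul_assoc (refl M s), refl_mul_self, one_mul]
    · rw [add_comm, zero_add, ralt_succ, Equiv.Perm.mul_apply, act_hit hM hx, h']
  | succ j ih =>
    have hs : ¬ ∃ x, Hit w s x := by
      rintro ⟨x, hx⟩
      exact hw x 0 (by omega) (by rw [dihedralRoot_zero hM h]; exact hx)
    have pull : ∀ y : X, ∀ i, (move hM w s hs).1 (root (y : S)) = dihedralRoot M t s i ↔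
        w.1 (root (y : S)) = dihedralRoot M s t (i + 1) := by
      intro y i
      rw [← refl_dihedralRoot hM h, ← (refl M s).injective.eq_iff]
      simp [move]
    obtain ⟨w', e, h'⟩ := ih h.symm (by rw [hM.symm, hm]) (by omega) (move hM w s hs)
      ((pull _ _).2 hx) (fun y i hi hy => hw y (i + 1) (by omega) ((pull _ _).1 hy))
      (fun _ y hy => not_hit_of_eq_refl (w := w) rfl ⟨y, hy⟩)
    have en : j + 1 + 1 + l = j + 1 + l + 1 := by omega
    refine ⟨w', ?_, fun a => ?_⟩
    · rw [e, en, ralt_succ]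
      simp [move, mul_assoc]
    · rw [en, ralt_succ, Equiv.Perm.mul_apply, act_move hM hs, h']

theorem two_hit_run (hM : Large M) (k : ℕ) {s t : S} (w : Chamber M X) {x y : X}
    (hx : Hit w s x) (hy : Hit w t y) (a : ArtinGroup (restrict M X)) :
    ralt k (act hM X s) (act hM X t) (w, a) = (w, ralt k (gen _ x) (gen _ y) * a) := by
  induction k generalizing s t x y a with
  | zero => simp
  | succ k ih =>
    rw [ralt_succ, Equiv.Perm.mul_apply, act_hit hM hx, ih hy hx, ralt_succ, mul_assoc]

theorem lam_injective {m n : ℕ∞} (hm : 2 ≤ m) (hn : 2 ≤ n) (h : lam m = lam n) : m = n := by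
  induction m using ENat.recTopCoe with
  | top =>
    induction n using ENat.recTopCoe with
    | top => rfl
    | coe n =>
      rw [lam_top] at h
      exact absurd h.symm (lam_lt_two (two_le_of_coe hn)).ne
  | coe m =>
    induction n using ENat.recTopCoe with
    | top =>
      rw [lam_top] at h
      exact absurd h (lam_lt_two (two_le_of_coe hm)).ne
    | coe n =>
      rw [lam_coe, lam_coe] at h
      have h1 := two_le_of_coe hm
      have h2 := two_le_of_coe hn
      have angle : ∀ k : ℕ, 2 ≤ k → Real.pi / k ∈ Set.Icc 0 Real.pi := fun k hk =>
        ⟨by positivity, div_le_self Real.pi_pos.le (by exact_mod_cast (by omega : 1 ≤ k))⟩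
      have := Real.injOn_cos (angle m h1) (angle n h2) (by linarith)
      rw [div_eq_div_iff (by positivity) (by positivity),
        mul_right_inj' Real.pi_pos.ne'] at this
      exact_mod_cast this.symm

theorem label_eq_of_hits (hM : Large M) {s t : S} (h : s ≠ t) {w : Chamber M X} {x y : X}
    (hx : Hit w s x) (hy : Hit w t y) : x ≠ y ∧ restrict M X x y = M s t := by
  have hxy : x ≠ y := by
    rintro rfl
    exact h (root_injective (hx.symm.trans hy))
  have hxy' : (x : S) ≠ y := fun e => hxy (Subtype.ext e)
  refine ⟨hxy, ?_⟩
  have := hM.form_W w.2.1 (root (x : S)) (root (y : S))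
  rw [hx, hy, form_root, form_root, gram_of_ne h, gram_of_ne hxy', neg_inj] at this
  exact (lam_injective (hM.two_le h) (hM.two_le hxy') this).symm

theorem satisfiesBraid_act (hM : Large M) (X : Set S) : SatisfiesBraid M (act hM X) := by
  intro s t h m hm
  have h2 : 2 ≤ m := two_le_of_coe (hm ▸ hM.two_le h)
  have hm' : M t s = m := by rw [hM.symm, hm]
  refine Equiv.ext ?_
  rintro ⟨w, a⟩
  by_cases h0 : ∃ x : X, ∃ j < m, w.1 (root (x : S)) = dihedralRoot M s t j
  swap
  · push Not at h0
    obtain ⟨w₁, e₁, h₁⟩ := free_run hM m h w h0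
    obtain ⟨w₂, e₂, h₂⟩ := free_run hM m h.symm w fun x i hi hx =>
      h0 x (m - 1 - i) (by omega) (hx.trans (dihedralRoot_reflect hM h.symm hm' (by omega)))
    rw [h₁, h₂]
    have : w₁ = w₂ := Subtype.ext (by rw [e₁, e₂, hM.satisfiesBraid_refl s t h m hm])
    rw [this]
  obtain ⟨x, j, hj, hx⟩ := h0
  by_cases h1 : ∃ x y, Hit w s x ∧ Hit w t y
  · obtain ⟨x, y, hx, hy⟩ := h1
    obtain ⟨hxy, e⟩ := label_eq_of_hits hM h hx hy
    rw [two_hit_run hM m w hx hy, two_hit_run hM m w hy hx,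
      satisfiesBraid_gen _ x y hxy m (e.trans hm)]
  have only : ∀ y : X, ∀ i < m, w.1 (root (y : S)) = dihedralRoot M s t i → i = j := by
    have main : ∀ y z : X, ∀ i k, i < k → k < m → w.1 (root (y : S)) = dihedralRoot M s t i →
        w.1 (root (z : S)) = dihedralRoot M s t k → False := by
      intro y z i k hik hk hy hz
      have i0 := index_eq_zero_of_hits hM h hm w.2.1 hik hk hy hz
      have k0 := index_eq_zero_of_hits hM h.symm hm' w.2.1 (i := m - 1 - k) (j := m - 1 - i)
        (by omega) (by omega) (hz.trans (dihedralRoot_reflect hM h hm (by omega)))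
        (hy.trans (dihedralRoot_reflect hM h hm (by omega)))
      subst i0
      rw [dihedralRoot_zero hM h] at hy
      rw [dihedralRoot_reflect hM h hm (j := 0) (by omega), dihedralRoot_zero hM h.symm] at hz
      exact h1 ⟨y, z, hy, hz⟩
    intro y i hi hy
    rcases lt_trichotomy i j with hij | hij | hij
    · exact (main y x i j hij hj hy hx).elim
    · exact hij
    · exact (main x y j i hij hi hx hy).elim
  obtain ⟨w₁, e₁, h₁⟩ := one_hit_run hM j (m - 1 - j) h hm (by omega) w x hx
    (fun y i hi hy => by have := only y i (by omega) hy; omega)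
    (fun j0 y hy => by
      subst j0
      rw [dihedralRoot_zero hM h] at hx
      exact h1 ⟨x, y, hx, hy⟩)
  have hx' := hx.trans (dihedralRoot_reflect hM h hm (j := m - 1 - j) (by omega))
  obtain ⟨w₂, e₂, h₂⟩ := one_hit_run hM (m - 1 - j) j h.symm hm' (by omega) w x hx'
    (fun y i hi hy => by
      have := only y (m - 1 - i) (by omega)
        (hy.trans (dihedralRoot_reflect hM h.symm hm' (by omega)))
      omega)
    (fun j0 y hy => by
      rw [j0, dihedralRoot_zero hM h.symm] at hx'
      exact h1 ⟨y, x, hy, hx'⟩)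
  rw [show j + 1 + (m - 1 - j) = m by omega] at e₁ h₁
  rw [show m - 1 - j + 1 + j = m by omega] at e₂ h₂
  rw [h₁, h₂]
  have : w₁ = w₂ := Subtype.ext (by rw [e₁, e₂, hM.satisfiesBraid_refl s t h m hm])
  rw [this]

end Artin

namespace Artin

variable {S : Type*} {M : S → S → ℕ∞} {X : Set S}

/-- The action of the Artin group on configurations. -/
noncomputable def theta (hM : Large M) (X : Set S) :
    ArtinGroup M →* Equiv.Perm (Chamber M X × ArtinGroup (restrict M X)) :=
  liftHom (act hM X) (satisfiesBraid_act hM X)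

/-- The identity chamber. -/
noncomputable def baseChamber (M : S → S → ℕ∞) (X : Set S) : Chamber M X :=
  ⟨1, one_mem _, fun x => by
    rw [LinearEquiv.coe_one, id, Finsupp.single_nonneg]
    exact zero_le_one⟩

theorem hit_base (x : X) : Hit (baseChamber M X) x x := rfl

theorem theta_incl (hM : Large M) (h a : ArtinGroup (restrict M X)) :
    theta hM X (incl M X h) (baseChamber M X, a) = (baseChamber M X, h * a) := by
  induction h using artin_induction generalizing a with
  | one => simp
  | gen_mul s g ih =>
    rw [map_mul, map_mul, Equiv.Perm.mul_apply, ih, incl_gen, theta, liftHom_gen,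
      act_hit hM (hit_base s), mul_assoc]
  | inv_mul s g ih =>
    rw [map_mul, map_mul, Equiv.Perm.mul_apply, ih, map_inv, map_inv, incl_gen, theta, liftHom_gen,
      act_inv_hit hM (hit_base s), mul_assoc]

theorem incl_injective (hM : Large M) (X : Set S) : Function.Injective (incl M X) := by
  intro a b h
  have h1 := theta_incl hM a 1
  rw [h, theta_incl] at h1
  simpa using (congrArg Prod.snd h1).symm

/-- Right translation of configurations. -/
noncomputable def translate (M : S → S → ℕ∞) {X : Set S} (b : ArtinGroup (restrict M X)) :
    Equiv.Perm (Chamber M X × ArtinGroup (restrict M X)) :=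
  (Equiv.refl _).prodCongr (Equiv.mulRight b)

@[simp] theorem translate_apply (b a : ArtinGroup (restrict M X)) (w : Chamber M X) :
    translate M b (w, a) = (w, a * b) := rfl

theorem commute_theta_translate (hM : Large M) (g : ArtinGroup M) (b : ArtinGroup (restrict M X)) :
    Commute (theta hM X g) (translate M b) := by
  have main : ∀ s, Commute (theta hM X (gen M s)) (translate M b) := by
    intro s
    rw [theta, liftHom_gen]
    refine Equiv.ext ?_
    rintro ⟨w, a⟩
    by_cases h : ∃ x, Hit w s x
    · obtain ⟨x, hx⟩ := h
      simp [act_hit hM hx, mul_assoc]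
    · simp [act_move hM h]
  induction g using artin_induction with
  | one => simp
  | gen_mul s g ih =>
    rw [map_mul]
    exact (main s).mul_left ih
  | inv_mul s g ih =>
    rw [map_mul, map_inv]
    exact (main s).inv_left.mul_left ih

theorem theta_translate (hM : Large M) (g : ArtinGroup M) (w : Chamber M X)
    (a b : ArtinGroup (restrict M X)) :
    theta hM X g (w, a * b) = ((theta hM X g (w, a)).1, (theta hM X g (w, a)).2 * b) :=
  DFunLike.congr_fun (commute_theta_translate hM g b).eq (w, a)

/-- The intersection of two standard parabolic subgroups is standard parabolic. -/
theorem standardParabolic_inter (hM : Large M) {X Z : Set S} {g : ArtinGroup M}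
    (hX : g ∈ StandardParabolic M X) (hZ : g ∈ StandardParabolic M Z) :
    g ∈ StandardParabolic M (X ∩ Z) := by
  set Y : Set X := {x | (x : S) ∈ Z} with hY
  have key : (∀ v, ∀ t ∉ Z, (theta hM X g (baseChamber M X, 1)).1.1 v t = v t) ∧
      (theta hM X g (baseChamber M X, 1)).2 ∈ StandardParabolic (restrict M X) Y := by
    have hitZ : ∀ (w : Chamber M X) s x, s ∈ Z → (∀ v, ∀ t ∉ Z, w.1 v t = v t) → Hit w s x →
        x ∈ Y := by
      intro w s x hs hw hx
      by_contra hxZ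
      have h1 := hw (root (x : S)) x hxZ
      rw [hx] at h1
      have hne : (x : S) ≠ s := by
        rintro rfl
        exact hxZ hs
      simp [hne.symm] at h1
    have moveZ : ∀ (w : Chamber M X) s, s ∈ Z → (∀ v, ∀ t ∉ Z, w.1 v t = v t) →
        ∀ h, ∀ v, ∀ t ∉ Z, (move hM w s h).1 v t = v t := by
      intro w s hs hw h v t ht
      have hne : t ≠ s := by
        rintro rfl
        exact ht hs
      rw [move, LinearEquiv.mul_apply, refl_apply_of_ne hne, hw v t ht]
    refine parabolic_induction (X := Z) (p := fun g =>
      (∀ v, ∀ t ∉ Z, (theta hM X g (baseChamber M X, 1)).1.1 v t = v t) ∧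
      (theta hM X g (baseChamber M X, 1)).2 ∈ StandardParabolic (restrict M X) Y) ?_ ?_ ?_ hZ
    · exact ⟨fun v t _ => by simp [baseChamber], by simp⟩
    · intro s hs g ih
      rw [map_mul, Equiv.Perm.mul_apply]
      generalize theta hM X g (baseChamber M X, 1) = q at ih
      obtain ⟨w, a⟩ := q
      rw [theta, liftHom_gen]
      by_cases h : ∃ x, Hit w s x
      · obtain ⟨x, hx⟩ := h
        rw [act_hit hM hx]
        exact ⟨ih.1, mul_mem (gen_mem_standardParabolic (hitZ w s x hs ih.1 hx)) ih.2⟩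
      · rw [act_move hM h]
        exact ⟨moveZ w s hs ih.1 h, ih.2⟩
    · intro s hs g ih
      rw [map_mul, map_inv, Equiv.Perm.mul_apply]
      generalize theta hM X g (baseChamber M X, 1) = q at ih
      obtain ⟨w, a⟩ := q
      rw [theta, liftHom_gen]
      by_cases h : ∃ x, Hit w s x
      · obtain ⟨x, hx⟩ := h
        rw [act_inv_hit hM hx]
        exact ⟨ih.1, mul_mem (inv_mem (gen_mem_standardParabolic (hitZ w s x hs ih.1 hx))) ih.2⟩
      · rw [act_inv_move hM h]
        exact ⟨moveZ w s hs ih.1 h, ih.2⟩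
  rw [← range_incl] at hX
  obtain ⟨h, rfl⟩ := hX
  rw [theta_incl, mul_one] at key
  have := Subgroup.mem_map_of_mem (incl M X) key.2
  rw [map_incl_standardParabolic] at this
  refine standardParabolic_mono ?_ this
  rintro _ ⟨x, hx, rfl⟩
  exact ⟨x.2, hx⟩

theorem mem_conjSubgroup {G : Type*} [Group G] {g x : G} {H : Subgroup G} :
    x ∈ conjSubgroup g H ↔ g⁻¹ * x * g ∈ H := by
  rw [conjSubgroup, Subgroup.mem_map_equiv, MulAut.conj_symm_apply]

theorem conjSubgroup_le_iff {G : Type*} [Group G] {g : G} {H K : Subgroup G} :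
    conjSubgroup g H ≤ K ↔ ∀ x ∈ H, g * x * g⁻¹ ∈ K := by
  rw [conjSubgroup, Subgroup.map_le_iff_le_comap]
  exact Iff.rfl

theorem conjSubgroup_standardParabolic (g : ArtinGroup M) (Y : Set S) :
    conjSubgroup g (StandardParabolic M Y) =
      Subgroup.closure ((fun s => g * gen M s * g⁻¹) '' Y) := by
  rw [conjSubgroup, StandardParabolic, MonoidHom.map_closure, Set.image_image]
  rfl

/-- A parabolic subgroup contained in a standard parabolic subgroup is conjugate inside it to a
standard parabolic subgroup. -/
theorem conj_le_standardParabolic (hM : Large M) {h : ArtinGroup M} {X Y : Set S}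
    (hle : conjSubgroup h (StandardParabolic M Y) ≤ StandardParabolic M X) :
    ∃ (a : ArtinGroup (restrict M X)) (Z : Set X), conjSubgroup h (StandardParabolic M Y) =
      conjSubgroup (incl M X a) (StandardParabolic M (Subtype.val '' Z)) := by
  set q := theta hM X h⁻¹ (baseChamber M X, 1) with hq
  have key : ∀ y ∈ Y, ∃ x, Hit q.1 y x ∧
      h * gen M y * h⁻¹ = (incl M X q.2)⁻¹ * gen M x * incl M X q.2 := by
    intro y hy
    have hmem : h * gen M y * h⁻¹ ∈ StandardParabolic M X :=
      conjSubgroup_le_iff.1 hle _ (gen_mem_standardParabolic hy)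
    rw [← range_incl] at hmem
    obtain ⟨b, hb⟩ := hmem
    have e : gen M y * h⁻¹ = h⁻¹ * incl M X b := by rw [hb]; group
    have e2 := congrArg (fun g => theta hM X g (baseChamber M X, 1)) e
    simp only [map_mul, Equiv.Perm.mul_apply] at e2
    rw [theta_incl, mul_one, ← one_mul b, theta_translate, ← hq] at e2
    generalize q = q at e2 ⊢
    obtain ⟨w, c⟩ := q
    rw [theta, liftHom_gen] at e2
    by_cases hh : ∃ x, Hit w y x
    · obtain ⟨x, hx⟩ := hh
      refine ⟨x, hx, ?_⟩
      rw [act_hit hM hx] at e2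
      have e3 : gen _ x * c = c * b := congrArg Prod.snd e2
      have e4 : b = c⁻¹ * gen _ x * c := by rw [mul_assoc, e3, inv_mul_cancel_left]
      rw [← hb, e4]
      simp
    · rw [act_move hM hh] at e2
      have e3 : refl M y * w.1 = w.1 := congrArg (fun p => p.1.1) e2
      rw [mul_eq_right] at e3
      have e4 := refl_root (M := M) y
      rw [e3, LinearEquiv.coe_one, id] at e4
      have := DFunLike.congr_fun e4 y
      simp at this
      norm_num at this
  refine ⟨q.2⁻¹, {x | ∃ y ∈ Y, Hit q.1 y x}, ?_⟩
  rw [conjSubgroup_standardParabolic, conjSubgroup_standardParabolic, Set.image_image]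
  congr 1
  ext g
  constructor
  · rintro ⟨y, hy, rfl⟩
    obtain ⟨x, hx, e⟩ := key y hy
    exact ⟨x, ⟨y, hy, hx⟩, by simp [e]⟩
  · rintro ⟨x, ⟨y, hy, hx⟩, rfl⟩
    obtain ⟨x', hx', e⟩ := key y hy
    obtain rfl := hx.unique hx'
    exact ⟨y, hy, by simp [e]⟩

end Artin

namespace Artin

/-- The real two by two matrices. -/
abbrev Mat2 := Matrix (Fin 2) (Fin 2) ℝ

/-- The image of the quarter turn. -/
def matS : Mat2ˣ where
  val := !![0, -1; 1, 0]
  inv := !![0, 1; -1, 0]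
  val_inv := by ext i j; fin_cases i <;> fin_cases j <;> simp
  inv_val := by ext i j; fin_cases i <;> fin_cases j <;> simp

/-- The image of the rotation. -/
noncomputable def matR (m : ℕ∞) : Mat2ˣ where
  val := !![lam m, -1; 1, 0]
  inv := !![0, 1; -1, lam m]
  val_inv := by ext i j; fin_cases i <;> fin_cases j <;> simp
  inv_val := by ext i j; fin_cases i <;> fin_cases j <;> simp

theorem matS_val : (matS : Mat2) = !![0, -1; 1, 0] := rfl

theorem matS_inv_val : ((matS⁻¹ : Mat2ˣ) : Mat2) = !![0, 1; -1, 0] := rfl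

theorem matR_val (m : ℕ∞) : (matR m : Mat2) = !![lam m, -1; 1, 0] := rfl

theorem matR_inv_val (m : ℕ∞) : (((matR m)⁻¹ : Mat2ˣ) : Mat2) = !![0, 1; -1, lam m] := rfl

theorem matR_zpow {m : ℕ∞} (hm : 2 ≤ m) (i : ℤ) : ((matR m ^ i : Mat2ˣ) : Mat2) =
    !![dc m (i + 1), -dc m i; dc m i, -dc m (i - 1)] := by
  induction i using Int.induction_on with
  | zero =>
    ext i j
    fin_cases i <;> fin_cases j <;> simp [dc_one hm, dc_neg]
  | succ i ih =>
    have h := dc_rec m (i + 1)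
    have h' := dc_rec m i
    rw [add_sub_cancel_right] at h
    rw [zpow_add_one, Units.val_mul, ih, matR_val]
    ext i j
    fin_cases i <;> fin_cases j <;> simp <;> linarith
  | pred i ih =>
    have h := dc_rec m (-i)
    have h' := dc_rec m (-i - 1)
    rw [sub_add_cancel] at h'
    rw [zpow_sub_one, Units.val_mul, ih, matR_inv_val]
    ext i j
    fin_cases i <;> fin_cases j <;> simp <;> linarith

/-- The exponent of the rotation that becomes central, with value zero for the label `⊤`. -/
noncomputable def per (m : ℕ∞) : ℤ := m.toNat

/-- Reduced nonzero exponents. -/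
def Adm (m : ℕ∞) (i : ℤ) : Prop := i % per m = i ∧ i ≠ 0

theorem matR_zpow_per {m : ℕ∞} (hm : 2 ≤ m) :
    ((matR m ^ per m : Mat2ˣ) : Mat2) = 1 ∨ ((matR m ^ per m : Mat2ˣ) : Mat2) = -1 := by
  induction m using ENat.recTopCoe with
  | top => simp [per]
  | coe m =>
    have h2 := two_le_of_coe hm
    right
    rw [matR_zpow hm, per, ENat.toNat_natCast, dc_label h2, add_comm, dc_add_label h2, dc_reflect h2,
      dc_one hm]
    ext i j
    fin_cases i <;> fin_cases j <;> simp

theorem adm_sign {m : ℕ∞} (hm : 3 ≤ m) {i : ℤ} (hi : Adm m i) : ∃ e : ℝ, (e = 1 ∨ e = -1) ∧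
    0 < e * dc m i ∧ 0 ≤ e * dc m (i + 1) ∧ 0 ≤ e * dc m (i - 1) ∧
    0 < e * dc m (i + 1) + e * dc m (i - 1) ∧ (e * dc m (i - 1) = 0 → i = 1) ∧
    (e * dc m (i + 1) = 0 → (i + 1) % per m = 0) := by
  have off : ∀ e : ℝ, 0 < e * dc m i → 0 < e * dc m (i + 1) + e * dc m (i - 1) := by
    intro e he
    rw [← mul_add, dc_rec, mul_left_comm]
    exact mul_pos (lam_pos hm) he
  induction m using ENat.recTopCoe with
  | top =>
    simp only [dc_top] at *
    rcases lt_or_gt_of_ne hi.2 with h | h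
    · have h1 : (i : ℝ) ≤ -1 := by exact_mod_cast (by omega : i ≤ -1)
      refine ⟨-1, .inr rfl, by linarith, by push_cast; linarith, by push_cast; linarith,
        off _ (by linarith), ?_, ?_⟩
      · push_cast
        intro h2
        linarith
      · intro h2
        have : ((i + 1 : ℤ) : ℝ) = 0 := by linarith
        rw [Int.cast_eq_zero.1 this, Int.zero_emod]
    · have h1 : (1 : ℝ) ≤ i := by exact_mod_cast (by omega : 1 ≤ i)
      refine ⟨1, .inl rfl, by linarith, by push_cast; linarith, by push_cast; linarith,
        off _ (by linarith), ?_, ?_⟩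
      · intro h2
        have : ((i - 1 : ℤ) : ℝ) = 0 := by linarith
        have := Int.cast_eq_zero.1 this
        omega
      · push_cast
        intro h2
        linarith
  | coe m =>
    have h2 : 3 ≤ m := by exact_mod_cast hm
    have hp : per m = m := rfl
    obtain ⟨h3, h4⟩ := hi
    rw [hp] at h3
    have h5 : 0 ≤ i := h3 ▸ Int.emod_nonneg _ (by omega)
    have h6 : i < m := h3 ▸ Int.emod_lt_of_pos _ (by omega)
    have pos : ∀ k : ℤ, 0 < k → k < m → 0 < dc m k := fun k h1 h2 =>
      dc_pos h1 fun l hl => by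
        have : m = l := by exact_mod_cast hl
        omega
    have nonneg : ∀ k : ℤ, 0 ≤ k → k ≤ m → 0 ≤ dc m k := fun k h1 h2 =>
      dc_nonneg h1 fun l hl => by
        have : m = l := by exact_mod_cast hl
        omega
    simp only [hp]
    have p0 := pos i (by omega) h6
    have p1 := nonneg (i + 1) (by omega) (by omega)
    have p2 := nonneg (i - 1) (by omega) (by omega)
    refine ⟨1, .inl rfl, by linarith, by linarith, by linarith, off _ (by linarith), ?_, ?_⟩
    · intro h
      by_contra hne
      have := pos (i - 1) (by omega) (by omega)
      linarith
    · intro h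
      by_contra hne
      have hne' : i + 1 ≠ m := fun e => hne (by rw [e, Int.emod_self])
      have := pos (i + 1) (by omega) (by omega)
      linarith

/-- Matrices with nonnegative entries and positive diagonal. -/
def Pos (A : Mat2) : Prop := 0 < A 0 0 ∧ 0 < A 1 1 ∧ 0 ≤ A 0 1 ∧ 0 ≤ A 1 0

/-- A group with two distinguished elements generating it, and enough homomorphisms to recognize
its elements; it contains the dihedral Artin group of the given label. -/
structure Dihedral (m : ℕ∞) (H : Type*) [Group H] where
  /-- the element of order two modulo the center -/
  σ : H
  /-- the rotation -/
  y : H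
  closure_eq : Subgroup.closure {σ, y} = ⊤
  sq_comm : ∀ h, Commute (σ ^ 2) h
  per_comm : ∀ h, Commute (y ^ per m) h
  /-- the linear representation -/
  ψ : H →* Mat2ˣ
  ψ_σ : ψ σ = matS
  ψ_y : ψ y = matR m
  /-- the first degree -/
  d₁ : H →* Multiplicative ℤ
  /-- the second degree -/
  d₂ : H →* Multiplicative ℤ
  d₁_σ : d₁ σ = 1
  d₁_y : d₁ y = Multiplicative.ofAdd 1
  d₂_σ : d₂ σ = Multiplicative.ofAdd 1
  d₂_y : d₂ y = Multiplicative.ofAdd 1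

namespace Dihedral

variable {m : ℕ∞} {H : Type*} [Group H] (D : Dihedral m H)

/-- The distinguished central subgroup. -/
def C : Subgroup H := Subgroup.closure {D.σ ^ 2, D.y ^ per m}

theorem sq_mem : D.σ ^ 2 ∈ D.C := Subgroup.subset_closure (by simp)

theorem per_mem : D.y ^ per m ∈ D.C := Subgroup.subset_closure (by simp)

variable {D} in
theorem comm_of_mem {c : H} (hc : c ∈ D.C) (h : H) : Commute c h := by
  refine Subgroup.closure_induction (p := fun c _ => Commute c h) ?_ (Commute.one_left h)
    (fun _ _ _ _ h1 h2 => h1.mul_left h2) (fun _ _ h1 => h1.inv_left) hc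
  rintro _ (rfl | rfl)
  · exact D.sq_comm h
  · exact D.per_comm h

variable {D} in
theorem exists_of_mem {c : H} (hc : c ∈ D.C) : ∃ p q : ℤ, c = D.σ ^ (2 * p) * D.y ^ (per m * q) := by
  refine Subgroup.closure_induction_left (p := fun c _ => ∃ p q : ℤ,
    c = D.σ ^ (2 * p) * D.y ^ (per m * q)) ⟨0, 0, by simp⟩ ?_ ?_ hc
  · rintro _ (rfl | rfl) _ _ ⟨p, q, rfl⟩
    · exact ⟨p + 1, q, by rw [mul_add, add_comm, zpow_add, mul_assoc, mul_one, zpow_ofNat]⟩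
    · exact ⟨p, q + 1, by
        rw [← mul_assoc, (D.per_comm _).eq, mul_add, add_comm, mul_one, zpow_add, mul_assoc]⟩
  · rintro _ (rfl | rfl) _ _ ⟨p, q, rfl⟩
    · exact ⟨p - 1, q, by
        rw [mul_sub, sub_eq_add_neg, add_comm, zpow_add, mul_assoc, mul_one, zpow_neg, zpow_ofNat]⟩
    · exact ⟨p, q - 1, by
        rw [← mul_assoc, (D.per_comm _).inv_left.eq, mul_sub, sub_eq_add_neg, add_comm, mul_one,
          zpow_add, mul_assoc, zpow_neg]⟩

theorem y_zpow_eq (i : ℤ) : ∃ c ∈ D.C, D.y ^ i = c * D.y ^ (i % per m) := by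
  refine ⟨D.y ^ (per m * (i / per m)), ?_, ?_⟩
  · rw [zpow_mul]
    exact zpow_mem D.per_mem _
  · rw [← zpow_add, Int.mul_ediv_add_emod]

variable {D} in
theorem ψ_of_mem (hm : 2 ≤ m) {c : H} (hc : c ∈ D.C) :
    (D.ψ c : Mat2) = 1 ∨ (D.ψ c : Mat2) = -1 := by
  have inv : ∀ A : Mat2ˣ, (A : Mat2) = -1 → ((A⁻¹ : Mat2ˣ) : Mat2) = -1 := by
    intro A h
    have := A.inv_mul
    rw [h, mul_neg, mul_one] at this
    rw [← this, neg_neg]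
  refine Subgroup.closure_induction (p := fun c _ => (D.ψ c : Mat2) = 1 ∨ (D.ψ c : Mat2) = -1)
    ?_ (by simp) ?_ ?_ hc
  · rintro _ (rfl | rfl)
    · right
      rw [map_pow, D.ψ_σ, Units.val_pow_eq_pow_val, matS_val, sq]
      ext i j
      fin_cases i <;> fin_cases j <;> simp
    · rw [map_zpow, D.ψ_y]
      exact matR_zpow_per hm
  · rintro x y _ _ (h1 | h1) (h2 | h2) <;> simp [h1, h2]
  · rintro x _ (h | h)
    · left
      rw [map_inv, Units.val_eq_one.1 h, inv_one, Units.val_one]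
    · right
      rw [map_inv, inv _ h]

/-- The product of the blocks attached to a list of exponents. -/
def blocks (l : List ℤ) : H := (l.map fun i => D.y ^ i * D.σ).prod

@[simp] theorem blocks_nil : D.blocks [] = 1 := rfl

@[simp] theorem blocks_cons (i : ℤ) (l : List ℤ) :
    D.blocks (i :: l) = D.y ^ i * D.σ * D.blocks l := by simp [blocks]

@[simp] theorem blocks_append (l l' : List ℤ) :
    D.blocks (l ++ l') = D.blocks l * D.blocks l' := by simp [blocks]

theorem blocks_pos (hm : 3 ≤ m) (l : List ℤ) (hl : ∀ i ∈ l, Adm m i) :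
    ∃ e : ℝ, (e = 1 ∨ e = -1) ∧ ∃ A : Mat2, (D.ψ (D.blocks l) : Mat2) = e • A ∧ Pos A ∧
      (l ≠ [] → 0 < A 0 1 + A 1 0) ∧ (A 1 0 = 0 → ∀ i ∈ l, i = 1) ∧
      (A 0 1 = 0 → ∀ i ∈ l, (i + 1) % per m = 0) := by
  induction l with
  | nil => exact ⟨1, .inl rfl, 1, by simp, by simp [Pos], by simp, by simp, by simp⟩
  | cons i l ih =>
    obtain ⟨e, he, A, hA, ⟨a1, a2, a3, a4⟩, -, a5, a6⟩ := ih fun j hj => hl j (by simp [hj])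
    obtain ⟨f, hf, p1, p2, p3, p4, p5, p6⟩ := adm_sign hm (hl i (by simp))
    set x := f * dc m i
    set z := f * dc m (i + 1)
    set w := f * dc m (i - 1)
    have ff : f * f = 1 := by rcases hf with rfl | rfl <;> norm_num
    have hV : ((D.ψ (D.y ^ i * D.σ) : Mat2ˣ) : Mat2) = (-f) • !![x, z; w, x] := by
      rw [map_mul, map_zpow, D.ψ_y, D.ψ_σ, Units.val_mul,
        matR_zpow (le_trans (by norm_num) hm), matS_val]
      ext i j
      fin_cases i <;> fin_cases j <;> simp [x, z, w, ← mul_assoc, ff]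
    refine ⟨-f * e, ?_, !![x, z; w, x] * A, ?_, ?_, fun _ => ?_, fun h => ?_, fun h => ?_⟩
    · rcases hf with rfl | rfl <;> rcases he with rfl | rfl <;> simp
    · rw [blocks_cons, map_mul, Units.val_mul, hV, hA, Matrix.smul_mul, Matrix.mul_smul, smul_smul]
    · simp only [Pos, Matrix.mul_apply, Fin.sum_univ_two]
      simp
      refine ⟨by positivity, by positivity, by positivity, by positivity⟩
    · simp [Matrix.mul_apply, Fin.sum_univ_two]
      have := mul_nonneg p1.le a3
      have := mul_nonneg p1.le a4
      have := mul_nonneg p2 a2.le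
      have := mul_nonneg p3 a1.le
      by_cases hz : z = 0
      · have : 0 < w * A 0 0 := mul_pos (by linarith) a1
        linarith
      · have : 0 < z * A 1 1 := mul_pos (lt_of_le_of_ne p2 (Ne.symm hz)) a2
        linarith
    · simp [Matrix.mul_apply, Fin.sum_univ_two] at h
      have h1 := mul_nonneg p1.le a4
      have h2 := mul_nonneg p3 a1.le
      have h3 : w * A 0 0 = 0 := by linarith
      have h4 : x * A 1 0 = 0 := by linarith
      intro j hj
      rcases List.mem_cons.1 hj with rfl | hj
      · exact p5 ((mul_eq_zero.1 h3).resolve_right a1.ne')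
      · exact a5 ((mul_eq_zero.1 h4).resolve_left p1.ne') j hj
    · simp [Matrix.mul_apply, Fin.sum_univ_two] at h
      have h1 := mul_nonneg p1.le a3
      have h2 := mul_nonneg p2 a2.le
      have h3 : z * A 1 1 = 0 := by linarith
      have h4 : x * A 0 1 = 0 := by linarith
      intro j hj
      rcases List.mem_cons.1 hj with rfl | hj
      · exact p6 ((mul_eq_zero.1 h3).resolve_right a2.ne')
      · exact a6 ((mul_eq_zero.1 h4).resolve_left p1.ne') j hj

end Dihedral

end Artin

namespace Artin

namespace Dihedral

variable {m : ℕ∞} {H : Type*} [Group H] (D : Dihedral m H)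

theorem zpow_adm_or (i : ℤ) : (∃ c ∈ D.C, D.y ^ i = c ∧ i % per m = 0) ∨
    ∃ c ∈ D.C, ∃ j, Adm m j ∧ D.y ^ i = c * D.y ^ j := by
  obtain ⟨c, hc, e⟩ := D.y_zpow_eq i
  by_cases h : i % per m = 0
  · left
    exact ⟨c, hc, by rw [e, h, zpow_zero, mul_one], h⟩
  · right
    exact ⟨c, hc, i % per m, ⟨Int.emod_emod_of_dvd _ dvd_rfl, h⟩, e⟩

theorem normal_form (h : H) : ∃ c ∈ D.C, ∃ l : List ℤ, (∀ i ∈ l, Adm m i) ∧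
    ∃ u, (u = 1 ∨ u = D.σ) ∧ ∃ v, (v = 1 ∨ ∃ j, Adm m j ∧ v = D.y ^ j) ∧
      h = c * (u * D.blocks l * v) := by
  have hσ : ∀ h : H, h * D.σ⁻¹ = (D.σ ^ 2)⁻¹ * (h * D.σ) := by
    intro h
    rw [((D.sq_comm _).inv_left).eq]
    simp [sq, mul_assoc]
  have stepσ : ∀ h : H, (∃ c ∈ D.C, ∃ l : List ℤ, (∀ i ∈ l, Adm m i) ∧
      ∃ u, (u = 1 ∨ u = D.σ) ∧ ∃ v, (v = 1 ∨ ∃ j, Adm m j ∧ v = D.y ^ j) ∧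
      h = c * (u * D.blocks l * v)) → ∃ c ∈ D.C, ∃ l : List ℤ, (∀ i ∈ l, Adm m i) ∧
      ∃ u, (u = 1 ∨ u = D.σ) ∧ ∃ v, (v = 1 ∨ ∃ j, Adm m j ∧ v = D.y ^ j) ∧
      h * D.σ = c * (u * D.blocks l * v) := by
    rintro _ ⟨c, hc, l, hl, u, hu, v, rfl | ⟨j, hj, rfl⟩, rfl⟩
    · rcases l.eq_nil_or_concat with rfl | ⟨l, i, rfl⟩
      · rcases hu with rfl | rfl
        · exact ⟨c, hc, [], by simp, D.σ, .inr rfl, 1, .inl rfl, by simp⟩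
        · exact ⟨c * D.σ ^ 2, mul_mem hc D.sq_mem, [], by simp, 1, .inl rfl, 1, .inl rfl,
            by simp [sq, mul_assoc]⟩
      · refine ⟨c * D.σ ^ 2, mul_mem hc D.sq_mem, l, fun i hi => hl i (by simp [hi]), u, hu,
          D.y ^ i, .inr ⟨i, hl i (by simp), rfl⟩, ?_⟩
        rw [mul_assoc c (D.σ ^ 2), (D.sq_comm _).eq]
        simp [sq, mul_assoc]
    · refine ⟨c, hc, l ++ [j], ?_, u, hu, 1, .inl rfl, by simp [mul_assoc]⟩
      intro i hi
      rcases List.mem_append.1 hi with hi | hi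
      · exact hl i hi
      · rw [List.mem_singleton] at hi
        exact hi ▸ hj
  have stepy : ∀ h : H, ∀ k : ℤ, (∃ c ∈ D.C, ∃ l : List ℤ, (∀ i ∈ l, Adm m i) ∧
      ∃ u, (u = 1 ∨ u = D.σ) ∧ ∃ v, (v = 1 ∨ ∃ j, Adm m j ∧ v = D.y ^ j) ∧
      h = c * (u * D.blocks l * v)) → ∃ c ∈ D.C, ∃ l : List ℤ, (∀ i ∈ l, Adm m i) ∧
      ∃ u, (u = 1 ∨ u = D.σ) ∧ ∃ v, (v = 1 ∨ ∃ j, Adm m j ∧ v = D.y ^ j) ∧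
      h * D.y ^ k = c * (u * D.blocks l * v) := by
    rintro _ k ⟨c, hc, l, hl, u, hu, v, hv, rfl⟩
    obtain ⟨i, hi⟩ : ∃ i : ℤ, v * D.y ^ k = D.y ^ i := by
      rcases hv with rfl | ⟨j, -, rfl⟩
      · exact ⟨k, one_mul _⟩
      · exact ⟨j + k, (zpow_add _ _ _).symm⟩
    have e : c * (u * D.blocks l * v) * D.y ^ k = c * (u * D.blocks l * D.y ^ i) := by
      rw [← hi]
      simp only [mul_assoc]
    rcases D.zpow_adm_or i with ⟨c', hc', e', -⟩ | ⟨c', hc', j, hj, e'⟩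
    · refine ⟨c * c', mul_mem hc hc', l, hl, u, hu, 1, .inl rfl, ?_⟩
      rw [e, e', mul_one, mul_assoc c, (comm_of_mem hc' _).eq]
    · refine ⟨c * c', mul_mem hc hc', l, hl, u, hu, D.y ^ j, .inr ⟨j, hj, rfl⟩, ?_⟩
      rw [e, e', mul_assoc c, ← mul_assoc _ c', ← (comm_of_mem hc' _).eq, mul_assoc c']
  refine Subgroup.closure_induction_right (p := fun h _ => ∃ c ∈ D.C, ∃ l : List ℤ,
    (∀ i ∈ l, Adm m i) ∧ ∃ u, (u = 1 ∨ u = D.σ) ∧ ∃ v, (v = 1 ∨ ∃ j, Adm m j ∧ v = D.y ^ j) ∧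
      h = c * (u * D.blocks l * v)) ?_ ?_ ?_
    (show h ∈ Subgroup.closure {D.σ, D.y} from D.closure_eq ▸ Subgroup.mem_top h)
  · exact ⟨1, one_mem _, [], by simp, 1, .inl rfl, 1, .inl rfl, by simp⟩
  · rintro h _ _ (rfl | rfl) ih
    · exact stepσ h ih
    · simpa using stepy h 1 ih
  · rintro h _ _ (rfl | rfl) ih
    · obtain ⟨c, hc, l, hl, u, hu, v, hv, e⟩ := stepσ h ih
      refine ⟨(D.σ ^ 2)⁻¹ * c, mul_mem (inv_mem D.sq_mem) hc, l, hl, u, hu, v, hv, ?_⟩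
      rw [hσ, e]
      simp only [mul_assoc]
    · simpa using stepy h (-1) ih

/-- Being conjugate, up to the distinguished central subgroup, to one of the standard elements. -/
def Std (h : H) : Prop := ∃ c ∈ D.C, ∃ u h', u * h * u⁻¹ = c * h' ∧
  (h' = D.σ ∨ (∃ j : ℤ, h' = D.y ^ j) ∨ ∃ l, l ≠ [] ∧ (∀ i ∈ l, Adm m i) ∧ h' = D.blocks l)

variable {D} in
theorem Std.of_conj {h : H} (u : H) (hu : D.Std (u * h * u⁻¹)) : D.Std h := by
  obtain ⟨c, hc, v, h', e, hh⟩ := hu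
  exact ⟨c, hc, v * u, h', by rw [← e]; group, hh⟩

variable {D} in
theorem Std.mul {c h : H} (hc : c ∈ D.C) (hh : D.Std h) : D.Std (c * h) := by
  obtain ⟨c', hc', v, h', e, hh⟩ := hh
  refine ⟨c * c', mul_mem hc hc', v, h', ?_, hh⟩
  rw [mul_assoc c, ← e, ← mul_assoc v, ← (comm_of_mem hc v).eq]
  simp only [mul_assoc]

theorem std_aux (n : ℕ) : ∀ l : List ℤ, l.length = n → (∀ i ∈ l, Adm m i) →
    D.Std (D.σ * D.blocks l) ∧ ∀ j, Adm m j → D.Std (D.blocks l * D.y ^ j) := by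
  induction n with
  | zero =>
    intro l h0 _
    rw [List.length_eq_zero_iff] at h0
    subst h0
    exact ⟨⟨1, one_mem _, 1, _, by simp, .inl rfl⟩, fun j _ =>
      ⟨1, one_mem _, 1, _, by simp, .inr (.inl ⟨j, rfl⟩)⟩⟩
  | succ n ih =>
    intro l hn hl
    constructor
    · rcases l.eq_nil_or_concat with rfl | ⟨l, i, rfl⟩
      · simp at hn
      have := (ih l (by simpa using hn) fun j hj => hl j (by simp [hj])).2 i (hl i (by simp))
      apply Std.of_conj D.σ⁻¹
      convert Std.mul D.sq_mem this using 1
      rw [(D.sq_comm _).eq]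
      simp [sq, mul_assoc]
    · intro j hj
      obtain ⟨i, l, rfl⟩ : ∃ i l', l = i :: l' := List.exists_cons_of_length_eq_add_one hn
      have hl' : ∀ k ∈ l, Adm m k := fun k hk => hl k (by simp [hk])
      have hσ := (ih l (by simpa using hn) hl').1
      apply Std.of_conj (D.y ^ j)
      have e : D.y ^ j * (D.blocks (i :: l) * D.y ^ j) * (D.y ^ j)⁻¹ =
          D.y ^ (j + i) * (D.σ * D.blocks l) := by
        rw [zpow_add]
        simp [mul_assoc]
      rw [e]
      rcases D.zpow_adm_or (j + i) with ⟨c', hc', e', -⟩ | ⟨c', hc', k, hk, e'⟩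
      · rw [e']
        exact hσ.mul hc'
      · rw [e', mul_assoc]
        refine Std.mul hc' ⟨1, one_mem _, 1, D.blocks (k :: l), by simp [mul_assoc],
          .inr (.inr ⟨_, by simp, ?_, rfl⟩)⟩
        intro q hq
        rcases List.mem_cons.1 hq with rfl | hq
        · exact hk
        · exact hl' q hq

theorem std (h : H) : D.Std h := by
  obtain ⟨c, hc, l, hl, u, hu, v, hv, rfl⟩ := D.normal_form h
  apply Std.mul hc
  rcases hu with rfl | rfl <;> rcases hv with rfl | ⟨j, hj, rfl⟩
  · rw [one_mul, mul_one]
    by_cases h0 : l = []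
    · exact ⟨1, one_mem _, 1, _, by simp [h0], .inr (.inl ⟨0, rfl⟩)⟩
    · exact ⟨1, one_mem _, 1, _, by simp, .inr (.inr ⟨l, h0, hl, rfl⟩)⟩
  · rw [one_mul]
    exact (D.std_aux _ l rfl hl).2 j hj
  · rw [mul_one]
    exact (D.std_aux _ l rfl hl).1
  · apply Std.of_conj D.σ⁻¹
    refine ⟨1, one_mem _, 1, D.blocks (l ++ [j]), by simp [mul_assoc],
      .inr (.inr ⟨_, by simp, ?_, rfl⟩)⟩
    intro i hi
    rcases List.mem_append.1 hi with hi | hi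
    · exact hl i hi
    · rw [List.mem_singleton] at hi
      exact hi ▸ hj

theorem degrees (p k : ℤ) : (D.d₁ (D.σ ^ p * D.y ^ k)).toAdd = k ∧
    (D.d₂ (D.σ ^ p * D.y ^ k)).toAdd = p + k := by
  simp [D.d₁_σ, D.d₁_y, D.d₂_σ, D.d₂_y]

theorem eq_one_of_pow_eq_one (D : Dihedral m H) (hm : 3 ≤ m) {h : H} {n : ℕ} (hn : n ≠ 0) (e : h ^ n = 1) :
    h = 1 := by
  obtain ⟨c, hc, u, h', e1, hh⟩ := D.std h
  have e2 : (c * h') ^ n = 1 := by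
    rw [← e1, conj_pow, e, mul_one, mul_inv_cancel]
  have d1 : n * (D.d₁ (c * h')).toAdd = 0 := by
    have := congrArg (fun z => (D.d₁ z).toAdd) e2
    simpa [-map_mul] using this
  have d2 : n * (D.d₂ (c * h')).toAdd = 0 := by
    have := congrArg (fun z => (D.d₂ z).toAdd) e2
    simpa [-map_mul] using this
  have hn' : (n : ℤ) ≠ 0 := by exact_mod_cast hn
  replace d1 := (mul_eq_zero.1 d1).resolve_left hn'
  replace d2 := (mul_eq_zero.1 d2).resolve_left hn'
  rcases hh with rfl | ⟨j, rfl⟩ | ⟨l, h0, hl, rfl⟩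
  · exfalso
    obtain ⟨p, q, rfl⟩ := exists_of_mem hc
    simp [D.d₁_σ, D.d₁_y, D.d₂_σ, D.d₂_y] at d1 d2
    rcases d1 with d1 | d1 <;> simp only [d1, zero_mul, mul_zero] at d2 <;> omega
  · obtain ⟨p, q, rfl⟩ := exists_of_mem hc
    rw [mul_assoc, ← zpow_add, (D.degrees _ _).1] at d1
    rw [mul_assoc, ← zpow_add, (D.degrees _ _).2, d1] at d2
    have : p = 0 := by omega
    rw [mul_assoc (D.σ ^ _), ← zpow_add, d1, this] at e1
    simpa using e1
  · exfalso
    rw [(comm_of_mem hc _).mul_pow] at e2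
    have e3 : D.blocks l ^ n ∈ D.C := by
      rw [← inv_eq_of_mul_eq_one_right e2]
      exact inv_mem (pow_mem hc n)
    have e4 : D.blocks l ^ n = D.blocks (List.replicate n l).flatten := by
      clear e2 e3 hn hn' e d1 d2
      induction n with
      | zero => simp
      | succ n ih => simp [List.replicate_succ, pow_succ', ih]
    have ne : (List.replicate n l).flatten ≠ [] := by
      simp [hn, h0]
    obtain ⟨s, hs, A, hA, -, hoff, -, -⟩ := D.blocks_pos hm (List.replicate n l).flatten (by
      intro i hi
      simp only [List.mem_flatten, List.mem_replicate] at hi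
      obtain ⟨l', ⟨_, rfl⟩, hi⟩ := hi
      exact hl i hi)
    have hoff := hoff ne
    rw [← e4] at hA
    have : A 0 1 = 0 ∧ A 1 0 = 0 := by
      rcases ψ_of_mem (le_trans (by norm_num) hm) e3 with h | h <;> rw [h] at hA <;>
        have h01 := congrFun (congrFun hA 0) 1 <;> have h10 := congrFun (congrFun hA 1) 0 <;>
        rcases hs with rfl | rfl <;> simp at h01 h10 <;> constructor <;> linarith
    linarith [this.1, this.2]

/-- The standard generator of the Artin group. -/
def a : H := D.y * D.σ⁻¹

theorem ψ_a : (D.ψ D.a : Mat2) = !![1, lam m; 0, 1] := by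
  rw [a, map_mul, map_inv, D.ψ_σ, D.ψ_y, Units.val_mul, matR_val, matS_inv_val]
  ext i j
  fin_cases i <;> fin_cases j <;> simp

theorem ψ_a_zpow (k : ℤ) : (D.ψ (D.a ^ k) : Mat2) = !![1, k * lam m; 0, 1] := by
  have hinv : (D.ψ D.a⁻¹ : Mat2) = !![1, -lam m; 0, 1] := by
    rw [a, mul_inv_rev, inv_inv, map_mul, map_inv, D.ψ_σ, D.ψ_y, Units.val_mul, matR_inv_val,
      matS_val]
    ext i j
    fin_cases i <;> fin_cases j <;> simp
  induction k using Int.induction_on with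
  | zero =>
    ext i j
    fin_cases i <;> fin_cases j <;> simp
  | succ k ih =>
    rw [zpow_add_one, map_mul, Units.val_mul, ih, ψ_a]
    ext i j
    fin_cases i <;> fin_cases j <;> simp
    ring
  | pred k ih =>
    rw [zpow_sub_one, map_mul, Units.val_mul, ih, hinv]
    ext i j
    fin_cases i <;> fin_cases j <;> simp
    ring

theorem mem_zpowers_of_unipotent (hm : 3 ≤ m) {h : H} {x u : ℝ} (hx : x ≠ 0)
    (hh : (D.ψ h : Mat2) = !![x, u; 0, x]) : ∃ c ∈ D.C, ∃ k : ℤ, h = c * D.a ^ k := by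
  obtain ⟨c, hc, l, hl, s, hs, v, hv, rfl⟩ := D.normal_form h
  suffices ∃ c' ∈ D.C, ∃ k : ℤ, s * D.blocks l * v = c' * D.a ^ k by
    obtain ⟨c', hc', k, e⟩ := this
    exact ⟨c * c', mul_mem hc hc', k, by rw [e, mul_assoc]⟩
  obtain ⟨x', u', hx', hh'⟩ : ∃ x u : ℝ, x ≠ 0 ∧
      (D.ψ (s * D.blocks l * v) : Mat2) = !![x, u; 0, x] := by
    rw [map_mul, Units.val_mul] at hh
    rcases ψ_of_mem (le_trans (by norm_num) hm) hc with h1 | h1 <;> rw [h1] at hh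
    · exact ⟨x, u, hx, by simpa using hh⟩
    · refine ⟨-x, -u, neg_ne_zero.2 hx, ?_⟩
      rw [neg_mul, one_mul, neg_eq_iff_eq_neg] at hh
      rw [hh]
      ext i j
      fin_cases i <;> fin_cases j <;> simp
  clear hh hx
  have hsq : ∀ r : ℕ, ∃ c ∈ D.C, (D.y * D.σ) ^ r = c * D.a ^ r := by
    intro r
    refine ⟨(D.σ ^ 2) ^ r, pow_mem D.sq_mem r, ?_⟩
    rw [← (D.sq_comm _).mul_pow, (D.sq_comm _).eq]
    simp [a, sq, mul_assoc]
  have happ : ∀ j, Adm m j → ∀ i ∈ l ++ [j], Adm m i := by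
    intro j hj i hi
    rcases List.mem_append.1 hi with hi | hi
    · exact hl i hi
    · rw [List.mem_singleton] at hi
      exact hi ▸ hj
  rcases hs with rfl | rfl <;> rcases hv with rfl | ⟨j, hj, rfl⟩
  · rw [one_mul, mul_one] at hh' ⊢
    obtain ⟨e, he, A, hA, hpos, -, h10, -⟩ := D.blocks_pos hm l hl
    have hone := h10 (by
      have := congrFun (congrFun (hh'.symm.trans hA) 1) 0
      rcases he with rfl | rfl <;> simp at this <;> linarith)
    have : D.blocks l = (D.y * D.σ) ^ l.length := by
      clear hA hh' h10 hl happ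
      induction l with
      | nil => simp
      | cons i l ih =>
        rw [blocks_cons, ih fun j hj => hone j (by simp [hj]), hone i (by simp), zpow_one,
          List.length_cons, pow_succ']
    obtain ⟨c', hc', e'⟩ := hsq l.length
    exact ⟨c', hc', l.length, by rw [this, e', zpow_natCast]⟩
  · exfalso
    obtain ⟨e, he, A, hA, hpos, -, -, -⟩ := D.blocks_pos hm (l ++ [j]) (happ j hj)
    have e1 : D.blocks (l ++ [j]) = 1 * D.blocks l * D.y ^ j * D.σ := by simp [mul_assoc]
    rw [e1, map_mul, Units.val_mul, hh', D.ψ_σ, matS_val] at hA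
    have := congrFun (congrFun hA 1) 1
    have hp := hpos.2.1
    rcases he with rfl | rfl <;> simp at this <;> linarith
  · exfalso
    obtain ⟨e, he, A, hA, hpos, -, -, -⟩ := D.blocks_pos hm l hl
    have e1 : D.blocks l = D.σ⁻¹ * (D.σ * D.blocks l * 1) := by simp
    rw [e1, map_mul, Units.val_mul, hh', map_inv, D.ψ_σ, matS_inv_val] at hA
    have := congrFun (congrFun hA 0) 0
    have hp := hpos.1
    rcases he with rfl | rfl <;> simp at this <;> linarith
  · obtain ⟨e, he, A, hA, hpos, -, -, h01⟩ := D.blocks_pos hm (l ++ [j]) (happ j hj)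
    have e1 : D.blocks (l ++ [j]) = D.σ⁻¹ * (D.σ * D.blocks l * D.y ^ j) * D.σ := by
      simp [mul_assoc]
    have e1' := e1
    rw [e1, map_mul, map_mul, Units.val_mul, Units.val_mul, hh', map_inv, D.ψ_σ, matS_inv_val,
      matS_val] at hA
    have hall := h01 (by
      have := congrFun (congrFun hA 0) 1
      rcases he with rfl | rfl <;> simp at this <;> linarith)
    have hbl : ∀ l : List ℤ, (∀ i ∈ l, (i + 1) % per m = 0) →
        ∃ c ∈ D.C, D.blocks l = c * (D.y⁻¹ * D.σ) ^ l.length := by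
      intro l hl
      induction l with
      | nil => exact ⟨1, one_mem _, by simp⟩
      | cons i l ih =>
        obtain ⟨c, hc, e⟩ := ih fun j hj => hl j (by simp [hj])
        obtain ⟨c', hc', e'⟩ := D.y_zpow_eq (i + 1)
        rw [hl i (by simp), zpow_zero, mul_one] at e'
        refine ⟨c * c', mul_mem hc hc', ?_⟩
        have e2 : D.y ^ i = c' * D.y⁻¹ := by rw [← e', zpow_add_one, mul_inv_cancel_right]
        rw [blocks_cons, e, e2, ← mul_assoc, ← (comm_of_mem hc _).eq, List.length_cons, pow_succ']
        simp only [mul_assoc]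
    obtain ⟨c', hc', e2⟩ := hbl _ hall
    refine ⟨c', hc', -(l ++ [j]).length, ?_⟩
    have e3 : D.a⁻¹ = D.σ * (D.y⁻¹ * D.σ) * D.σ⁻¹ := by simp [a, mul_assoc]
    have e4 : D.σ * D.blocks l * D.y ^ j = D.σ * D.blocks (l ++ [j]) * D.σ⁻¹ := by
      rw [e1']
      simp [mul_assoc]
    rw [zpow_neg, zpow_natCast, ← inv_pow, e3, conj_pow, e4, e2, ← mul_assoc D.σ,
      ← (comm_of_mem hc' D.σ).eq]
    simp only [mul_assoc]

theorem mem_zpowers_of_pow_eq (hm : 3 ≤ m) {h : H} {n : ℕ} (hn : n ≠ 0) {k : ℤ}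
    (e : h ^ n = D.a ^ k) : ∃ r : ℤ, h = D.a ^ r := by
  by_cases hk : k = 0
  · rw [hk, zpow_zero] at e
    exact ⟨0, by rw [D.eq_one_of_pow_eq_one hm hn e, zpow_zero]⟩
  have lp := lam_pos hm
  have hkl : (k : ℝ) * lam m ≠ 0 := mul_ne_zero (by exact_mod_cast hk) lp.ne'
  have hcomm : h * D.a ^ k = D.a ^ k * h := by rw [← e, ← pow_succ, ← pow_succ']
  have hmat := congrArg (fun g => (D.ψ g : Mat2)) hcomm
  simp only [map_mul D.ψ, Units.val_mul, D.ψ_a_zpow] at hmat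
  have h00 := congrFun (congrFun hmat 0) 0
  have h01 := congrFun (congrFun hmat 0) 1
  simp [Matrix.mul_apply, Fin.sum_univ_two] at h00 h01
  have z : (D.ψ h : Mat2) 1 0 = 0 := by
    rcases h00 with (h | h) | h
    · exact absurd h hk
    · exact absurd h lp.ne'
    · exact h
  have q : (D.ψ h : Mat2) 0 0 = (D.ψ h : Mat2) 1 1 := by
    have : (k * lam m) * ((D.ψ h : Mat2) 0 0 - (D.ψ h : Mat2) 1 1) = 0 := by linarith
    exact sub_eq_zero.1 ((mul_eq_zero.1 this).resolve_left hkl)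
  have hx : (D.ψ h : Mat2) 0 0 ≠ 0 := by
    intro h0
    have := congrFun (congrFun (D.ψ h).inv_mul 0) 0
    simp only [Matrix.mul_apply, Fin.sum_univ_two, z, h0] at this
    simp at this
  obtain ⟨c, hc, r, rfl⟩ := D.mem_zpowers_of_unipotent hm hx (h := h)
    (u := (D.ψ h : Mat2) 0 1) (by
      ext i j
      fin_cases i <;> fin_cases j <;> simp [z, q])
  refine ⟨r, ?_⟩
  rw [(comm_of_mem hc _).mul_pow, ← zpow_natCast (D.a ^ r), ← zpow_mul, ← eq_mul_inv_iff_mul_eq,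
    ← zpow_neg, ← zpow_add] at e
  have e5 := congrArg (fun g => (D.ψ g : Mat2)) e
  simp only [D.ψ_a_zpow] at e5
  have e6 : ((k + -(r * n) : ℤ) : ℝ) * lam m = 0 := by
    have e7 := congrFun (congrFun e5 0) 1
    rcases ψ_of_mem (le_trans (by norm_num) hm) (pow_mem hc n) with h | h <;> rw [h] at e7 <;>
      simp at e7 ⊢ <;> exact e7.imp (fun h => by linarith) id
  have e8 := (mul_eq_zero.1 e6).resolve_right lp.ne'
  rw [Int.cast_eq_zero.1 e8, zpow_zero] at e
  rw [D.eq_one_of_pow_eq_one hm hn e, one_mul]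

end Dihedral

end Artin

namespace Artin

section Twist

variable {G : Type*} [Group G] {a b σ : G}

theorem twist_alt (hab : σ * a = b * σ) (hba : σ * b = a * σ) (k : ℕ) :
    σ * alt k a b = alt k b a * σ ∧ σ * alt k b a = alt k a b * σ := by
  induction k with
  | zero => simp
  | succ k ih =>
    rw [alt_succ, alt_succ, ← mul_assoc, hab, mul_assoc, ih.2, ← mul_assoc, ← mul_assoc σ, hba,
      mul_assoc a, ih.1, ← mul_assoc]
    exact ⟨rfl, rfl⟩

theorem twist_pow (hab : σ * a = b * σ) (hba : σ * b = a * σ) (k : ℕ) :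
    (a * σ) ^ k = alt k a b * σ ^ k := by
  induction k with
  | zero => simp
  | succ k ih =>
    rw [pow_succ', ih, mul_assoc a, ← mul_assoc σ, (twist_alt hab hba k).1, alt_succ, pow_succ']
    simp only [mul_assoc]

theorem twist_commute_iff (hab : σ * a = b * σ) (hba : σ * b = a * σ) (k : ℕ) :
    Commute σ ((a * σ) ^ k) ↔ alt k a b = alt k b a := by
  rw [commute_iff_eq, twist_pow hab hba, ← mul_assoc, (twist_alt hab hba k).1, mul_assoc, mul_assoc,
    ← pow_succ, ← pow_succ', mul_left_inj]
  exact eq_comm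

end Twist

section RankTwo

variable {S : Type*} {M : S → S → ℕ∞} {s t : S}

open Classical in
theorem swap_label (hM : Large M) (huniv : ∀ u, u = s ∨ u = t) {u v : S} (h : u ≠ v) :
    M (Equiv.swap s t u) (Equiv.swap s t v) = M u v := by
  rcases huniv u with rfl | rfl <;> rcases huniv v with rfl | rfl <;>
    first
      | exact absurd rfl h
      | (rw [Equiv.swap_apply_left, Equiv.swap_apply_right]; exact hM.symm _ _)

open Classical in
/-- The endomorphism exchanging the two generators. -/
noncomputable def swapHom (hM : Large M) (huniv : ∀ u, u = s ∨ u = t) :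
    ArtinGroup M →* ArtinGroup M :=
  liftHom (fun u => gen M (Equiv.swap s t u)) fun u v huv k hk =>
    satisfiesBraid_gen M _ _ (fun h => huv ((Equiv.swap s t).injective h)) k
      (by rw [swap_label hM huniv huv, hk])

open Classical in
theorem swapHom_gen (hM : Large M) (huniv : ∀ u, u = s ∨ u = t) (u : S) :
    swapHom hM huniv (gen M u) = gen M (Equiv.swap s t u) :=
  liftHom_gen _ _ _

open Classical in
theorem swapHom_swapHom (hM : Large M) (huniv : ∀ u, u = s ∨ u = t) (g : ArtinGroup M) :
    swapHom hM huniv (swapHom hM huniv g) = g := by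
  induction g using artin_induction with
  | one => simp
  | gen_mul u g ih => rw [map_mul, map_mul, ih, swapHom_gen, swapHom_gen, ← Equiv.Perm.mul_apply,
      Equiv.swap_mul_self, Equiv.Perm.one_apply]
  | inv_mul u g ih =>
    rw [map_mul, map_mul, ih, map_inv, map_inv, swapHom_gen, swapHom_gen, ← Equiv.Perm.mul_apply,
      Equiv.swap_mul_self, Equiv.Perm.one_apply]

/-- The automorphism exchanging the two generators. -/
noncomputable def swapAut (hM : Large M) (huniv : ∀ u, u = s ∨ u = t) : MulAut (ArtinGroup M) :=
  { swapHom hM huniv with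
    invFun := swapHom hM huniv
    left_inv := swapHom_swapHom hM huniv
    right_inv := swapHom_swapHom hM huniv }

open Classical in
theorem swapAut_left (hM : Large M) (huniv : ∀ u, u = s ∨ u = t) :
    swapAut hM huniv (gen M s) = gen M t := by
  change swapHom hM huniv (gen M s) = _
  rw [swapHom_gen, Equiv.swap_apply_left]

open Classical in
theorem swapAut_right (hM : Large M) (huniv : ∀ u, u = s ∨ u = t) :
    swapAut hM huniv (gen M t) = gen M s := by
  change swapHom hM huniv (gen M t) = _
  rw [swapHom_gen, Equiv.swap_apply_right]

/-- The extension of the Artin group by the exchange of the generators. -/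
abbrev Twisted (hM : Large M) (huniv : ∀ u, u = s ∨ u = t) : Type _ :=
  ArtinGroup M ⋊[zpowersHom (MulAut (ArtinGroup M)) (swapAut hM huniv)] Multiplicative ℤ

namespace Twisted

open SemidirectProduct

variable (hM : Large M) (huniv : ∀ u, u = s ∨ u = t)

/-- The element inducing the exchange. -/
noncomputable def σ : Twisted hM huniv := inr (Multiplicative.ofAdd 1)

theorem σ_mul_inl (g : ArtinGroup M) :
    σ hM huniv * inl g = inl (swapAut hM huniv g) * σ hM huniv := by
  have h := inl_aut (φ := zpowersHom (MulAut (ArtinGroup M)) (swapAut hM huniv))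
    (Multiplicative.ofAdd 1) g
  rw [zpowersHom_apply, toAdd_ofAdd, zpow_one] at h
  rw [h, map_inv, σ, inv_mul_cancel_right]

/-- The rotation. -/
noncomputable def y : Twisted hM huniv := inl (gen M s) * σ hM huniv

theorem closure_eq : Subgroup.closure {σ hM huniv, y hM huniv} = ⊤ := by
  set K := Subgroup.closure {σ hM huniv, y hM huniv} with hK
  have hσ : σ hM huniv ∈ K := Subgroup.subset_closure (by simp)
  have hy : y hM huniv ∈ K := Subgroup.subset_closure (by simp)
  have hs : inl (gen M s) ∈ K := by
    have := mul_mem hy (inv_mem hσ)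
    rwa [y, mul_inv_cancel_right] at this
  have ht : inl (gen M t) ∈ K := by
    have := mul_mem (mul_mem hσ hs) (inv_mem hσ)
    rwa [σ_mul_inl, mul_inv_cancel_right, swapAut_left] at this
  have hu : ∀ u, inl (gen M u) ∈ K := fun u => by
    rcases huniv u with rfl | rfl
    exacts [hs, ht]
  rw [eq_top_iff]
  intro h _
  rw [← inl_left_mul_inr_right h]
  refine mul_mem ?_ ?_
  · generalize h.left = g
    induction g using artin_induction with
    | one => simp
    | gen_mul u g ih =>
      rw [map_mul]
      exact mul_mem (hu u) ih
    | inv_mul u g ih =>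
      rw [map_mul, map_inv]
      exact mul_mem (inv_mem (hu u)) ih
  · have : (inr h.right : Twisted hM huniv) = σ hM huniv ^ h.right.toAdd := by
      rw [σ, ← map_zpow, ← ofAdd_zsmul, smul_eq_mul, mul_one, ofAdd_toAdd]
    rw [this]
    exact zpow_mem hσ _

variable {hM huniv} in
theorem commute_of_commute {c : Twisted hM huniv} (h1 : Commute c (σ hM huniv))
    (h2 : Commute c (y hM huniv)) (h : Twisted hM huniv) : Commute c h := by
  have hh : h ∈ Subgroup.closure {σ hM huniv, y hM huniv} := closure_eq hM huniv ▸ Subgroup.mem_top h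
  refine Subgroup.closure_induction (p := fun h _ => Commute c h) ?_ (Commute.one_right c)
    (fun _ _ _ _ h1 h2 => h1.mul_right h2) (fun _ _ h1 => h1.inv_right) hh
  rintro _ (rfl | rfl)
  exacts [h1, h2]

theorem sq_comm (h : Twisted hM huniv) : Commute (σ hM huniv ^ 2) h := by
  refine commute_of_commute ((Commute.refl _).pow_left 2) ?_ h
  rw [commute_iff_eq, y, sq]
  simp only [mul_assoc]
  rw [← mul_assoc, ← mul_assoc, mul_assoc _ _ (inl _), σ_mul_inl, ← mul_assoc, σ_mul_inl,
    swapAut_left, swapAut_right]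
  simp only [mul_assoc]

theorem per_comm (hst : s ≠ t) (h : Twisted hM huniv) :
    Commute (y hM huniv ^ per (M s t)) h := by
  refine commute_of_commute (Commute.symm ?_) ((Commute.refl _).zpow_left _) h
  rw [per, zpow_natCast]
  by_cases hm : M s t = ⊤
  · simp [hm]
  · rw [y, twist_commute_iff (b := inl (gen M t)) (by rw [σ_mul_inl, swapAut_left])
      (by rw [σ_mul_inl, swapAut_right]), ← map_alt, ← map_alt]
    congr 1
    rw [alt_comm_iff_ralt_comm]
    exact satisfiesBraid_gen M s t hst _ (ENat.natCast_toNat hm).symm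

variable {G : Type*} [Group G]

/-- Homomorphisms out of the extension. -/
noncomputable def extend (f : ArtinGroup M →* G) (q : G)
    (h : ∀ x, f (swapAut hM huniv x) * q = q * f x) : Twisted hM huniv →* G :=
  SemidirectProduct.lift f (zpowersHom G q) (by
    intro k
    refine MonoidHom.ext fun x => ?_
    induction k using Multiplicative.rec with | _ k
    simp only [zpowersHom_apply, toAdd_ofAdd, MonoidHom.comp_apply, MulEquiv.toMonoidHom_eq_coe,
      MonoidHom.coe_coe, MulAut.conj_apply]
    induction k using Int.induction_on generalizing x with
    | zero => simp
    | succ k ih =>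
      rw [zpow_add_one, MulAut.mul_apply, ih, eq_mul_inv_of_mul_eq (h x), zpow_add_one]
      simp only [mul_inv_rev, mul_assoc]
    | pred k ih =>
      have h' := h ((swapAut hM huniv)⁻¹ x)
      rw [← MulAut.mul_apply, mul_inv_cancel, MulAut.one_apply] at h'
      rw [zpow_sub_one, MulAut.mul_apply, ih, eq_inv_mul_of_mul_eq h'.symm, zpow_sub_one]
      simp only [mul_inv_rev, mul_assoc, inv_inv])

@[simp] theorem extend_inl (f : ArtinGroup M →* G) (q : G)
    (h : ∀ x, f (swapAut hM huniv x) * q = q * f x) (x : ArtinGroup M) :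
    extend hM huniv f q h (inl x) = f x := SemidirectProduct.lift_inl _ _ _ _

@[simp] theorem extend_σ (f : ArtinGroup M →* G) (q : G)
    (h : ∀ x, f (swapAut hM huniv x) * q = q * f x) :
    extend hM huniv f q h (σ hM huniv) = q := by
  rw [σ, extend, SemidirectProduct.lift_inr, zpowersHom_apply, toAdd_ofAdd, zpow_one]

end Twisted

theorem intertwine_of_gen (hM : Large M) (huniv : ∀ u, u = s ∨ u = t) {G : Type*} [Group G]
    (f : ArtinGroup M →* G) (q : G) (hs : f (gen M t) * q = q * f (gen M s))
    (ht : f (gen M s) * q = q * f (gen M t)) (x : ArtinGroup M) :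
    f (swapAut hM huniv x) * q = q * f x := by
  have hu : ∀ u, f (swapAut hM huniv (gen M u)) * q = q * f (gen M u) := fun u => by
    rcases huniv u with rfl | rfl
    · rw [swapAut_left, hs]
    · rw [swapAut_right, ht]
  induction x using artin_induction with
  | one => simp
  | gen_mul u g ih => rw [map_mul, map_mul, mul_assoc, ih, ← mul_assoc, hu, map_mul, mul_assoc]
  | inv_mul u g ih =>
    rw [map_mul, map_mul, mul_assoc, ih, ← mul_assoc, map_inv, map_inv, map_mul, map_inv,
      ← mul_assoc, eq_mul_inv_iff_mul_eq.2 (hu u).symm.symm]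
    simp only [mul_inv_rev, mul_assoc, inv_mul_cancel_left, inv_inv]

/-- The length homomorphism. -/
noncomputable def lengthHom (M : S → S → ℕ∞) : ArtinGroup M →* Multiplicative ℤ :=
  liftHom (fun _ => Multiplicative.ofAdd 1) fun _ _ _ _ _ => rfl

@[simp] theorem lengthHom_gen (u : S) : lengthHom M (gen M u) = Multiplicative.ofAdd 1 :=
  liftHom_gen _ _ _

theorem matS_sq_comm (A : Mat2ˣ) : Commute (matS ^ 2) A := by
  have h : ((matS ^ 2 : Mat2ˣ) : Mat2) = -1 := by
    rw [Units.val_pow_eq_pow_val, matS_val, sq]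
    ext i j
    fin_cases i <;> fin_cases j <;> simp
  apply Units.ext
  rw [Units.val_mul, Units.val_mul, h]
  simp

open Classical in
theorem satisfiesBraid_matrix (hM : Large M) (huniv : ∀ u, u = s ∨ u = t) (hst : s ≠ t) :
    SatisfiesBraid M fun u => if u = s then matR (M s t) * matS⁻¹ else
      matS * (matR (M s t) * matS⁻¹) * matS⁻¹ := by
  set a := matR (M s t) * matS⁻¹ with ha
  set b := matS * a * matS⁻¹ with hb
  have hab : matS * a = b * matS := by rw [hb]; group
  have hba : matS * b = a * matS := by
    have := matS_sq_comm a
    rw [hb, ← mul_assoc, ← mul_assoc, ← sq, this.eq]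
    group
  have key : ∀ k : ℕ, M s t = k → ralt k a b = ralt k b a := by
    intro k hk
    rw [← alt_comm_iff_ralt_comm, ← twist_commute_iff hab hba, ha, inv_mul_cancel_right]
    have h := matR_zpow_per (hM.two_le hst)
    rw [per, hk, ENat.toNat_natCast, zpow_natCast, ← hk] at h
    apply Units.ext
    rw [Units.val_mul, Units.val_mul]
    rcases h with h | h <;> rw [h] <;> simp
  intro u v huv k hk
  rcases huniv u with rfl | rfl <;> rcases huniv v with rfl | rfl
  · exact absurd rfl huv
  · simpa [hst.symm] using key k hk
  · simpa [hst.symm] using (key k (hM.symm _ _ ▸ hk)).symm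
  · exact absurd rfl huv

open Classical in
/-- The linear representation in rank two. -/
noncomputable def matHom (hM : Large M) (huniv : ∀ u, u = s ∨ u = t) (hst : s ≠ t) :
    ArtinGroup M →* Mat2ˣ := liftHom _ (satisfiesBraid_matrix hM huniv hst)

theorem matHom_left (hM : Large M) (huniv : ∀ u, u = s ∨ u = t) (hst : s ≠ t) :
    matHom hM huniv hst (gen M s) = matR (M s t) * matS⁻¹ :=
  (liftHom_gen _ _ _).trans (if_pos rfl)

theorem matHom_right (hM : Large M) (huniv : ∀ u, u = s ∨ u = t) (hst : s ≠ t) :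
    matHom hM huniv hst (gen M t) = matS * (matR (M s t) * matS⁻¹) * matS⁻¹ :=
  (liftHom_gen _ _ _).trans (if_neg hst.symm)

theorem matHom_intertwine (hM : Large M) (huniv : ∀ u, u = s ∨ u = t) (hst : s ≠ t)
    (x : ArtinGroup M) :
    matHom hM huniv hst (swapAut hM huniv x) * matS = matS * matHom hM huniv hst x := by
  refine intertwine_of_gen hM huniv _ _ ?_ ?_ x
  · rw [matHom_left, matHom_right, inv_mul_cancel_right]
  · rw [matHom_left, matHom_right, ← mul_assoc, ← mul_assoc, ← sq, (matS_sq_comm _).eq]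
    group

/-- The structure carried by the extension in rank two. -/
noncomputable def dihedral (hM : Large M) (huniv : ∀ u, u = s ∨ u = t) (hst : s ≠ t) :
    Dihedral (M s t) (Twisted hM huniv) where
  σ := Twisted.σ hM huniv
  y := Twisted.y hM huniv
  closure_eq := Twisted.closure_eq hM huniv
  sq_comm := Twisted.sq_comm hM huniv
  per_comm := Twisted.per_comm hM huniv hst
  ψ := Twisted.extend hM huniv (matHom hM huniv hst) matS (matHom_intertwine hM huniv hst)
  ψ_σ := Twisted.extend_σ _ _ _ _ _
  ψ_y := by rw [Twisted.y, map_mul, Twisted.extend_inl, Twisted.extend_σ, matHom_left,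
    inv_mul_cancel_right]
  d₁ := Twisted.extend hM huniv (lengthHom M) 1
    (intertwine_of_gen hM huniv _ _ (by simp) (by simp))
  d₁_σ := Twisted.extend_σ _ _ _ _ _
  d₁_y := by rw [Twisted.y, map_mul, Twisted.extend_inl, Twisted.extend_σ, lengthHom_gen, mul_one]
  d₂ := Twisted.extend hM huniv 1 (Multiplicative.ofAdd 1) (by simp)
  d₂_σ := Twisted.extend_σ _ _ _ _ _
  d₂_y := by rw [Twisted.y, map_mul, Twisted.extend_inl, Twisted.extend_σ, MonoidHom.one_apply,
    one_mul]

/-- In rank two, roots of powers of a generator are powers of that generator. -/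
theorem mem_zpowers_of_pow_eq_gen_zpow (hM : Large M) (huniv : ∀ u, u = s ∨ u = t) (hst : s ≠ t)
    {g : ArtinGroup M} {n : ℕ} (hn : n ≠ 0) {k : ℤ} (e : g ^ n = gen M s ^ k) :
    ∃ r : ℤ, g = gen M s ^ r := by
  have ha : (dihedral hM huniv hst).a = SemidirectProduct.inl (gen M s) :=
    mul_inv_cancel_right _ _
  obtain ⟨r, hr⟩ := (dihedral hM huniv hst).mem_zpowers_of_pow_eq (hM.three_le s t hst)
    (h := SemidirectProduct.inl g) hn (k := k) (by rw [ha, ← map_pow, e, map_zpow])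
  exact ⟨r, SemidirectProduct.inl_injective (by rw [hr, ha, map_zpow])⟩

theorem eq_zero_of_gen_zpow_cycle (hM : Large M) (huniv : ∀ u, u = s ∨ u = t) (hst : s ≠ t)
    {i j k l : ℤ} (e : gen M s ^ i * gen M t ^ j * gen M s ^ k * gen M t ^ l = 1) :
    i = 0 ∨ j = 0 := by
  set D := dihedral hM huniv hst with hD
  have hs : ∀ i : ℤ, (matHom hM huniv hst (gen M s ^ i) : Mat2) = !![1, i * lam (M s t); 0, 1] := by
    intro i
    rw [← D.ψ_a_zpow i, Dihedral.a, map_zpow D.ψ, map_mul, map_inv, D.ψ_σ, D.ψ_y, map_zpow,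
      matHom_left]
  have ht : ∀ i : ℤ, (matHom hM huniv hst (gen M t ^ i) : Mat2) = !![1, 0; -i * lam (M s t), 1] := by
    intro i
    rw [map_zpow, matHom_right, ← matHom_left hM huniv hst, conj_zpow, ← map_zpow, Units.val_mul,
      Units.val_mul, hs, matS_val, matS_inv_val]
    ext i j
    fin_cases i <;> fin_cases j <;> simp
  have e1 : gen M s ^ i * gen M t ^ j = gen M t ^ (-l) * gen M s ^ (-k) := by
    rw [zpow_neg, zpow_neg, eq_mul_inv_iff_mul_eq, eq_inv_iff_mul_eq_one, e]
  have e2 := congrArg (fun g => (matHom hM huniv hst g : Mat2) 0 0) e1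
  simp only [map_mul, Units.val_mul, hs, ht] at e2
  simp [Matrix.mul_apply, Fin.sum_univ_two] at e2
  have lp := (lam_pos (hM.three_le s t hst)).ne'
  simpa [lp] using e2

end RankTwo

end Artin

namespace Artin

universe u

/-- A three-colored two-dimensional simplicial complex, recorded by its triangles, whose vertex
links contain no cycle of length four. -/
structure TriComplex (V : Type u) where
  /-- the color of a vertex -/
  color : V → Fin 3
  /-- the triangles -/
  T : V → V → V → Prop
  swap : ∀ {x y z}, T x y z → T y x z
  rot : ∀ {x y z}, T x y z → T y z x
  color_ne : ∀ {x y z}, T x y z → color x ≠ color y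
  link : ∀ {x y y' z z'}, T x y z → T x y' z → T x y z' → T x y' z' → y = y' ∨ z = z'

namespace TriComplex

variable {V : Type u} (K : TriComplex V)

/-- The edges. -/
def E (x y : V) : Prop := ∃ z, K.T x y z

variable {K} {x y z w : V}

theorem E.symm (h : K.E x y) : K.E y x := h.imp fun _ => K.swap

theorem E.color_ne (h : K.E x y) : K.color x ≠ K.color y := h.elim fun _ => K.color_ne

theorem E.ne (h : K.E x y) : x ≠ y := fun e => h.color_ne (congrArg _ e)

theorem T_E₁₂ (h : K.T x y z) : K.E x y := ⟨z, h⟩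

theorem T_E₂₃ (h : K.T x y z) : K.E y z := ⟨x, K.rot h⟩

theorem T_E₁₃ (h : K.T x y z) : K.E x z := (T_E₁₂ (K.rot (K.rot h))).symm

theorem T_swap₂₃ (h : K.T x y z) : K.T x z y := K.swap (K.rot (K.rot h))

theorem color_eq (h : K.T x y z) (h1 : K.color w ≠ K.color x) (h2 : K.color w ≠ K.color y) :
    K.color w = K.color z := by
  have h3 := (T_E₁₂ h).color_ne
  have h4 := (T_E₂₃ h).color_ne
  have h5 := (T_E₁₃ h).color_ne
  generalize K.color x = a at *
  generalize K.color y = b at *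
  generalize K.color z = c at *
  generalize K.color w = d at *
  omega

theorem not_color (h : K.T x y z) (h1 : K.color w ≠ K.color x) (h2 : K.color w ≠ K.color y)
    (h3 : K.color w ≠ K.color z) : False := h3 (color_eq h h1 h2)

theorem color_eq_of_T {z' : V} (h : K.T x y z) (h' : K.T x y z') : K.color z' = K.color z :=
  color_eq h (T_E₁₃ h').color_ne.symm (T_E₂₃ h').color_ne.symm

end TriComplex

open TriComplex

/-- A level of the tower describing the universal cover: the vertices at given distance from the
base point, the images of their neighbors one level below, and their adjacency. -/
structure Level {V : Type u} (K : TriComplex V) where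
  /-- the vertices -/
  X : Type u
  /-- the projection -/
  p : X → V
  /-- the images of the parents -/
  U : X → Set V
  /-- the adjacency -/
  H : X → X → Prop
  U_E : ∀ {x u}, u ∈ U x → K.E (p x) u
  U_T : ∀ {x u u'}, u ∈ U x → u' ∈ U x → u ≠ u' → K.T (p x) u u'
  H_symm : ∀ {x y}, H x y → H y x
  H_T : ∀ {x y}, H x y → ∃ u ∈ U x, u ∈ U y ∧ K.T (p x) (p y) u
  H_exists : ∀ {x u z}, u ∈ U x → K.T (p x) u z → z ∉ U x → ∃ y, H x y ∧ p y = z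
  H_unique : ∀ {x y y'}, H x y → H x y' → p y = p y' → y = y'
  H_notMem : ∀ {x y}, H x y → p y ∉ U x

namespace Level

variable {V : Type u} {K : TriComplex V}

/-- The level of the base point. -/
def base (K : TriComplex V) (v : V) : Level K where
  X := PUnit
  p _ := v
  U _ := ∅
  H _ _ := False
  U_E := by simp
  U_T := by simp
  H_symm := id
  H_T := by simp
  H_exists := by simp
  H_unique := by simp
  H_notMem := by simp

variable (L : Level K)

/-- Neighbors in the link of `y` that belong to the next level. -/
def Up (y : L.X) (z : V) : Prop := K.E (L.p y) z ∧ z ∉ L.U y ∧ ∀ u ∈ L.U y, ¬ K.T (L.p y) u z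

/-- The set of parents of a vertex of the next level. -/
def cls (y : L.X) (z : V) : Set L.X := {y' | y' = y ∨ L.H y y' ∧ K.T (L.p y) (L.p y') z}

theorem mem_cls_self (y : L.X) (z : V) : y ∈ L.cls y z := .inl rfl

variable {L} {y y' y'' : L.X} {z : V}

theorem Up.eq_of_mem (h : L.Up y z) (h1 : L.H y y') (h1' : K.T (L.p y) (L.p y') z)
    (h2 : L.H y y'') (h2' : K.T (L.p y) (L.p y'') z) : y' = y'' := by
  obtain ⟨u, hu, -, hT⟩ := L.H_T h1
  obtain ⟨u', hu', -, hT'⟩ := L.H_T h2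
  by_cases e : u = u'
  · subst e
    rcases K.link h1' h2' hT hT' with e | e
    · exact L.H_unique h1 h2 e
    · exact absurd (e ▸ hu) h.2.1
  · exact absurd ((color_eq_of_T h1' hT).trans (color_eq_of_T h2' hT').symm)
      (T_E₂₃ (L.U_T hu hu' e)).color_ne

theorem Up.of_mem_cls (h : L.Up y z) (hy : y' ∈ L.cls y z) : L.Up y' z := by
  rcases hy with rfl | ⟨h1, h2⟩
  · exact h
  obtain ⟨u, hu, hu', hT⟩ := L.H_T h1
  have hc := color_eq_of_T h2 hT
  refine ⟨T_E₂₃ h2, fun hz => ?_, fun u' hu'' hT' => ?_⟩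
  · have : u ≠ z := fun e => h.2.1 (e ▸ hu)
    exact (T_E₂₃ (L.U_T hu' hz this)).color_ne hc
  · have hne : u' ≠ u := fun e => (T_E₂₃ hT').color_ne (e ▸ hc)
    rcases K.link (K.swap h2) hT' (K.swap hT) (L.U_T hu'' hu' hne) with e | e
    · exact L.H_notMem (L.H_symm h1) (e ▸ hu'')
    · exact h.2.1 (e ▸ hu)

theorem Up.cls_eq (h : L.Up y z) (hy : y' ∈ L.cls y z) : L.cls y' z = L.cls y z := by
  have h' := h.of_mem_cls hy
  rcases hy with rfl | ⟨h1, h2⟩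
  · rfl
  ext w
  constructor
  · rintro (rfl | ⟨h3, h4⟩)
    · exact .inr ⟨h1, h2⟩
    · exact .inl (h'.eq_of_mem h3 h4 (L.H_symm h1) (K.swap h2))
  · rintro (rfl | ⟨h3, h4⟩)
    · exact .inr ⟨L.H_symm h1, K.swap h2⟩
    · exact .inl (h.eq_of_mem h3 h4 h1 h2)

variable (L) in
/-- The vertices of the next level. -/
def NextX : Type u := {q : V × Set L.X // ∃ y, L.Up y q.1 ∧ q.2 = L.cls y q.1}

/-- The vertex of the next level in a given direction. -/
def Up.toNext (h : L.Up y z) : L.NextX := ⟨(z, L.cls y z), y, h, rfl⟩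

theorem NextX.up (x : L.NextX) (hy : y ∈ x.1.2) : L.Up y x.1.1 := by
  obtain ⟨y', h, e⟩ := x.2
  exact h.of_mem_cls (e ▸ hy)

theorem NextX.eq_cls (x : L.NextX) (hy : y ∈ x.1.2) : x.1.2 = L.cls y x.1.1 := by
  obtain ⟨y', h, e⟩ := x.2
  rw [e] at hy ⊢
  exact (h.cls_eq hy).symm

theorem NextX.nonempty (x : L.NextX) : ∃ y, y ∈ x.1.2 := by
  obtain ⟨y', h, e⟩ := x.2
  exact ⟨y', e ▸ L.mem_cls_self _ _⟩

theorem NextX.H_of_mem (x : L.NextX) (hy : y ∈ x.1.2) (hy' : y' ∈ x.1.2) (hne : y' ≠ y) :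
    L.H y y' ∧ K.T (L.p y) (L.p y') x.1.1 := by
  rw [x.eq_cls hy] at hy'
  exact hy'.resolve_left hne

theorem NextX.ext {x x' : L.NextX} (h : x.1.1 = x'.1.1) (hy : y ∈ x.1.2) (hy' : y ∈ x'.1.2) :
    x = x' := by
  refine Subtype.ext (Prod.ext h ?_)
  rw [x.eq_cls hy, x'.eq_cls hy', h]

theorem NextX.eq_of_mem {x : L.NextX} (hy : y ∈ x.1.2) (hy' : y' ∈ x.1.2) {w : V}
    (hT : K.T (L.p y) x.1.1 w) (hT' : K.E (L.p y') w) : y = y' := by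
  by_contra hne
  have h := (x.H_of_mem hy hy' (Ne.symm hne)).2
  exact not_color h (T_E₁₃ hT).color_ne.symm hT'.color_ne.symm (T_E₂₃ hT).color_ne.symm

variable (L) in
/-- The next level. -/
def next : Level K where
  X := L.NextX
  p x := x.1.1
  U x := L.p '' x.1.2
  H x x' := ∃ y, y ∈ x.1.2 ∧ y ∈ x'.1.2 ∧ K.T (L.p y) x.1.1 x'.1.1
  U_E := by
    rintro x _ ⟨y, hy, rfl⟩
    exact (x.up hy).1.symm
  U_T := by
    rintro x _ _ ⟨y, hy, rfl⟩ ⟨y', hy', rfl⟩ hne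
    exact K.rot (K.rot (x.H_of_mem hy hy' fun e => hne (congrArg _ e.symm)).2)
  H_symm := fun ⟨y, h1, h2, h3⟩ => ⟨y, h2, h1, T_swap₂₃ h3⟩
  H_T := fun ⟨y, h1, h2, h3⟩ => ⟨L.p y, ⟨y, h1, rfl⟩, ⟨y, h2, rfl⟩, K.rot h3⟩
  H_exists := by
    rintro x _ w ⟨y, hy, rfl⟩ hT hw
    have hxy := x.up hy
    have hU : w ∉ L.U y := fun h => hxy.2.2 w h (K.rot hT)
    have hup : L.Up y w := by
      refine ⟨T_E₂₃ hT, hU, fun u hu hT' => ?_⟩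
      obtain ⟨y', h1, rfl⟩ := L.H_exists hu hT' hU
      refine hw ⟨y', ?_, rfl⟩
      rw [x.eq_cls hy]
      exact .inr ⟨h1, K.rot hT⟩
    exact ⟨hup.toNext, ⟨y, hy, L.mem_cls_self _ _, K.swap hT⟩, rfl⟩
  H_unique := by
    rintro x x1 x2 ⟨y, h1, h2, h3⟩ ⟨y', h1', h2', h3'⟩ e
    obtain rfl := NextX.eq_of_mem h1 h1' h3 (e ▸ T_E₁₃ h3')
    exact NextX.ext e h2 h2'
  H_notMem := by
    rintro x x' ⟨y, h1, h2, h3⟩ ⟨y', h1', e⟩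
    have hne : y' ≠ y := by
      rintro rfl
      exact (T_E₁₃ h3).ne e
    obtain ⟨u, hu, -, hT⟩ := L.H_T (x.H_of_mem h1 h1' hne).1
    exact (x'.up h2).2.2 u hu (e ▸ T_swap₂₃ hT)

/-- The levels. -/
def tower (K : TriComplex V) (v : V) : ℕ → Level K
  | 0 => base K v
  | k + 1 => (tower K v k).next

end Level

end Artin

namespace Artin

universe u

open TriComplex

/-- A covering of a complex. -/
structure Cover {V : Type u} (K : TriComplex V) where
  /-- the vertices -/
  Y : Type u
  /-- the projection -/
  q : Y → V
  /-- the adjacency -/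
  A : Y → Y → Prop
  symm : ∀ {a b}, A a b → A b a
  exists_lift : ∀ {a z}, K.E (q a) z → ∃ b, A a b ∧ q b = z
  unique_lift : ∀ {a b c}, A a b → A a c → q b = q c → b = c
  triangle : ∀ {a b c}, A a b → A a c → K.T (q a) (q b) (q c) → A b c

/-- Every connected cover is trivial. -/
def TriComplex.SimplyConnected {V : Type u} (K : TriComplex V) : Prop :=
  ∀ (C : Cover K) (y : C.Y), ∃ f : V → C.Y, (∀ x, C.q (f x) = x) ∧
    (∀ x x', K.E x x' → C.A (f x) (f x')) ∧ f (C.q y) = y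

/-- The properties of the distance to a vertex `v` in a complex with edges `E` and triangles `T`
of nonpositive curvature. -/
structure IsLevel {V : Type*} (E : V → V → Prop) (T : V → V → V → Prop) (v : V) (l : V → ℕ) :
    Prop where
  zero_iff : ∀ x, l x = 0 ↔ x = v
  le_succ : ∀ x y, E x y → l y ≤ l x + 1
  parent : ∀ x, x ≠ v → ∃ y, E x y ∧ l x = l y + 1
  parents : ∀ x y y', E x y → E x y' → l x = l y + 1 → l x = l y' + 1 → y ≠ y' → T x y y'
  horizontal : ∀ x y, E x y → l x = l y → ∃ z, T x y z ∧ l x = l z + 1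

theorem IsLevel.eq {V : Type*} {E : V → V → Prop} {T : V → V → V → Prop} (hE : ∀ x y, E x y → E y x)
    {v : V} {l l' : V → ℕ} (h : IsLevel E T v l) (h' : IsLevel E T v l') : l = l' := by
  have key : ∀ l l', IsLevel E T v l → IsLevel E T v l' → ∀ n x, l' x = n → l x ≤ n := by
    intro l l' h h' n
    induction n with
    | zero =>
      intro x hx
      rw [(h.zero_iff x).2 ((h'.zero_iff x).1 hx)]
    | succ n ih =>
      intro x hx
      obtain ⟨y, hy, e⟩ := h'.parent x fun e => by
        rw [(h'.zero_iff x).2 e] at hx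
        omega
      have := ih y (by omega)
      have := h.le_succ y x (hE _ _ hy)
      omega
  funext x
  exact le_antisymm (key _ _ h h' _ x rfl) (key _ _ h' h _ x rfl)

namespace Level

variable {V : Type u} {K : TriComplex V} {v : V}

/-- Adjacency in the tower. -/
inductive Adj (K : TriComplex V) (v : V) :
    (Σ k, (tower K v k).X) → (Σ k, (tower K v k).X) → Prop
  | hor {k} {x y : (tower K v k).X} : (tower K v k).H x y → Adj K v ⟨k, x⟩ ⟨k, y⟩
  | up {k} {y : (tower K v k).X} {x : (tower K v k).NextX} : y ∈ x.1.2 → Adj K v ⟨k, y⟩ ⟨k + 1, x⟩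
  | down {k} {y : (tower K v k).X} {x : (tower K v k).NextX} : y ∈ x.1.2 →
      Adj K v ⟨k + 1, x⟩ ⟨k, y⟩

theorem Adj.symm {a b} (h : Adj K v a b) : Adj K v b a := by
  cases h with
  | hor h => exact .hor ((tower K v _).H_symm h)
  | up h => exact .down h
  | down h => exact .up h

/-- The projection of the tower. -/
def proj (K : TriComplex V) (v : V) (a : Σ k, (tower K v k).X) : V := (tower K v a.1).p a.2

theorem exists_adj {a z} (h : K.E (proj K v a) z) : ∃ b, Adj K v a b ∧ proj K v b = z := by
  obtain ⟨k, x⟩ := a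
  by_cases hU : z ∈ (tower K v k).U x
  · cases k with
    | zero => exact absurd hU (Set.notMem_empty z)
    | succ k =>
      obtain ⟨y, hy, rfl⟩ := hU
      exact ⟨⟨k, y⟩, .down hy, rfl⟩
  by_cases hN : ∃ u ∈ (tower K v k).U x, K.T ((tower K v k).p x) u z
  · obtain ⟨u, hu, hT⟩ := hN
    obtain ⟨y, h1, h2⟩ := (tower K v k).H_exists hu hT hU
    exact ⟨⟨k, y⟩, .hor h1, h2⟩
  · have hup : (tower K v k).Up x z := ⟨h, hU, fun u hu hT => hN ⟨u, hu, hT⟩⟩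
    exact ⟨⟨k + 1, hup.toNext⟩, .up ((tower K v k).mem_cls_self _ _), rfl⟩

theorem mem_U_of_mem {k} {y : (tower K v k).X} {x : (tower K v k).NextX} (h : y ∈ x.1.2) :
    (tower K v k).p y ∈ (tower K v (k + 1)).U x := ⟨y, h, rfl⟩

theorem adj_unique {a b c} (hb : Adj K v a b) (hc : Adj K v a c)
    (e : proj K v b = proj K v c) : b = c := by
  have hh : ∀ {k} {x y z : (tower K v k).X}, (tower K v k).H x y → (tower K v k).H x z →
      (tower K v k).p y = (tower K v k).p z → y = z := (tower K v _).H_unique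
  have hd : ∀ {k} {x y : (tower K v (k + 1)).X} {z : (tower K v k).X}, (tower K v (k + 1)).H x y →
      z ∈ x.1.2 → (tower K v (k + 1)).p y = (tower K v k).p z → False := by
    intro k x y z h1 h2 h3
    exact (tower K v (k + 1)).H_notMem h1 (h3 ▸ mem_U_of_mem h2)
  have hu : ∀ {k} {x y : (tower K v k).X} {z : (tower K v k).NextX}, (tower K v k).H x y →
      x ∈ z.1.2 → (tower K v k).p y = z.1.1 → False := by
    intro k x y z h1 h2 h3
    obtain ⟨u, hu, -, hT⟩ := (tower K v k).H_T h1
    exact (z.up h2).2.2 u hu (h3 ▸ T_swap₂₃ hT)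
  have hdu : ∀ {k} {x : (tower K v (k + 1)).X} {y : (tower K v k).X}
      {z : (tower K v (k + 1)).NextX}, y ∈ x.1.2 → x ∈ z.1.2 → (tower K v k).p y = z.1.1 → False := by
    intro k x y z h1 h2 h3
    exact (z.up h2).2.1 (h3 ▸ mem_U_of_mem h1)
  have hdd : ∀ {k} {y y' : (tower K v k).X} {x : (tower K v k).NextX}, y ∈ x.1.2 → y' ∈ x.1.2 →
      (tower K v k).p y = (tower K v k).p y' → y = y' := by
    intro k y y' x h1 h2 h3
    by_contra hne
    exact (T_E₁₂ (x.H_of_mem h1 h2 (Ne.symm hne)).2).ne h3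
  cases hb with
  | hor h =>
    cases hc with
    | hor h' => rw [hh h h' e]
    | up h' => exact (hu h h' e).elim
    | down h' => exact (hd h h' e).elim
  | up h =>
    cases hc with
    | hor h' => exact (hu h' h e.symm).elim
    | up h' => exact congrArg (Sigma.mk _) (NextX.ext e h h')
    | down h' => exact (hdu h' h e.symm).elim
  | down h =>
    cases hc with
    | hor h' => exact (hd h' h e.symm).elim
    | up h' => exact (hdu h h' e).elim
    | down h' => exact congrArg (Sigma.mk _) (hdd h h' e)

theorem adj_triangle {a b c} (hb : Adj K v a b) (hc : Adj K v a c)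
    (hT : K.T (proj K v a) (proj K v b) (proj K v c)) : Adj K v b c := by
  have hdh : ∀ {k} {x y : (tower K v (k + 1)).X} {z : (tower K v k).X}, (tower K v (k + 1)).H x y →
      z ∈ x.1.2 → K.E ((tower K v k).p z) ((tower K v (k + 1)).p y) → z ∈ y.1.2 := by
    rintro k x y z ⟨z', h1, h2, h3⟩ h4 h5
    rwa [← NextX.eq_of_mem h1 h4 h3 h5]
  have hdu : ∀ {k} {x : (tower K v (k + 1)).X} {y : (tower K v k).X}
      {z : (tower K v (k + 1)).NextX}, y ∈ x.1.2 → x ∈ z.1.2 →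
      K.T ((tower K v (k + 1)).p x) ((tower K v k).p y) z.1.1 → False := by
    intro k x y z h1 h2 h3
    exact (z.up h2).2.2 _ (mem_U_of_mem h1) h3
  have hhu : ∀ {k} {x y : (tower K v k).X} {z : (tower K v k).NextX}, (tower K v k).H x y →
      x ∈ z.1.2 → K.T ((tower K v k).p x) ((tower K v k).p y) z.1.1 → y ∈ z.1.2 := by
    intro k x y z h1 h2 h3
    rw [z.eq_cls h2]
    exact .inr ⟨h1, h3⟩
  have hdd : ∀ {k} {y y' : (tower K v k).X} {x : (tower K v k).NextX}, y ∈ x.1.2 → y' ∈ x.1.2 →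
      K.T x.1.1 ((tower K v k).p y) ((tower K v k).p y') → (tower K v k).H y y' := by
    intro k y y' x h1 h2 h3
    refine (x.H_of_mem h1 h2 fun e => ?_).1
    exact (T_E₂₃ h3).ne (congrArg _ e.symm)
  cases hb with
  | hor h =>
    cases hc with
    | hor h' =>
      exfalso
      obtain ⟨u, hu, -, h1⟩ := (tower K v _).H_T h
      obtain ⟨u', hu', -, h2⟩ := (tower K v _).H_T h'
      have c1 := color_eq_of_T hT h1
      have c2 := color_eq_of_T (T_swap₂₃ hT) h2
      have hne : u' ≠ u := by
        rintro rfl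
        exact (T_E₂₃ hT).color_ne (c2.symm.trans c1)
      rcases K.link hT (T_swap₂₃ h2) h1 ((tower K v _).U_T hu' hu hne) with e | e
      · replace e : (tower K v _).p _ = u' := e
        exact (tower K v _).H_notMem h (by rw [e]; exact hu')
      · replace e : (tower K v _).p _ = u := e
        exact (tower K v _).H_notMem h' (by rw [e]; exact hu)
    | up h' => exact .up (hhu h h' hT)
    | down h' => exact .down (hdh h h' (T_E₂₃ hT).symm)
  | up h =>
    cases hc with
    | hor h' => exact .down (hhu h' h (T_swap₂₃ hT))
    | up h' => exact .hor ⟨_, h, h', hT⟩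
    | down h' => exact (hdu h' h (T_swap₂₃ hT)).elim
  | down h =>
    cases hc with
    | hor h' => exact .up (hdh h' h (T_E₂₃ hT))
    | up h' => exact (hdu h h' hT).elim
    | down h' => exact .hor (hdd h h' hT)

/-- The universal cover. -/
def cover (K : TriComplex V) (v : V) : Cover K where
  Y := Σ k, (tower K v k).X
  q := proj K v
  A := Adj K v
  symm := Adj.symm
  exists_lift := exists_adj
  unique_lift := adj_unique
  triangle := adj_triangle

end Level

open Level in
theorem TriComplex.SimplyConnected.exists_isLevel {V : Type u} {K : TriComplex V}
    (hK : K.SimplyConnected) (v : V) : ∃ l, IsLevel K.E K.T v l := by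
  obtain ⟨f, hf, hA, hv⟩ : ∃ f : V → Σ k, (tower K v k).X, (∀ x, proj K v (f x) = x) ∧
      (∀ x x', K.E x x' → Adj K v (f x) (f x')) ∧ f v = ⟨0, PUnit.unit⟩ :=
    hK (cover K v) ⟨0, PUnit.unit⟩
  have hsurj : ∀ k (x : (tower K v k).X), f ((tower K v k).p x) = ⟨k, x⟩ := by
    intro k
    induction k with
    | zero =>
      intro x
      exact hv
    | succ k ih =>
      intro x
      obtain ⟨y, hy⟩ := NextX.nonempty x
      refine (cover K v).unique_lift (a := f ((tower K v k).p y)) (hA _ _ (x.up hy).1) ?_ ?_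
      · rw [ih y]
        exact Adj.up hy
      · exact hf _
  refine ⟨fun x => (f x).1, fun x => ⟨fun h => ?_, fun h => by rw [h, hv]⟩, fun x y h => ?_,
    fun x hx => ?_, fun x y y' h h' e e' hne => ?_, fun x y h e => ?_⟩
  · rw [← hf x]
    generalize f x = a at *
    obtain ⟨k, a⟩ := a
    obtain rfl : k = 0 := h
    rfl
  · have := hA x y h
    generalize f x = a at *
    generalize f y = b at *
    cases this <;> dsimp only <;> omega
  · have hx' := hf x
    generalize hfx : f x = a at *
    obtain ⟨k, a⟩ := a
    cases k with
    | zero => exact absurd hx'.symm hx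
    | succ k =>
      obtain ⟨y, hy⟩ := NextX.nonempty a
      refine ⟨(tower K v k).p y, ?_, by rw [hsurj]⟩
      rw [← hx']
      exact (a.up hy).1.symm
  · have h1 := hA x y h
    have h2 := hA x y' h'
    have hx := hf x
    have hy := hf y
    have hy' := hf y'
    generalize f x = a at *
    generalize f y = b at *
    generalize f y' = c at *
    rw [← hx]
    cases h1 with
    | hor h => simp at e
    | up h => dsimp only at e; omega
    | down h =>
      cases h2 with
      | hor h => simp at e'
      | up h => dsimp only at e'; omega
      | down h' =>
        rw [← hy, ← hy'] at hne ⊢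
        exact (tower K v _).U_T (mem_U_of_mem h) (mem_U_of_mem h') hne
  · have h1 := hA x y h
    have hx := hf x
    have hy := hf y
    generalize f x = a at *
    generalize f y = b at *
    cases h1 with
    | @hor k x' y' h =>
      cases k with
      | zero => exact h.elim
      | succ k =>
        obtain ⟨u, ⟨z, -, rfl⟩, -, h2⟩ := (tower K v (k + 1)).H_T h
        refine ⟨(tower K v k).p z, ?_, by rw [hsurj]⟩
        rw [← hx, ← hy]
        exact h2
    | up h => simp at e
    | down h => simp at e

end Artin

namespace Artin

universe u

open TriComplex

/-- The coset of `g` of color `i`. -/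
def vert {A : Type*} [Group A] (G : Fin 3 → Subgroup A) (g : A) (i : Fin 3) : Σ i, A ⧸ G i :=
  ⟨i, (g : A ⧸ G i)⟩

section vert

variable {A : Type*} [Group A] {G : Fin 3 → Subgroup A}

theorem exists_vert (x : Σ i, A ⧸ G i) : ∃ g, x = vert G g x.1 := by
  obtain ⟨i, c⟩ := x
  obtain ⟨g, rfl⟩ := QuotientGroup.mk_surjective c
  exact ⟨g, rfl⟩

theorem vert_eq_iff {g h : A} {i : Fin 3} : vert G g i = vert G h i ↔ g⁻¹ * h ∈ G i := by
  rw [← QuotientGroup.eq]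
  exact ⟨fun e => eq_of_heq (Sigma.mk.inj e).2, fun e => congrArg (Sigma.mk i) e⟩

theorem vert_mul {g h : A} {i : Fin 3} (hh : h ∈ G i) : vert G (g * h) i = vert G g i := by
  rw [vert_eq_iff]
  simpa using hh

/-- Three cosets of different colors with a common element. -/
def CosetTriangle (G : Fin 3 → Subgroup A) (x y z : Σ i, A ⧸ G i) : Prop :=
  (x.1 ≠ y.1 ∧ x.1 ≠ z.1 ∧ y.1 ≠ z.1) ∧
    ∃ g, x = vert G g x.1 ∧ y = vert G g y.1 ∧ z = vert G g z.1

/-- The absence of cycles of length four in the links of the coset complex. -/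
def NoSquare (G : Fin 3 → Subgroup A) : Prop :=
  ∀ i j k, i ≠ j → i ≠ k → j ≠ k → ∀ a₁ b₁ a₂ b₂, a₁ ∈ G i ⊓ G k → a₂ ∈ G i ⊓ G k →
    b₁ ∈ G i ⊓ G j → b₂ ∈ G i ⊓ G j → a₁ * b₁ * a₂ * b₂ = 1 → a₁ ∈ G j ∨ b₁ ∈ G k

end vert

/-- The coset complex. -/
def cosetComplex {A : Type u} [Group A] {G : Fin 3 → Subgroup A} (hG : NoSquare G) :
    TriComplex (Σ i, A ⧸ G i) where
  color := Sigma.fst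
  T := CosetTriangle G
  swap := fun ⟨⟨h1, h2, h3⟩, g, hx, hy, hz⟩ => ⟨⟨h1.symm, h3, h2⟩, g, hy, hx, hz⟩
  rot := fun ⟨⟨h1, h2, h3⟩, g, hx, hy, hz⟩ => ⟨⟨h3, h1.symm, h2.symm⟩, g, hy, hz, hx⟩
  color_ne := fun h => h.1.1
  link := by
    rintro x y y' z z' ⟨⟨c1, c2, c3⟩, g₀, h1, h2, h3⟩ ⟨⟨c4, c5, c6⟩, g₁, h4, h5, h6⟩
      ⟨⟨c7, c8, c9⟩, g₃, h7, h8, h9⟩ ⟨⟨c10, c11, c12⟩, g₂, h10, h11, h12⟩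
    have cy : y'.1 = y.1 := by omega
    have cz : z'.1 = z.1 := by omega
    rw [cy] at h5 h11
    rw [cz] at h9 h12
    have e : ∀ {w} {g h : A} {i : Fin 3}, w = vert G g i → w = vert G h i → g⁻¹ * h ∈ G i :=
      fun h1 h2 => vert_eq_iff.1 (h1.symm.trans h2)
    rcases hG x.1 y.1 z.1 c1 c2 c3 (g₀⁻¹ * g₁) (g₁⁻¹ * g₂) (g₂⁻¹ * g₃) (g₃⁻¹ * g₀)
      ⟨e h1 h4, e h3 h6⟩ ⟨e h10 h7, e h12 h9⟩ ⟨e h4 h10, e h5 h11⟩ ⟨e h7 h1, e h8 h2⟩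
      (by group) with h | h
    · left
      rw [h2, h5, vert_eq_iff]
      exact h
    · right
      rw [h6, h12, vert_eq_iff]
      exact h

section cosetComplex

variable {A : Type u} [Group A] {G : Fin 3 → Subgroup A} (hG : NoSquare G)

theorem cosetComplex_T_vert {i j k : Fin 3} (h1 : i ≠ j) (h2 : i ≠ k) (h3 : j ≠ k) (g : A) :
    (cosetComplex hG).T (vert G g i) (vert G g j) (vert G g k) :=
  ⟨⟨h1, h2, h3⟩, g, rfl, rfl, rfl⟩

theorem cosetComplex_E_vert {i j : Fin 3} (h : i ≠ j) (g : A) :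
    (cosetComplex hG).E (vert G g i) (vert G g j) := by
  obtain ⟨k, h1, h2⟩ : ∃ k : Fin 3, i ≠ k ∧ j ≠ k := by decide +revert
  exact ⟨_, cosetComplex_T_vert hG h h1 h2 g⟩

theorem exists_of_cosetComplex_E {x y} (h : (cosetComplex hG).E x y) :
    x.1 ≠ y.1 ∧ ∃ g, x = vert G g x.1 ∧ y = vert G g y.1 :=
  h.elim fun _ h => ⟨h.1.1, h.2.imp fun _ h => ⟨h.1, h.2.1⟩⟩

/-- A lift of a triangle of the coset complex to a cover. -/
structure LiftedTriangle (C : Cover (cosetComplex hG)) where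
  /-- the vertices -/
  c : Fin 3 → C.Y
  /-- the inverse of the common element -/
  g : A
  q_c : ∀ i, C.q (c i) = vert G g⁻¹ i
  A_c : ∀ i j, i ≠ j → C.A (c i) (c j)

variable {hG} {C : Cover (cosetComplex hG)}

namespace LiftedTriangle

theorem ext_of_eq {a b : LiftedTriangle hG C} (hg : a.g = b.g) (i : Fin 3) (hc : a.c i = b.c i) :
    a = b := by
  have : a.c = b.c := by
    funext j
    by_cases hj : j = i
    · rw [hj, hc]
    · have h1 := a.A_c i j (Ne.symm hj)
      rw [hc] at h1
      refine C.unique_lift h1 (b.A_c i j (Ne.symm hj)) ?_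
      rw [a.q_c, b.q_c, hg]
  cases a
  cases b
  simp_all

open Classical in
theorem exists_of_eq {y : C.Y} {g : A} {i : Fin 3} (h : C.q y = vert G g⁻¹ i) :
    ∃ a : LiftedTriangle hG C, a.g = g ∧ a.c i = y := by
  have h1 : ∀ j, ∃ b, (j = i → b = y) ∧ (j ≠ i → C.A y b) ∧ C.q b = vert G g⁻¹ j := by
    intro j
    by_cases hj : j = i
    · exact ⟨y, fun _ => rfl, fun h => absurd hj h, by rw [hj, h]⟩
    · obtain ⟨b, hb, hb'⟩ := C.exists_lift (a := y) (z := vert G g⁻¹ j)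
        (h ▸ cosetComplex_E_vert hG (Ne.symm hj) _)
      exact ⟨b, fun h => absurd h hj, fun _ => hb, hb'⟩
  choose c hc1 hc2 hc3 using h1
  refine ⟨⟨c, g, hc3, fun j k hjk => ?_⟩, rfl, hc1 i rfl⟩
  by_cases hj : j = i
  · rw [hc1 j hj]
    exact hc2 k (fun h => hjk (hj.trans h.symm))
  by_cases hk : k = i
  · rw [hc1 k hk]
    exact C.symm (hc2 j hj)
  refine C.triangle (hc2 j hj) (hc2 k hk) ?_
  rw [h, hc3, hc3]
  exact cosetComplex_T_vert hG (Ne.symm hj) (Ne.symm hk) hjk _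

theorem exists_smul (a : LiftedTriangle hG C) {i : Fin 3} {h : A} (hh : h ∈ G i) :
    ∃ b : LiftedTriangle hG C, b.g = h * a.g ∧ b.c i = a.c i := by
  refine exists_of_eq ?_
  rw [a.q_c, mul_inv_rev, vert_mul (inv_mem hh)]

theorem c_eq_of_mem {a b : LiftedTriangle hG C} {i j : Fin 3} {h : A} (hg : b.g = h * a.g)
    (hc : b.c i = a.c i) (hj : h ∈ G j) : b.c j = a.c j := by
  by_cases hij : i = j
  · rwa [← hij]
  have h1 := b.A_c i j hij
  rw [hc] at h1
  refine C.unique_lift h1 (a.A_c i j hij) ?_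
  rw [b.q_c, a.q_c, hg, mul_inv_rev, vert_mul (inv_mem hj)]

/-- The action on chambers of the stabilizer of a color. -/
@[reducible]
noncomputable def action (C : Cover (cosetComplex hG)) (i : Fin 3) :
    MulAction (G i) (LiftedTriangle hG C) where
  smul h a := (a.exists_smul h.2).choose
  one_smul a := by
    have h := (a.exists_smul (one_mem (G i))).choose_spec
    exact ext_of_eq (h.1.trans (one_mul _)) i h.2
  mul_smul x y a := by
    have h1 := (a.exists_smul (mul_mem x.2 y.2)).choose_spec
    have h2 := (a.exists_smul y.2).choose_spec
    have h3 := ((a.exists_smul y.2).choose.exists_smul x.2).choose_spec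
    exact ext_of_eq (h1.1.trans (by rw [mul_assoc, ← h2.1]; exact h3.1.symm)) i
      (h1.2.trans (h2.2.symm.trans h3.2.symm))

/-- The action on chambers of the stabilizer of a color, as a homomorphism. -/
noncomputable def perm (C : Cover (cosetComplex hG)) (i : Fin 3) :
    G i →* Equiv.Perm (LiftedTriangle hG C) :=
  letI := action C i
  MulAction.toPermHom _ _

theorem perm_g {i : Fin 3} (h : G i) (a : LiftedTriangle hG C) : (perm C i h a).g = h * a.g :=
  (a.exists_smul h.2).choose_spec.1

theorem perm_c {i : Fin 3} (h : G i) (a : LiftedTriangle hG C) : (perm C i h a).c i = a.c i :=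
  (a.exists_smul h.2).choose_spec.2

theorem perm_eq {i j : Fin 3} {h : A} (hi : h ∈ G i) (hj : h ∈ G j) :
    perm C i ⟨h, hi⟩ = perm C j ⟨h, hj⟩ := by
  ext1 a
  refine ext_of_eq ?_ j ?_
  · rw [perm_g, perm_g]
  · rw [perm_c]
    exact c_eq_of_mem (perm_g _ _) (perm_c _ _) hj

end LiftedTriangle

theorem simplyConnected_of_hom
    (h : ∀ C : Cover (cosetComplex hG), ∃ f : A →* Equiv.Perm (LiftedTriangle hG C),
      (∀ x a, (f x a).g = x * a.g) ∧ ∀ i, ∀ x ∈ G i, ∀ a, (f x a).c i = a.c i) :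
    (cosetComplex hG).SimplyConnected := by
  intro C y
  obtain ⟨f, hg, hc⟩ := h C
  obtain ⟨g₀, h₀⟩ := exists_vert (C.q y)
  obtain ⟨a, ha, hay⟩ := LiftedTriangle.exists_of_eq (C := C) (y := y) (g := g₀⁻¹) (by rwa [inv_inv])
  have key : ∀ g i, (f ((vert G g i).2.out⁻¹ * g₀) a).c i = (f (g⁻¹ * g₀) a).c i := by
    intro g i
    obtain ⟨h, hh⟩ := QuotientGroup.mk_out_eq_mul (G i) g
    change (f ((g : A ⧸ G i).out⁻¹ * g₀) a).c i = _
    rw [hh, mul_inv_rev, mul_assoc, map_mul, Equiv.Perm.mul_apply, hc i _ (inv_mem h.2)]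
  refine ⟨fun x => (f (x.2.out⁻¹ * g₀) a).c x.1, fun x => ?_, fun x x' hx => ?_, ?_⟩
  · obtain ⟨g, hx⟩ := exists_vert x
    obtain ⟨i, hi⟩ : ∃ i, x = vert G g i := ⟨_, hx⟩
    subst hi
    refine (congrArg C.q (key g i)).trans ?_
    rw [LiftedTriangle.q_c, hg, ha]
    simp
  · obtain ⟨hne, g, h1, h2⟩ := exists_of_cosetComplex_E hG hx
    obtain ⟨i, hi⟩ : ∃ i, i = x.1 := ⟨_, rfl⟩
    obtain ⟨j, hj⟩ : ∃ j, j = x'.1 := ⟨_, rfl⟩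
    rw [← hi] at h1 hne
    rw [← hj] at h2 hne
    subst h1 h2
    change C.A ((f ((vert G g i).2.out⁻¹ * g₀) a).c i) ((f ((vert G g j).2.out⁻¹ * g₀) a).c j)
    rw [key, key]
    exact LiftedTriangle.A_c _ _ _ hne
  · obtain ⟨i, hi⟩ : ∃ i, i = (C.q y).1 := ⟨_, rfl⟩
    rw [← hi] at h₀ hay
    rw [h₀]
    refine (key g₀ i).trans ?_
    rw [inv_mul_cancel, map_one]
    exact hay

end cosetComplex

end Artin

namespace Artin

universe u

open TriComplex

variable {S : Type u} {M : S → S → ℕ∞}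

/-- The stabilizers of the vertices of a chamber of the coset complex. -/
def corank (M : S → S → ℕ∞) (e : Fin 3 → S) (i : Fin 3) : Subgroup (ArtinGroup M) :=
  StandardParabolic M {e i}ᶜ

theorem gen_mem_corank {e : Fin 3 → S} {i : Fin 3} {s : S} (h : e i ≠ s) :
    gen M s ∈ corank M e i :=
  gen_mem_standardParabolic (by simpa using h.symm)

theorem simplyConnected_corank {e : Fin 3 → S} (he : Function.Injective e)
    (hG : NoSquare (corank M e)) : (cosetComplex hG).SimplyConnected := by
  refine simplyConnected_of_hom fun C => ?_
  have hidx : ∀ s t : S, ∃ i, e i ≠ s ∧ e i ≠ t := by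
    intro s t
    by_contra! h
    have h01 := he.ne (show (0 : Fin 3) ≠ 1 by decide)
    have h02 := he.ne (show (0 : Fin 3) ≠ 2 by decide)
    have h12 := he.ne (show (1 : Fin 3) ≠ 2 by decide)
    have h0 := h 0
    have h1 := h 1
    have h2 := h 2
    by_cases e 0 = s <;> by_cases e 1 = s <;> by_cases e 2 = s <;> simp_all
  choose idx h1 using fun s => (hidx s s).imp fun _ h => h.1
  set f : S → Equiv.Perm (LiftedTriangle hG C) := fun s =>
    LiftedTriangle.perm C (idx s) ⟨gen M s, gen_mem_corank (h1 s)⟩ with hf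
  have hfi : ∀ s i (h : e i ≠ s), f s = LiftedTriangle.perm C i ⟨gen M s, gen_mem_corank h⟩ :=
    fun s i h => LiftedTriangle.perm_eq _ _
  have hbr : SatisfiesBraid M f := by
    intro s t hst k hk
    obtain ⟨i, hs, ht⟩ := hidx s t
    rw [hfi s i hs, hfi t i ht, ← map_ralt, ← map_ralt]
    congr 1
    apply Subtype.ext
    change (corank M e i).subtype _ = (corank M e i).subtype _
    rw [map_ralt, map_ralt]
    exact satisfiesBraid_gen M s t hst k hk
  have hgen : ∀ s, liftHom f hbr (gen M s) = f s := liftHom_gen f hbr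
  refine ⟨liftHom f hbr, fun x => ?_, fun i x hx => ?_⟩
  · induction x using artin_induction with
    | one => simp
    | gen_mul s g ih =>
      intro a
      rw [map_mul, hgen, Equiv.Perm.mul_apply, hfi s _ (h1 s), LiftedTriangle.perm_g, ih, mul_assoc]
    | inv_mul s g ih =>
      intro a
      rw [map_mul, map_inv, hgen, Equiv.Perm.mul_apply, hfi s _ (h1 s), ← map_inv,
        LiftedTriangle.perm_g, ih, mul_assoc]
      rfl
  · refine parabolic_induction (p := fun x => ∀ a, (liftHom f hbr x a).c i = a.c i) ?_ ?_ ?_ hx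
    · simp
    · intro s hs g ih a
      rw [map_mul, hgen, Equiv.Perm.mul_apply, hfi s i (Ne.symm hs), LiftedTriangle.perm_c, ih]
    · intro s hs g ih a
      rw [map_mul, map_inv, hgen, Equiv.Perm.mul_apply, hfi s i (Ne.symm hs), ← map_inv,
        LiftedTriangle.perm_c, ih]

/-- There is no cycle of length four in the incidence graph of the cosets of two maximal
standard parabolic subgroups. -/
def NoSquareMax (M : S → S → ℕ∞) : Prop :=
  ∀ s t : S, s ≠ t → ∀ a₁ b₁ a₂ b₂, a₁ ∈ StandardParabolic M {s}ᶜ → a₂ ∈ StandardParabolic M {s}ᶜ →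
    b₁ ∈ StandardParabolic M {t}ᶜ → b₂ ∈ StandardParabolic M {t}ᶜ → a₁ * b₁ * a₂ * b₂ = 1 →
    a₁ ∈ StandardParabolic M {t}ᶜ ∨ b₁ ∈ StandardParabolic M {s}ᶜ

theorem noSquare_corank (hM : Large M) (h : ∀ s, NoSquareMax (restrict M {s}ᶜ)) {e : Fin 3 → S}
    (he : Function.Injective e) : NoSquare (corank M e) := by
  intro i j k hij hik hjk a₁ b₁ a₂ b₂ ha₁ ha₂ hb₁ hb₂ h1
  have key : ∀ l, i ≠ l → ∃ hl : e l ∈ ({e i}ᶜ : Set S),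
      (∀ x ∈ corank M e i ⊓ corank M e l, ∃ y ∈ StandardParabolic (restrict M {e i}ᶜ)
        {(⟨e l, hl⟩ : ({e i}ᶜ : Set S))}ᶜ, incl M _ y = x) ∧
      (∀ y ∈ StandardParabolic (restrict M {e i}ᶜ)
        {(⟨e l, hl⟩ : ({e i}ᶜ : Set S))}ᶜ, incl M _ y ∈ corank M e l) := by
    intro l hl
    refine ⟨fun h => hl (he h).symm, fun x hx => ?_, fun y hy => ?_⟩
    · have := standardParabolic_inter hM hx.1 hx.2
      rw [← Subgroup.mem_map, map_incl_standardParabolic]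
      refine standardParabolic_mono ?_ this
      rintro s ⟨h1, h2⟩
      exact ⟨⟨s, h1⟩, fun h => h2 (congrArg Subtype.val h), rfl⟩
    · have := Subgroup.mem_map_of_mem (incl M _) hy
      rw [map_incl_standardParabolic] at this
      refine standardParabolic_mono ?_ this
      rintro _ ⟨s, h1, rfl⟩ h2
      exact h1 (Subtype.ext h2)
  obtain ⟨hj, hj1, hj2⟩ := key j hij
  obtain ⟨hk, hk1, hk2⟩ := key k hik
  obtain ⟨a₁, ia₁, rfl⟩ := hk1 _ ha₁
  obtain ⟨a₂, ia₂, rfl⟩ := hk1 _ ha₂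
  obtain ⟨b₁, ib₁, rfl⟩ := hj1 _ hb₁
  obtain ⟨b₂, ib₂, rfl⟩ := hj1 _ hb₂
  rw [← map_mul, ← map_mul, ← map_mul, ← map_one (incl M _)] at h1
  have h2 := incl_injective hM _ h1
  rcases h (e i) ⟨e k, hk⟩ ⟨e j, hj⟩ (fun h => hjk (he (congrArg Subtype.val h)).symm)
    _ _ _ _ ia₁ ia₂ ib₁ ib₂ h2 with h | h
  · exact .inl (hj2 _ h)
  · exact .inr (hk2 _ h)

theorem NoSquareMax.of_noSquare (h : ∀ e : Fin 3 → S, Function.Injective e → NoSquare (corank M e))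
    (hS : ∀ s t : S, ∃ r, r ≠ s ∧ r ≠ t) : NoSquareMax M := by
  intro s t hst a₁ b₁ a₂ b₂ ha₁ ha₂ hb₁ hb₂ h1
  obtain ⟨r, hrs, hrt⟩ := hS s t
  have he : Function.Injective ![s, t, r] := by
    intro i j hij
    fin_cases i <;> fin_cases j <;> simp_all
  set G := corank M ![s, t, r] with hG
  change a₁ ∈ G 0 at ha₁
  change a₂ ∈ G 0 at ha₂
  change b₁ ∈ G 1 at hb₁
  change b₂ ∈ G 1 at hb₂
  change a₁ ∈ G 1 ∨ b₁ ∈ G 0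
  have hsq := h _ he
  obtain ⟨l, hl⟩ := (simplyConnected_corank he hsq).exists_isLevel (vert G 1 0)
  have hv : l (vert G 1 0) = 0 := (hl.zero_iff _).2 rfl
  have h01 : (0 : Fin 3) ≠ 1 := by decide
  have hE : ∀ a ∈ G 0, (cosetComplex hsq).E (vert G 1 0) (vert G a 1) := by
    intro a ha
    have := cosetComplex_E_vert hsq h01 a
    rwa [show vert G a 0 = vert G 1 0 by simpa using vert_mul (g := 1) ha] at this
  have hl1 : ∀ a ∈ G 0, l (vert G a 1) = 1 := by
    intro a ha
    have h2 := hl.le_succ _ _ (hE a ha)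
    have h3 : l (vert G a 1) ≠ 0 := fun h => (hE a ha).ne ((hl.zero_iff _).1 h).symm
    omega
  have hE1 : (cosetComplex hsq).E (vert G (a₁ * b₁) 0) (vert G a₁ 1) := by
    rw [← vert_mul hb₁]
    exact cosetComplex_E_vert hsq h01 _
  have hE2 : (cosetComplex hsq).E (vert G (a₁ * b₁) 0) (vert G 1 1) := by
    have h2 : vert G (a₁ * b₁ * a₂) 1 = vert G 1 1 := by rw [← h1, vert_mul hb₂]
    rw [← h2, ← vert_mul ha₂]
    exact cosetComplex_E_vert hsq h01 _
  by_cases hx : vert G 1 0 = vert G (a₁ * b₁) 0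
  · right
    rw [vert_eq_iff, inv_one, one_mul] at hx
    exact (Subgroup.mul_mem_cancel_left _ ha₁).1 hx
  left
  by_contra hne
  have hne' : vert G a₁ 1 ≠ vert G 1 1 := by
    intro h
    rw [vert_eq_iff, mul_one] at h
    exact hne (by simpa using h)
  have l1 := hl1 _ ha₁
  have l2 := hl1 1 (one_mem _)
  have l3 := hl.le_succ _ _ hE1.symm
  have l4 : l (vert G (a₁ * b₁) 0) ≠ 0 := fun h => hx ((hl.zero_iff _).1 h).symm
  by_cases l5 : l (vert G (a₁ * b₁) 0) = 1
  · obtain ⟨z, hz, hz'⟩ := hl.horizontal _ _ hE1 (by omega)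
    obtain rfl := (hl.zero_iff z).1 (by omega)
    exact (T_E₁₃ hz).color_ne rfl
  · exact (T_E₂₃ (hl.parents _ _ _ hE1 hE2 (by omega) (by omega) hne')).color_ne rfl

theorem standardParabolic_compl_eq_zpowers {s t : S} (huniv : ∀ u, u = s ∨ u = t) (hst : s ≠ t) :
    StandardParabolic M {s}ᶜ = Subgroup.zpowers (gen M t) := by
  have : ({s}ᶜ : Set S) = {t} := by
    ext u
    have := huniv u
    simp only [Set.mem_compl_iff, Set.mem_singleton_iff]
    grind
  rw [this, StandardParabolic, Set.image_singleton, Subgroup.zpowers_eq_closure]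

theorem NoSquareMax.of_rank_two (hM : Large M) (hS : ∀ s t : S, s ≠ t → ∀ u, u = s ∨ u = t) :
    NoSquareMax M := by
  intro s t hst a₁ b₁ a₂ b₂
  have huniv := hS s t hst
  have huniv' := hS t s hst.symm
  rw [standardParabolic_compl_eq_zpowers huniv hst,
    standardParabolic_compl_eq_zpowers huniv' hst.symm]
  rintro ⟨i, rfl⟩ ⟨k, rfl⟩ ⟨j, rfl⟩ ⟨l, rfl⟩ h1
  rcases eq_zero_of_gen_zpow_cycle hM huniv' hst.symm h1 with rfl | rfl
  · exact .inl (by simp [one_mem])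
  · exact .inr (by simp [one_mem])

theorem noSquareMax (n : ℕ) : ∀ {S : Type u} [Finite S] (M : S → S → ℕ∞), Large M →
    Nat.card S = n → NoSquareMax M := by
  induction n using Nat.strong_induction_on with
  | _ n ih =>
    intro S _ M hM hn
    by_cases hS : ∀ s t : S, ∃ r, r ≠ s ∧ r ≠ t
    · refine .of_noSquare (fun e he => noSquare_corank hM (fun s => ?_) he) hS
      refine ih _ ?_ _ (hM.restrict _) rfl
      rw [← hn]
      have := Set.ncard_lt_card (s := ({s}ᶜ : Set S)) (by simp)
      simpa using this
    · push Not at hS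
      obtain ⟨s, t, hst⟩ := hS
      refine .of_rank_two hM fun x y hxy u => ?_
      have := hst x
      have := hst y
      have := hst u
      by_cases x = s <;> by_cases y = s <;> by_cases u = s <;> simp_all

theorem Large.noSquare_corank [Finite S] (hM : Large M) {e : Fin 3 → S}
    (he : Function.Injective e) : NoSquare (corank M e) :=
  Artin.noSquare_corank hM (fun _ => noSquareMax _ _ (hM.restrict _) rfl) he

end Artin

namespace Artin

section norm

variable {X : Type*}

/-- The action of a permutation on chains. -/
noncomputable def chainMap (σ : Equiv.Perm X) : (X →₀ ℤ) →ₗ[ℤ] (X →₀ ℤ) :=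
  Finsupp.lmapDomain ℤ ℤ σ

theorem chainMap_single (σ : Equiv.Perm X) (x : X) (n : ℤ) :
    chainMap σ (Finsupp.single x n) = Finsupp.single (σ x) n :=
  Finsupp.mapDomain_single

theorem chainMap_apply (σ : Equiv.Perm X) (c : X →₀ ℤ) (x : X) :
    chainMap σ c x = c (σ⁻¹ x) := by
  obtain ⟨y, rfl⟩ := σ.surjective x
  rw [← Equiv.Perm.mul_apply, inv_mul_cancel, Equiv.Perm.one_apply]
  exact Finsupp.mapDomain_apply σ.injective c y

/-- The norm. -/
noncomputable def norm {C : Type*} [AddCommGroup C] (p : ℕ) (s : C →ₗ[ℤ] C) : C →ₗ[ℤ] C :=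
  ∑ k ∈ Finset.range p, s ^ k

theorem norm_apply {C : Type*} [AddCommGroup C] (p : ℕ) (s : C →ₗ[ℤ] C) (c : C) :
    norm p s c = ∑ k ∈ Finset.range p, (s ^ k) c := by
  simp [norm]

theorem norm_map {C C' : Type*} [AddCommGroup C] [AddCommGroup C'] (p : ℕ) {s : C →ₗ[ℤ] C}
    {s' : C' →ₗ[ℤ] C'} (d : C →ₗ[ℤ] C') (h : ∀ c, d (s c) = s' (d c)) (c : C) :
    d (norm p s c) = norm p s' (d c) := by
  rw [norm_apply, norm_apply, map_sum]
  refine Finset.sum_congr rfl fun k hk => ?_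
  clear hk
  induction k with
  | zero => rfl
  | succ k ih => rw [pow_succ', pow_succ', Module.End.mul_apply, Module.End.mul_apply, h, ih]

theorem map_norm {C : Type*} [AddCommGroup C] {p : ℕ} {s : C →ₗ[ℤ] C} (hs : s ^ p = 1) (c : C) :
    s (norm p s c) = norm p s c := by
  have h := Finset.sum_range_succ' (fun k => (s ^ k) c) p
  rw [Finset.sum_range_succ, hs] at h
  rw [norm_apply, map_sum]
  simp only [pow_zero, Module.End.one_apply, add_left_inj] at h
  rw [h]
  refine Finset.sum_congr rfl fun k _ => ?_
  rw [pow_succ', Module.End.mul_apply]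

theorem norm_sub {C : Type*} [AddCommGroup C] {p : ℕ} {s : C →ₗ[ℤ] C} (hs : s ^ p = 1) (c : C) :
    norm p s (s c - c) = 0 := by
  rw [map_sub, norm_map p s (fun _ => rfl) c |>.symm, map_norm hs, sub_self]

variable {σ : Equiv.Perm X} {p : ℕ}

theorem chainMap_pow_apply (k : ℕ) (c : X →₀ ℤ) (x : X) :
    (chainMap σ ^ k) c x = c ((σ⁻¹ ^ k) x) := by
  induction k generalizing x with
  | zero => rfl
  | succ k ih =>
    rw [pow_succ', Module.End.mul_apply, chainMap_apply, ih, pow_succ, Equiv.Perm.mul_apply]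

theorem chainMap_pow (hσ : σ ^ p = 1) : chainMap σ ^ p = 1 := by
  refine LinearMap.ext fun c => Finsupp.ext fun x => ?_
  rw [chainMap_pow_apply, inv_pow, hσ]
  rfl

theorem norm_chainMap_apply (c : X →₀ ℤ) (x : X) :
    norm p (chainMap σ) c x = ∑ k ∈ Finset.range p, c ((σ⁻¹ ^ k) x) := by
  rw [norm_apply, Finsupp.finsetSum_apply]
  exact Finset.sum_congr rfl fun k _ => chainMap_pow_apply k c x

theorem exists_orbit_section (hp : p.Prime) (hσ : σ ^ p = 1) (hfix : ∀ x, σ x ≠ x) :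
    ∃ r : X → X, (∀ x, ∃ i : ℤ, (σ ^ i) x = r x) ∧ (∀ x, r (r x) = r x) ∧
      ∀ x, ∃ k < p, ∀ l < p, r ((σ⁻¹ ^ l) x) = (σ⁻¹ ^ l) x ↔ l = k := by
  refine ⟨fun x => (Quotient.mk (Equiv.Perm.SameCycle.setoid σ) x).out, fun x => ?_, fun x => ?_,
    fun x => ?_⟩
  · exact (Equiv.Perm.SameCycle.symm (Quotient.mk_out (s := Equiv.Perm.SameCycle.setoid σ) x))
  · exact congrArg Quotient.out (Quotient.out_eq _)
  have hr : ∀ l : ℕ, (Quotient.mk (Equiv.Perm.SameCycle.setoid σ) ((σ⁻¹ ^ l) x)).out =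
      (Quotient.mk (Equiv.Perm.SameCycle.setoid σ) x).out := by
    intro l
    congr 1
    refine Quotient.sound (s := Equiv.Perm.SameCycle.setoid σ) ⟨l, ?_⟩
    rw [zpow_natCast, ← Equiv.Perm.mul_apply, inv_pow, mul_inv_cancel, Equiv.Perm.one_apply]
  simp only [hr]
  generalize hy : (Quotient.mk (Equiv.Perm.SameCycle.setoid σ) x).out = y
  obtain ⟨i, hi⟩ : Equiv.Perm.SameCycle σ y x :=
    hy ▸ Quotient.mk_out (s := Equiv.Perm.SameCycle.setoid σ) x
  have hp0 : (0 : ℤ) < p := by exact_mod_cast hp.pos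
  have hiy : y = (σ⁻¹ ^ (i % p).toNat) x := by
    have h1 : σ ^ i = σ ^ (i % p).toNat := by
      rw [← zpow_natCast σ, Int.toNat_of_nonneg (Int.emod_nonneg _ hp0.ne')]
      conv_lhs => rw [← Int.emod_add_mul_ediv i p, zpow_add, zpow_mul, zpow_natCast, hσ, one_zpow,
        mul_one]
    rw [← hi, h1, ← Equiv.Perm.mul_apply, inv_pow, inv_mul_cancel, Equiv.Perm.one_apply]
  refine ⟨(i % p).toNat, ?_, fun l hl => ⟨fun h => ?_, fun h => h ▸ hiy⟩⟩
  · have := Int.emod_lt_of_pos i hp0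
    omega
  have hk : (i % p).toNat < p := by
    have := Int.emod_lt_of_pos i hp0
    omega
  generalize (i % p).toNat = k at *
  rw [hiy] at h
  by_contra hne
  have key : ∀ a b : ℕ, a < b → b < p → (σ⁻¹ ^ a) x = (σ⁻¹ ^ b) x → False := by
    intro a b hab hb he
    obtain ⟨d, rfl⟩ := Nat.exists_eq_add_of_lt hab
    rw [add_assoc, pow_add, Equiv.Perm.mul_apply] at he
    have he' := ((σ⁻¹ ^ a).injective he).symm
    have hper : Function.IsPeriodicPt (σ⁻¹ : Equiv.Perm X) (d + 1) x := by
      rw [Function.IsPeriodicPt, Function.IsFixedPt, Equiv.Perm.iterate_eq_pow]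
      exact he'
    have hper' : Function.IsPeriodicPt (σ⁻¹ : Equiv.Perm X) p x := by
      rw [Function.IsPeriodicPt, Function.IsFixedPt, Equiv.Perm.iterate_eq_pow, inv_pow, hσ]
      rfl
    have := hper.gcd hper'
    rw [Nat.Coprime.gcd_eq_one ((hp.coprime_iff_not_dvd.2 fun h =>
      absurd (Nat.le_of_dvd (by omega) h) (by omega)).symm)] at this
    have h1 : σ⁻¹ x = x := this
    exact hfix x (Equiv.Perm.inv_eq_iff_eq.1 h1).symm
  rcases Nat.lt_or_gt_of_ne hne with h1 | h1
  · exact key l k h1 hk h.symm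
  · exact key k l h1 hl h

open Classical in
theorem exists_norm_eq (hp : p.Prime) (hσ : σ ^ p = 1) (hfix : ∀ x, σ x ≠ x) {c : X →₀ ℤ}
    (hc : chainMap σ c = c) : ∃ b, c = norm p (chainMap σ) b := by
  obtain ⟨r, -, -, hr⟩ := exists_orbit_section hp hσ hfix
  refine ⟨c.filter fun x => r x = x, Finsupp.ext fun x => ?_⟩
  obtain ⟨k, hk, h⟩ := hr x
  have hinv : ∀ k, (chainMap σ ^ k) c = c := by
    intro k
    induction k with
    | zero => rfl
    | succ k ih => rw [pow_succ, Module.End.mul_apply, hc, ih]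
  rw [norm_chainMap_apply, Finset.sum_eq_single_of_mem k (Finset.mem_range.2 hk)]
  · rw [Finsupp.filter_apply, if_pos ((h k hk).2 rfl), ← chainMap_pow_apply, hinv]
  · intro l hl hne
    rw [Finsupp.filter_apply, if_neg fun e => hne ((h l (Finset.mem_range.1 hl)).1 e)]

theorem exists_sub_eq (hp : p.Prime) (hσ : σ ^ p = 1) (hfix : ∀ x, σ x ≠ x) {c : X →₀ ℤ}
    (hc : norm p (chainMap σ) c = 0) : ∃ b, c = chainMap σ b - b := by
  obtain ⟨r, hr', hrr, hr⟩ := exists_orbit_section hp hσ hfix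
  have hmem : ∀ c : X →₀ ℤ, c - c.mapDomain r ∈ LinearMap.range (chainMap σ - 1) := by
    intro c
    induction c using Finsupp.induction_linear with
    | zero => simp
    | add c d hc hd =>
      rw [Finsupp.mapDomain_add, add_sub_add_comm]
      exact add_mem hc hd
    | single x n =>
      rw [Finsupp.mapDomain_single]
      obtain ⟨i, hi⟩ := hr' x
      rw [← hi]
      clear hi
      induction i using Int.induction_on with
      | zero => simp
      | succ i ih =>
        have : Finsupp.single x n - Finsupp.single ((σ ^ ((i : ℤ) + 1)) x) n =
            (Finsupp.single x n - Finsupp.single ((σ ^ (i : ℤ)) x) n) -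
            (chainMap σ - 1) (Finsupp.single ((σ ^ (i : ℤ)) x) n) := by
          rw [LinearMap.sub_apply, chainMap_single, add_comm, zpow_add, zpow_one]
          simp
        rw [this]
        exact sub_mem ih ⟨_, rfl⟩
      | pred i ih =>
        have : Finsupp.single x n - Finsupp.single ((σ ^ (-(i : ℤ) - 1)) x) n =
            (Finsupp.single x n - Finsupp.single ((σ ^ (-(i : ℤ))) x) n) +
            (chainMap σ - 1) (Finsupp.single ((σ ^ (-(i : ℤ) - 1)) x) n) := by
          rw [LinearMap.sub_apply, chainMap_single, ← Equiv.Perm.mul_apply, ← zpow_one_add]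
          simp
        rw [this]
        exact add_mem ih ⟨_, rfl⟩
  obtain ⟨b, hb⟩ := hmem c
  refine ⟨b, ?_⟩
  suffices h : c.mapDomain r = 0 by
    rw [h, sub_zero] at hb
    exact hb.symm
  have hN : norm p (chainMap σ) (c.mapDomain r) = 0 := by
    have := norm_sub (chainMap_pow hσ) b
    rw [show chainMap σ b - b = c - c.mapDomain r from hb, map_sub, hc, zero_sub, neg_eq_zero] at this
    exact this
  have hr0 : ∀ x, r x ≠ x → c.mapDomain r x = 0 := by
    intro x hx
    refine Finsupp.mapDomain_of_notMem_range _ _ ?_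
    rintro ⟨y, rfl⟩
    exact hx (hrr y)
  refine Finsupp.ext fun x => ?_
  obtain ⟨k, hk, h⟩ := hr x
  by_cases hx : r x = x
  · have hk0 : 0 = k := (h 0 hp.pos).1 hx
    have := congrArg (fun d => d x) hN
    simp only [norm_chainMap_apply, Finsupp.coe_zero, Pi.zero_apply] at this
    rw [Finset.sum_eq_single_of_mem 0 (Finset.mem_range.2 hp.pos)] at this
    · exact this
    · intro l hl hne
      exact hr0 _ fun e => hne (((h l (Finset.mem_range.1 hl)).1 e).trans hk0.symm)
  · exact hr0 x hx

/-- An algebraic form of Smith theory: a free action of a cyclic group of prime order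
on an acyclic complex does not exist. -/
theorem exists_eq_map_add_norm {X₀ X₁ X₂ : Type*} {σ₀ : Equiv.Perm X₀} {σ₁ : Equiv.Perm X₁}
    {σ₂ : Equiv.Perm X₂} (hp : p.Prime) (h₀ : σ₀ ^ p = 1) (h₁ : σ₁ ^ p = 1) (h₂ : σ₂ ^ p = 1)
    (hf₀ : ∀ x, σ₀ x ≠ x) (hf₁ : ∀ x, σ₁ x ≠ x) (hf₂ : ∀ x, σ₂ x ≠ x)
    (d₁ : (X₁ →₀ ℤ) →ₗ[ℤ] (X₀ →₀ ℤ)) (d₂ : (X₂ →₀ ℤ) →ₗ[ℤ] (X₁ →₀ ℤ))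
    (hd₁ : ∀ c, d₁ (chainMap σ₁ c) = chainMap σ₀ (d₁ c))
    (hd₂ : ∀ c, d₂ (chainMap σ₂ c) = chainMap σ₁ (d₂ c)) (hdd : ∀ c, d₁ (d₂ c) = 0)
    (hex₂ : ∀ c, d₂ c = 0 → c = 0) (hex₁ : ∀ c, d₁ c = 0 → ∃ b, d₂ b = c) {c : X₀ →₀ ℤ}
    (hc : ∃ b, d₁ b = chainMap σ₀ c - c) : ∃ a b, c = d₁ a + norm p (chainMap σ₀) b := by
  obtain ⟨c₁, hc₁⟩ := hc
  obtain ⟨c₂, hc₂⟩ := hex₁ (norm p (chainMap σ₁) c₁) (by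
    rw [norm_map p d₁ hd₁, hc₁, norm_sub (chainMap_pow h₀)])
  have h : chainMap σ₂ c₂ = c₂ := by
    rw [← sub_eq_zero]
    apply hex₂
    rw [map_sub, hd₂, hc₂, map_norm (chainMap_pow h₁), sub_self]
  obtain ⟨b₂, rfl⟩ := exists_norm_eq hp h₂ hf₂ h
  rw [norm_map p d₂ hd₂] at hc₂
  obtain ⟨b₁, hb₁⟩ := exists_sub_eq hp h₁ hf₁ (c := c₁ - d₂ b₂) (by rw [map_sub, hc₂, sub_self])
  have h' : chainMap σ₀ (c - d₁ b₁) = c - d₁ b₁ := by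
    have := congrArg d₁ hb₁
    rw [map_sub, hdd, sub_zero, hc₁, map_sub, hd₁] at this
    rw [map_sub, sub_eq_sub_iff_sub_eq_sub]
    exact this
  obtain ⟨b₀, hb₀⟩ := exists_norm_eq hp h₀ hf₀ h'
  exact ⟨b₁, b₀, by rw [← hb₀]; abel⟩

end norm

end Artin

namespace Artin

universe u

theorem exists_third {i j : Fin 3} (h : i ≠ j) : ∃ k, i ≠ k ∧ j ≠ k := by decide +revert

theorem exists_other_two (i : Fin 3) : ∃ j k, i ≠ j ∧ i ≠ k ∧ j ≠ k := by decide +revert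

/-- A three-colored complex of nonpositive curvature with a base point. -/
structure LevelComplex (D : Type u) where
  /-- the color of a vertex -/
  color : D → Fin 3
  /-- the edges -/
  E : D → D → Prop
  /-- the triangles -/
  T : D → D → D → Prop
  E_symm : ∀ {x y}, E x y → E y x
  E_color : ∀ {x y}, E x y → color x ≠ color y
  T_E : ∀ {x y z}, T x y z → E x y
  link : ∀ {x y y' z z'}, T x y z → T x y' z → T x y z' → T x y' z' → y = y' ∨ z = z'
  swap : ∀ {x y z}, T x y z → T y x z
  rot : ∀ {x y z}, T x y z → T y z x
  /-- the base point -/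
  v : D
  /-- the distance to the base point -/
  l : D → ℕ
  isLevel : IsLevel E T v l

namespace LevelComplex

variable {D : Type u} (K : LevelComplex D)

/-- The positively oriented edges. -/
def Edge : Type u := {e : Fin 2 → D // K.E (e 0) (e 1) ∧ K.color (e 1) = K.color (e 0) + 1}

/-- The triangles. -/
def Triangle : Type u := {t : Fin 3 → D // K.T (t 0) (t 1) (t 2) ∧ ∀ i, K.color (t i) = i}

variable {K}

theorem swap' {x y z : D} (h : K.T x y z) : K.T x z y := K.swap (K.rot (K.rot h))

theorem Triangle.T (t : K.Triangle) {i j k : Fin 3} (hij : i ≠ j) (hik : i ≠ k) (hjk : j ≠ k) :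
    K.T (t.1 i) (t.1 j) (t.1 k) := by
  have h := t.2.1
  have h2 := K.rot h
  have h3 := K.rot h2
  have h4 := K.swap h
  have h5 := K.swap h2
  have h6 := K.swap h3
  fin_cases i <;> fin_cases j <;> fin_cases k <;> first | contradiction | assumption

theorem Triangle.edge_mem (t : K.Triangle) (i : Fin 3) :
    K.E (![t.1 i, t.1 (i + 1)] 0) (![t.1 i, t.1 (i + 1)] 1) ∧
      K.color (![t.1 i, t.1 (i + 1)] 1) = K.color (![t.1 i, t.1 (i + 1)] 0) + 1 := by
  refine ⟨K.T_E (t.T (k := i + 2) ?_ ?_ ?_), ?_⟩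
  · decide +revert
  · decide +revert
  · decide +revert
  · change K.color (t.1 (i + 1)) = K.color (t.1 i) + 1
    rw [t.2.2, t.2.2]

/-- The edges of a triangle. -/
def Triangle.edge (t : K.Triangle) (i : Fin 3) : K.Edge := ⟨_, t.edge_mem i⟩

theorem Triangle.edge_eq_iff {t t' : K.Triangle} {i j : Fin 3} :
    t.edge i = t'.edge j ↔ i = j ∧ t.1 i = t'.1 i ∧ t.1 (i + 1) = t'.1 (i + 1) := by
  constructor
  · intro h
    have h0 : t.1 i = t'.1 j := congrFun (congrArg Subtype.val h) 0
    have h1 : t.1 (i + 1) = t'.1 (j + 1) := congrFun (congrArg Subtype.val h) 1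
    obtain rfl : i = j := by rw [← t.2.2 i, h0, t'.2.2]
    exact ⟨rfl, h0, h1⟩
  · rintro ⟨rfl, h0, h1⟩
    apply Subtype.ext
    change ![_, _] = ![_, _]
    rw [h0, h1]

variable (K)

/-- The boundary of edges. -/
noncomputable def d₁ : (K.Edge →₀ ℤ) →ₗ[ℤ] (D →₀ ℤ) :=
  Finsupp.linearCombination ℤ fun e => Finsupp.single (e.1 1) 1 - Finsupp.single (e.1 0) 1

/-- The boundary of triangles. -/
noncomputable def d₂ : (K.Triangle →₀ ℤ) →ₗ[ℤ] (K.Edge →₀ ℤ) :=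
  Finsupp.linearCombination ℤ fun t => ∑ i, Finsupp.single (t.edge i) 1

theorem d₁_single (e : K.Edge) :
    K.d₁ (Finsupp.single e 1) = Finsupp.single (e.1 1) 1 - Finsupp.single (e.1 0) 1 := by
  simp [d₁]

theorem d₂_single (t : K.Triangle) :
    K.d₂ (Finsupp.single t 1) = ∑ i, Finsupp.single (t.edge i) 1 := by
  simp [d₂]

theorem d₁_d₂ (c) : K.d₁ (K.d₂ c) = 0 := by
  suffices h : K.d₁ ∘ₗ K.d₂ = 0 from LinearMap.congr_fun h c
  refine Finsupp.lhom_ext' fun t => LinearMap.ext_ring ?_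
  change K.d₁ (K.d₂ (Finsupp.single t 1)) = 0
  rw [d₂_single, map_sum]
  simp only [d₁_single, Fin.sum_univ_three]
  change (Finsupp.single (t.1 1) 1 - Finsupp.single (t.1 0) 1) +
    (Finsupp.single (t.1 2) 1 - Finsupp.single (t.1 1) 1) +
    (Finsupp.single (t.1 0) 1 - Finsupp.single (t.1 2) 1) = (0 : D →₀ ℤ)
  abel

variable {K}

theorem exists_agree {c : K.Triangle →₀ ℤ} (hc : K.d₂ c = 0) {t : K.Triangle} (ht : t ∈ c.support)
    (i : Fin 3) : ∃ t' ∈ c.support, t' ≠ t ∧ t'.1 i = t.1 i ∧ t'.1 (i + 1) = t.1 (i + 1) := by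
  classical
  by_contra! h
  have h1 := congrArg (fun b => b (t.edge i)) hc
  simp only [d₂, Finsupp.linearCombination_apply, Finsupp.sum, Finsupp.finsetSum_apply,
    Finsupp.smul_apply, Finsupp.single_apply, Finsupp.coe_zero, Pi.zero_apply] at h1
  rw [Finset.sum_eq_single_of_mem t ht, Finset.sum_eq_single_of_mem i (Finset.mem_univ _)] at h1
  · rw [if_pos rfl, smul_eq_mul, mul_one] at h1
    exact Finsupp.mem_support_iff.1 ht h1
  · intro j _ hj
    rw [if_neg fun e => hj (Triangle.edge_eq_iff.1 e).1]
  · intro t' ht' hne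
    rw [Finset.sum_eq_zero, smul_zero]
    intro j _
    rw [if_neg]
    intro e
    obtain ⟨rfl, e1, e2⟩ := Triangle.edge_eq_iff.1 e
    exact h t' ht' hne e1 e2

theorem exists_agree' {c : K.Triangle →₀ ℤ} (hc : K.d₂ c = 0) {t : K.Triangle}
    (ht : t ∈ c.support) {i j : Fin 3} (hij : i ≠ j) :
    ∃ t' ∈ c.support, t' ≠ t ∧ t'.1 i = t.1 i ∧ t'.1 j = t.1 j := by
  rcases (by decide +revert : j = i + 1 ∨ i = j + 1) with rfl | rfl
  · exact exists_agree hc ht i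
  · obtain ⟨t', h1, h2, h3, h4⟩ := exists_agree hc ht j
    exact ⟨t', h1, h2, h4, h3⟩

theorem not_horizontal {x y z : D} (h : K.T x y z) (hy : K.l x = K.l y) (hz : K.l x = K.l z) :
    False := by
  obtain ⟨u, hu, hu'⟩ := K.isLevel.horizontal x y (K.T_E h) hy
  obtain ⟨w, hw, hw'⟩ := K.isLevel.horizontal x z (K.T_E (swap' h)) hz
  by_cases huw : u = w
  · subst huw
    have h1 := K.E_color (K.T_E h)
    have h2 := K.E_color (K.T_E (swap' h))
    have h3 := K.E_color (K.T_E (K.rot h))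
    have h4 := K.E_color (K.T_E (swap' hu))
    have h5 := K.E_color (K.T_E (K.rot hu))
    have h6 := K.E_color (K.T_E (K.rot hw))
    generalize K.color x = a at *
    generalize K.color y = b at *
    generalize K.color z = c at *
    generalize K.color u = d at *
    omega
  · have h1 := K.isLevel.parents x u w (K.T_E (swap' hu)) (K.T_E (swap' hw)) hu' hw' huw
    rcases K.link h (swap' hw) hu (swap' h1) with e | e
    · rw [e] at hy
      omega
    · rw [e] at hz
      omega

theorem eq_zero_of_d₂_eq_zero (c : K.Triangle →₀ ℤ) (hc : K.d₂ c = 0) : c = 0 := by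
  by_contra hne
  have hsupp : c.support.Nonempty := Finsupp.support_nonempty_iff.2 hne
  obtain ⟨⟨t₀, i⟩, ht₀, hmax⟩ := Finset.exists_max_image
    (c.support ×ˢ (Finset.univ : Finset (Fin 3))) (fun q => K.l (q.1.1 q.2))
    (hsupp.product Finset.univ_nonempty)
  have ht : t₀ ∈ c.support := (Finset.mem_product.1 ht₀).1
  have hm : ∀ t ∈ c.support, ∀ j, K.l (t.1 j) ≤ K.l (t₀.1 i) := fun t ht j =>
    hmax (t, j) (Finset.mem_product.2 ⟨ht, Finset.mem_univ _⟩)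
  have key : ∃ t ∈ c.support, ∃ t' ∈ c.support, t.1 i = t₀.1 i ∧ t'.1 i = t₀.1 i ∧ ∃ j k, i ≠ j ∧
      i ≠ k ∧ j ≠ k ∧ t ≠ t' ∧ t.1 j = t'.1 j ∧ K.l (t.1 k) ≠ K.l (t₀.1 i) ∧
      K.l (t'.1 k) ≠ K.l (t₀.1 i) := by
    by_cases hcase : ∃ t ∈ c.support, t.1 i = t₀.1 i ∧ ∃ j, i ≠ j ∧ K.l (t₀.1 i) = K.l (t.1 j)
    · obtain ⟨t, ht, hti, j, hij, hj⟩ := hcase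
      obtain ⟨t', ht', h1, h2, h3⟩ := exists_agree' hc ht hij
      obtain ⟨k, hik, hjk⟩ := exists_third hij
      refine ⟨t, ht, t', ht', hti, h2.trans hti, j, k, hij, hik, hjk, h1.symm, h3.symm, fun h => ?_,
        fun h => ?_⟩
      · exact not_horizontal (t.T hij hik hjk) (by rw [hti, hj]) (by rw [hti, h])
      · exact not_horizontal (t'.T hij hik hjk) (by rw [h2, hti, hj, h3]) (by rw [h2, hti, h])
    · push Not at hcase
      obtain ⟨j, k, hij, hik, hjk⟩ := exists_other_two i
      obtain ⟨t', ht', h1, h2, h3⟩ := exists_agree' hc ht hij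
      exact ⟨t₀, ht, t', ht', rfl, h2, j, k, hij, hik, hjk, h1.symm, h3.symm,
        (hcase t₀ ht rfl k hik).symm, (hcase t' ht' h2 k hik).symm⟩
  obtain ⟨t, ht, t', ht', hi, hi', j, k, hij, hik, hjk, hne, hj, hk, hk'⟩ := key
  have par : ∀ t ∈ c.support, t.1 i = t₀.1 i → K.l (t.1 k) ≠ K.l (t₀.1 i) →
      K.E (t₀.1 i) (t.1 k) ∧ K.l (t₀.1 i) = K.l (t.1 k) + 1 := by
    intro t ht hi hk
    have h1 := K.T_E (t.T hik hij hjk.symm)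
    rw [hi] at h1
    have h2 := K.isLevel.le_succ _ _ (K.E_symm h1)
    have h3 := hm t ht k
    exact ⟨h1, by omega⟩
  obtain ⟨e1, l1⟩ := par t ht hi hk
  obtain ⟨e2, l2⟩ := par t' ht' hi' hk'
  have hkk : t.1 k ≠ t'.1 k := by
    intro h
    apply hne
    apply Subtype.ext
    funext m
    have : m = i ∨ m = j ∨ m = k := by omega
    rcases this with rfl | rfl | rfl
    · rw [hi, hi']
    · exact hj
    · exact h
  have h := K.isLevel.parents _ _ _ e1 e2 l1 l2 hkk
  exact K.E_color (K.T_E (K.rot h)) (by rw [t.2.2, t'.2.2])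

end LevelComplex

end Artin

namespace Artin

universe u

namespace LevelComplex

variable {D : Type u} {K : LevelComplex D}

/-- The edge with given endpoints. -/
def mkEdge {x y : D} (h : K.E x y ∧ K.color y = K.color x + 1) : K.Edge := ⟨![x, y], h⟩

theorem d₁_single_mkEdge {x y : D} (h : K.E x y ∧ K.color y = K.color x + 1) :
    K.d₁ (Finsupp.single (mkEdge h) 1) = Finsupp.single y 1 - Finsupp.single x 1 :=
  d₁_single K (mkEdge h)

variable (K) in
open Classical in
/-- The chain of an edge. -/
noncomputable def ed (x y : D) : K.Edge →₀ ℤ :=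
  if h : K.E x y ∧ K.color y = K.color x + 1 then Finsupp.single (mkEdge h) 1
  else if h : K.E y x ∧ K.color x = K.color y + 1 then -Finsupp.single (mkEdge h) 1
  else 0

theorem ed_pos {x y : D} (h : K.E x y ∧ K.color y = K.color x + 1) :
    K.ed x y = Finsupp.single (mkEdge h) 1 := dif_pos h

theorem ed_neg {x y : D} (h : K.E y x ∧ K.color x = K.color y + 1) :
    K.ed x y = -Finsupp.single (mkEdge h) 1 := by
  have : ¬ (K.E x y ∧ K.color y = K.color x + 1) := by
    rintro ⟨-, h'⟩
    have := h.2
    omega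
  rw [ed, dif_neg this, dif_pos h]

theorem oriented {x y : D} (h : K.E x y) :
    (K.E x y ∧ K.color y = K.color x + 1) ∨ (K.E y x ∧ K.color x = K.color y + 1) := by
  have := K.E_color h
  by_cases h' : K.color y = K.color x + 1
  · exact .inl ⟨h, h'⟩
  · exact .inr ⟨K.E_symm h, by omega⟩

theorem ed_symm {x y : D} (h : K.E x y) : K.ed y x = -K.ed x y := by
  rcases oriented h with h | h
  · rw [ed_pos h, ed_neg h]
  · rw [ed_pos h, ed_neg h, neg_neg]

theorem d₁_ed {x y : D} (h : K.E x y) :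
    K.d₁ (K.ed x y) = Finsupp.single y 1 - Finsupp.single x 1 := by
  rcases oriented h with h | h
  · rw [ed_pos h, d₁_single_mkEdge]
  · rw [ed_neg h, map_neg, d₁_single_mkEdge, neg_sub]

variable (K) in
/-- The boundaries of triangles. -/
noncomputable def B : Submodule ℤ (K.Edge →₀ ℤ) := LinearMap.range K.d₂

theorem ed_mem_B {x y z : D} (h : K.T x y z) : K.ed x y + K.ed y z + K.ed z x ∈ K.B := by
  have rot : ∀ {x y z : D}, K.ed x y + K.ed y z + K.ed z x ∈ K.B →
      K.ed y z + K.ed z x + K.ed x y ∈ K.B := by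
    intro x y z h
    convert h using 1
    abel
  have swap : ∀ {x y z : D}, K.T x y z → K.ed x y + K.ed y z + K.ed z x ∈ K.B →
      K.ed y x + K.ed x z + K.ed z y ∈ K.B := by
    intro x y z hT h
    rw [ed_symm (K.T_E hT), ed_symm (K.T_E (K.rot hT)), ed_symm (K.T_E (K.rot (K.rot hT)))]
    convert neg_mem h using 1
    abel
  have base : ∀ {x y z : D}, K.T x y z → K.color x = 0 → K.color y = 1 → K.color z = 2 →
      K.ed x y + K.ed y z + K.ed z x ∈ K.B := by
    intro x y z hT h0 h1 h2
    have hc : ∀ i, K.color (![x, y, z] i) = i := by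
      intro i
      fin_cases i <;> assumption
    let t : K.Triangle := ⟨![x, y, z], hT, hc⟩
    refine ⟨Finsupp.single t 1, ?_⟩
    have e0 : K.ed x y = Finsupp.single (t.edge 0) 1 := ed_pos (x := x) (y := y) (t.edge_mem 0)
    have e1 : K.ed y z = Finsupp.single (t.edge 1) 1 := ed_pos (x := y) (y := z) (t.edge_mem 1)
    have e2 : K.ed z x = Finsupp.single (t.edge 2) 1 := ed_pos (x := z) (y := x) (t.edge_mem 2)
    rw [d₂_single, Fin.sum_univ_three, e0, e1, e2]
  have h1 := K.E_color (K.T_E h)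
  have h2 := K.E_color (K.T_E (K.rot h))
  have h3 := K.E_color (K.T_E (K.rot (K.rot h)))
  have hr := K.rot h
  have hrr := K.rot hr
  have : (K.color x = 0 ∧ K.color y = 1 ∧ K.color z = 2) ∨
      (K.color x = 1 ∧ K.color y = 2 ∧ K.color z = 0) ∨
      (K.color x = 2 ∧ K.color y = 0 ∧ K.color z = 1) ∨
      (K.color x = 1 ∧ K.color y = 0 ∧ K.color z = 2) ∨
      (K.color x = 0 ∧ K.color y = 2 ∧ K.color z = 1) ∨
      (K.color x = 2 ∧ K.color y = 1 ∧ K.color z = 0) := by omega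
  rcases this with ⟨a, b, c⟩ | ⟨a, b, c⟩ | ⟨a, b, c⟩ | ⟨a, b, c⟩ | ⟨a, b, c⟩ | ⟨a, b, c⟩
  · exact base h a b c
  · exact rot (base hrr c a b)
  · exact rot (rot (base hr b c a))
  · exact swap (K.swap h) (base (K.swap h) b a c)
  · exact swap (K.swap h) (rot (rot (base (swap' h) a c b)))
  · exact swap (K.swap h) (rot (base (K.rot (swap' h)) c b a))

variable (K) in
theorem exists_parent (x : D) : ∃ y, x ≠ K.v → K.E x y ∧ K.l x = K.l y + 1 := by
  by_cases h : x = K.v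
  · exact ⟨x, fun h' => (h' h).elim⟩
  · obtain ⟨y, hy⟩ := K.isLevel.parent x h
    exact ⟨y, fun _ => hy⟩

variable (K) in
/-- A chosen neighbor closer to the base point. -/
noncomputable def par (x : D) : D := (K.exists_parent x).choose

theorem par_spec {x : D} (h : x ≠ K.v) : K.E x (K.par x) ∧ K.l x = K.l (K.par x) + 1 :=
  (K.exists_parent x).choose_spec h

variable (K) in
/-- The first `n` edges of the path to the base point. -/
noncomputable def pathAux : ℕ → D → (K.Edge →₀ ℤ)
  | 0, _ => 0
  | n + 1, x => pathAux n (K.par x) + K.ed (K.par x) x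

variable (K) in
/-- The path from the base point. -/
noncomputable def path (x : D) : K.Edge →₀ ℤ := K.pathAux (K.l x) x

theorem path_eq {x : D} (h : x ≠ K.v) : K.path x = K.path (K.par x) + K.ed (K.par x) x := by
  rw [path, (par_spec h).2]
  rfl

theorem path_v : K.path K.v = 0 := by
  rw [path, (K.isLevel.zero_iff _).2 rfl]
  rfl

theorem d₁_path (x : D) : K.d₁ (K.path x) = Finsupp.single x 1 - Finsupp.single K.v 1 := by
  induction h : K.l x using Nat.strong_induction_on generalizing x with
  | _ n ih =>
    by_cases hx : x = K.v
    · rw [hx, path_v, map_zero, sub_self]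
    · obtain ⟨h1, h2⟩ := par_spec hx
      rw [path_eq hx, map_add, ih _ (by omega) _ rfl, d₁_ed (K.E_symm h1)]
      abel

theorem ed_sub_mem {x y : D} (hxy : K.E x y) : K.ed x y - (K.path y - K.path x) ∈ K.B := by
  induction h : K.l x + K.l y using Nat.strong_induction_on generalizing x y with
  | _ n ih =>
    have comb : ∀ {x y z : D}, K.T x y z → K.ed x z - (K.path z - K.path x) ∈ K.B →
        K.ed y z - (K.path z - K.path y) ∈ K.B → K.ed x y - (K.path y - K.path x) ∈ K.B := by
      intro x y z hT h1 h2
      convert sub_mem (add_mem (ed_mem_B hT) h1) h2 using 1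
      rw [ed_symm (K.T_E (swap' hT))]
      abel
    have flip : ∀ {x y : D}, K.E x y → K.ed y x - (K.path x - K.path y) ∈ K.B →
        K.ed x y - (K.path y - K.path x) ∈ K.B := by
      intro x y hE h
      convert neg_mem h using 1
      rw [ed_symm hE]
      abel
    have down : ∀ {x y : D}, K.E x y → K.l x + K.l y = n → K.l x = K.l y + 1 →
        K.ed y x - (K.path x - K.path y) ∈ K.B := by
      intro x y hE hn hl
      have hx : x ≠ K.v := fun e => by
        have := (K.isLevel.zero_iff x).2 e
        omega
      obtain ⟨h1, h2⟩ := par_spec hx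
      by_cases hy : y = K.par x
      · rw [path_eq hx, ← hy, add_sub_cancel_left, sub_self]
        exact zero_mem _
      · have hT := K.isLevel.parents x y _ hE h1 hl h2 hy
        have h3 := ih _ (by omega) (K.T_E (K.rot hT)) rfl
        refine comb (K.swap hT) h3 ?_
        rw [path_eq hx, ed_symm (K.E_symm h1)]
        convert zero_mem K.B using 1
        abel
    rcases lt_trichotomy (K.l x) (K.l y) with hlt | heq | hlt
    · have := K.isLevel.le_succ x y hxy
      exact down (K.E_symm hxy) (by omega) (by omega)
    · obtain ⟨z, hz, hl⟩ := K.isLevel.horizontal x y hxy heq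
      exact comb hz (ih _ (by omega) (K.T_E (swap' hz)) rfl)
        (ih _ (by omega) (K.T_E (K.rot hz)) rfl)
    · have := K.isLevel.le_succ y x (K.E_symm hxy)
      exact flip hxy (down hxy h (by omega))

theorem exists_d₂_eq {c : K.Edge →₀ ℤ} (hc : K.d₁ c = 0) : ∃ b, K.d₂ b = c := by
  suffices h : ∀ c, c - Finsupp.linearCombination ℤ K.path (K.d₁ c) ∈ K.B by
    have := h c
    rw [hc, map_zero, sub_zero] at this
    exact this
  intro c
  induction c using Finsupp.induction_linear with
  | zero => simp
  | add c d hc hd =>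
    rw [map_add, map_add, add_sub_add_comm]
    exact add_mem hc hd
  | single e n =>
    have h : K.ed (e.1 0) (e.1 1) = Finsupp.single e 1 := by
      rw [ed_pos e.2]
      congr 1
      refine Subtype.ext (funext fun i => ?_)
      fin_cases i <;> rfl
    have := K.B.smul_mem n (ed_sub_mem e.2.1)
    rw [h] at this
    convert this using 1
    rw [smul_sub, ← Finsupp.smul_single_one, map_smul, map_smul, d₁_single, map_sub,
      Finsupp.linearCombination_single, Finsupp.linearCombination_single, one_smul, one_smul]

end LevelComplex

end Artin

namespace Artin

universe u

/-- The permutation of cells induced by a permutation of vertices. -/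
def cellPerm {ι D : Type*} {c : (ι → D) → Prop} (σ : Equiv.Perm D) (h : ∀ e, c (σ ∘ e) ↔ c e) :
    Equiv.Perm {e : ι → D // c e} :=
  Equiv.Perm.subtypePerm (Equiv.arrowCongr (Equiv.refl ι) σ) h

section cellPerm

variable {ι D : Type*} {c : (ι → D) → Prop} {σ : Equiv.Perm D} {h : ∀ e, c (σ ∘ e) ↔ c e}

theorem cellPerm_pow_apply (k : ℕ) (e : {e : ι → D // c e}) (i : ι) :
    ((cellPerm σ h ^ k) e).1 i = (σ ^ k) (e.1 i) := by
  induction k generalizing e with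
  | zero => rfl
  | succ k ih =>
    rw [pow_succ, Equiv.Perm.mul_apply, ih, pow_succ, Equiv.Perm.mul_apply]
    rfl

theorem cellPerm_pow_eq_one {p : ℕ} (hσ : σ ^ p = 1) : cellPerm σ h ^ p = 1 := by
  refine Equiv.ext fun e => Subtype.ext (funext fun i => ?_)
  rw [cellPerm_pow_apply, hσ]
  rfl

theorem cellPerm_ne [Nonempty ι] (hσ : ∀ x, σ x ≠ x) (e : {e : ι → D // c e}) :
    cellPerm σ h e ≠ e :=
  fun h' => hσ _ (congrFun (congrArg Subtype.val h') (Classical.arbitrary ι))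

end cellPerm

namespace LevelComplex

theorem exists_fixed {D : Type u} (K : LevelComplex D) {σ : Equiv.Perm D} {p : ℕ} (hp : p.Prime)
    (hσ : σ ^ p = 1) (hcolor : ∀ x, K.color (σ x) = K.color x)
    (hE : ∀ x y, K.E (σ x) (σ y) ↔ K.E x y) (hT : ∀ x y z, K.T (σ x) (σ y) (σ z) ↔ K.T x y z) :
    ∃ x, σ x = x := by
  by_contra! hfix
  have h₁ : ∀ e : Fin 2 → D,
      (K.E ((σ ∘ e) 0) ((σ ∘ e) 1) ∧ K.color ((σ ∘ e) 1) = K.color ((σ ∘ e) 0) + 1) ↔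
      (K.E (e 0) (e 1) ∧ K.color (e 1) = K.color (e 0) + 1) := by
    intro e
    simp only [Function.comp_apply, hE, hcolor]
  have h₂ : ∀ t : Fin 3 → D,
      (K.T ((σ ∘ t) 0) ((σ ∘ t) 1) ((σ ∘ t) 2) ∧ ∀ i, K.color ((σ ∘ t) i) = i) ↔
      (K.T (t 0) (t 1) (t 2) ∧ ∀ i, K.color (t i) = i) := by
    intro t
    simp only [Function.comp_apply, hT, hcolor]
  let σ₁ : Equiv.Perm K.Edge := cellPerm σ h₁
  let σ₂ : Equiv.Perm K.Triangle := cellPerm σ h₂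
  have hd₁ : ∀ c, K.d₁ (chainMap σ₁ c) = chainMap σ (K.d₁ c) := by
    suffices h : K.d₁ ∘ₗ chainMap σ₁ = chainMap σ ∘ₗ K.d₁ from LinearMap.congr_fun h
    refine Finsupp.lhom_ext' fun e => LinearMap.ext_ring ?_
    change K.d₁ (chainMap σ₁ (Finsupp.single e 1)) = chainMap σ (K.d₁ (Finsupp.single e 1))
    rw [chainMap_single, d₁_single, d₁_single, map_sub, chainMap_single, chainMap_single]
    rfl
  have hd₂ : ∀ c, K.d₂ (chainMap σ₂ c) = chainMap σ₁ (K.d₂ c) := by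
    suffices h : K.d₂ ∘ₗ chainMap σ₂ = chainMap σ₁ ∘ₗ K.d₂ from LinearMap.congr_fun h
    refine Finsupp.lhom_ext' fun t => LinearMap.ext_ring ?_
    change K.d₂ (chainMap σ₂ (Finsupp.single t 1)) = chainMap σ₁ (K.d₂ (Finsupp.single t 1))
    rw [chainMap_single, d₂_single, d₂_single, map_sum]
    refine Finset.sum_congr rfl fun i _ => ?_
    rw [chainMap_single]
    congr 1
    refine Subtype.ext (funext fun j => ?_)
    fin_cases j <;> rfl
  obtain ⟨a, b, h⟩ := exists_eq_map_add_norm (X₁ := K.Edge) (X₂ := K.Triangle)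
    (c := Finsupp.single K.v 1) hp hσ
    (cellPerm_pow_eq_one hσ : σ₁ ^ p = 1) (cellPerm_pow_eq_one hσ : σ₂ ^ p = 1) hfix
    (cellPerm_ne hfix) (cellPerm_ne hfix) K.d₁ K.d₂ hd₁ hd₂ K.d₁_d₂ eq_zero_of_d₂_eq_zero
    (fun c hc => exists_d₂_eq hc) ⟨K.path (σ K.v), (K.d₁_path _).trans (by rw [chainMap_single])⟩
  let ε : (D →₀ ℤ) →ₗ[ℤ] ℤ := Finsupp.linearCombination ℤ fun _ => 1
  have hε₁ : ε ∘ₗ K.d₁ = 0 := by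
    refine Finsupp.lhom_ext' fun e => LinearMap.ext_ring ?_
    change ε (K.d₁ (Finsupp.single e 1)) = 0
    simp [d₁_single, ε]
  have hε : ε ∘ₗ chainMap σ = ε := by
    refine Finsupp.lhom_ext' fun x => LinearMap.ext_ring ?_
    change ε (chainMap σ (Finsupp.single x 1)) = ε (Finsupp.single x 1)
    simp [chainMap_single, ε]
  have h' := congrArg ε h
  rw [map_add, show ε (K.d₁ a) = 0 from LinearMap.congr_fun hε₁ a, zero_add,
    norm_map p ε (s' := LinearMap.id) fun c => LinearMap.congr_fun hε c, norm_apply] at h'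
  have hid : ∀ k (m : ℤ), ((LinearMap.id : ℤ →ₗ[ℤ] ℤ) ^ k) m = m := fun k m => by
    rw [show (LinearMap.id : ℤ →ₗ[ℤ] ℤ) = 1 from rfl, one_pow]
    rfl
  simp only [hid, Finset.sum_const, Finset.card_range, nsmul_eq_mul] at h'
  have h1 : ε (Finsupp.single K.v 1) = 1 := by simp [ε]
  rw [h1] at h'
  exact hp.one_lt.ne' (by exact_mod_cast Int.eq_one_of_mul_eq_one_right (by positivity) h'.symm)

end LevelComplex

namespace TriComplex

/-- The automorphisms of a complex. -/
structure IsAut {V : Type u} (K : TriComplex V) (τ : Equiv.Perm V) : Prop where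
  color : ∀ x, K.color (τ x) = K.color x
  T : ∀ x y z, K.T (τ x) (τ y) (τ z) ↔ K.T x y z

variable {V : Type u} {K : TriComplex V} {τ : Equiv.Perm V}

theorem IsAut.E (h : K.IsAut τ) (x y : V) : K.E (τ x) (τ y) ↔ K.E x y := by
  constructor
  · rintro ⟨z, hz⟩
    obtain ⟨w, rfl⟩ := τ.surjective z
    exact ⟨w, (h.T _ _ _).1 hz⟩
  · rintro ⟨z, hz⟩
    exact ⟨_, (h.T _ _ _).2 hz⟩

theorem IsAut.pow (h : K.IsAut τ) (n : ℕ) : K.IsAut (τ ^ n) := by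
  induction n with
  | zero => exact ⟨fun _ => rfl, fun _ _ _ => Iff.rfl⟩
  | succ n ih =>
    simp only [pow_succ]
    exact ⟨fun x => (ih.color _).trans (h.color x), fun x y z => (ih.T _ _ _).trans (h.T x y z)⟩

theorem IsAut.isLevel (h : K.IsAut τ) {v : V} (hv : τ v = v) {l : V → ℕ}
    (hl : IsLevel K.E K.T v l) : IsLevel K.E K.T v (l ∘ τ) where
  zero_iff x := by
    rw [Function.comp_apply, hl.zero_iff]
    constructor
    · intro e
      exact τ.injective (e.trans hv.symm)
    · rintro rfl
      exact hv
  le_succ x y e := hl.le_succ _ _ ((h.E x y).2 e)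
  parent x hx := by
    obtain ⟨y, e, hy⟩ := hl.parent (τ x) fun e => hx (τ.injective (e.trans hv.symm))
    obtain ⟨z, rfl⟩ := τ.surjective y
    exact ⟨z, (h.E x z).1 e, hy⟩
  parents x y y' e e' hy hy' hne :=
    (h.T _ _ _).1 (hl.parents _ _ _ ((h.E _ _).2 e) ((h.E _ _).2 e') hy hy'
      fun e => hne (τ.injective e))
  horizontal x y e hy := by
    obtain ⟨z, e, hz⟩ := hl.horizontal _ _ ((h.E _ _).2 e) hy
    obtain ⟨w, rfl⟩ := τ.surjective z
    exact ⟨w, (h.T _ _ _).1 e, hz⟩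

theorem IsAut.parent_fixed (h : K.IsAut τ) {v : V} (hv : τ v = v) {l : V → ℕ}
    (hl : IsLevel K.E K.T v l) {x y : V} (hx : τ x = x) (e : K.E x y) (hy : l x = l y + 1) :
    τ y = y := by
  by_contra hne
  have hinv : ∀ z, l (τ z) = l z :=
    congrFun (IsLevel.eq (fun _ _ => E.symm) (h.isLevel hv hl) hl)
  have e' := (h.E x y).2 e
  rw [hx] at e'
  have hT := hl.parents x (τ y) y e' e (by rw [hinv, hy]) hy hne
  exact (T_E₂₃ hT).color_ne (h.color y)

/-- The fixed point set of an automorphism with a fixed point. -/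
def IsAut.fixed (h : K.IsAut τ) {v : V} (hv : τ v = v) {l : V → ℕ}
    (hl : IsLevel K.E K.T v l) : LevelComplex {x // τ x = x} where
  color x := K.color x.1
  E x y := K.E x.1 y.1
  T x y z := K.T x.1 y.1 z.1
  E_symm e := e.symm
  E_color e := e.color_ne
  T_E e := T_E₁₂ e
  swap := K.swap
  rot := K.rot
  link h1 h2 h3 h4 := (K.link h1 h2 h3 h4).imp Subtype.ext Subtype.ext
  v := ⟨v, hv⟩
  l x := l x.1
  isLevel :=
    { zero_iff := fun x => (hl.zero_iff x.1).trans ⟨fun e => Subtype.ext e, congrArg Subtype.val⟩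
      le_succ := fun x y => hl.le_succ x.1 y.1
      parent := fun x hx => by
        obtain ⟨y, e, hy⟩ := hl.parent x.1 fun e => hx (Subtype.ext e)
        exact ⟨⟨y, h.parent_fixed hv hl x.2 e hy⟩, e, hy⟩
      parents := fun x y y' e e' hy hy' hne =>
        hl.parents _ _ _ e e' hy hy' fun e => hne (Subtype.ext e)
      horizontal := fun x y e hy => by
        obtain ⟨z, e, hz⟩ := hl.horizontal x.1 y.1 e hy
        exact ⟨⟨z, h.parent_fixed hv hl x.2 (T_E₁₃ e) hz⟩, e, hz⟩ }

theorem IsAut.exists_fixed_of_prime (hK : K.SimplyConnected) (h : K.IsAut τ) {p : ℕ}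
    (hp : p.Prime) {v : V} (hv : (τ ^ p) v = v) : ∃ x, τ x = x := by
  obtain ⟨l, hl⟩ := hK.exists_isLevel v
  have hτ : ∀ x, (τ ^ p) (τ x) = τ x ↔ (τ ^ p) x = x := fun x => by
    rw [← Equiv.Perm.mul_apply, pow_mul_comm', Equiv.Perm.mul_apply, τ.injective.eq_iff]
  obtain ⟨x, hx⟩ := ((h.pow p).fixed hv hl).exists_fixed (σ := τ.subtypePerm hτ) hp
    (by
      rw [Equiv.Perm.subtypePerm_pow]
      exact Equiv.ext fun x => Subtype.ext x.2)
    (fun x => h.color x.1) (fun x y => h.E x.1 y.1) (fun x y z => h.T x.1 y.1 z.1)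
  exact ⟨x.1, congrArg Subtype.val hx⟩

theorem IsAut.exists_fixed (hK : K.SimplyConnected) (h : K.IsAut τ) {n : ℕ} (hn : n ≠ 0) {v : V}
    (hv : (τ ^ n) v = v) : ∃ x, τ x = x := by
  induction n using induction_on_primes generalizing τ v with
  | zero => exact (hn rfl).elim
  | one => exact ⟨v, by rwa [pow_one] at hv⟩
  | prime_mul p a hp ih =>
    rw [pow_mul] at hv
    obtain ⟨w, hw⟩ := ih (h.pow p) (right_ne_zero_of_mul hn) hv
    exact h.exists_fixed_of_prime hK hp hw

end TriComplex

end Artin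

namespace Artin

universe u

section coset

variable {A : Type u} [Group A] {G : Fin 3 → Subgroup A}

theorem CosetTriangle.smul {x y z : Σ i, A ⧸ G i} (h : CosetTriangle G x y z) (g : A) :
    CosetTriangle G (g • x) (g • y) (g • z) := by
  obtain ⟨h1, a, hx, hy, hz⟩ := h
  exact ⟨h1, g * a, congrArg (g • ·) hx, congrArg (g • ·) hy, congrArg (g • ·) hz⟩

theorem isAut_toPerm (hG : NoSquare G) (g : A) :
    (cosetComplex hG).IsAut (MulAction.toPermHom A (Σ i, A ⧸ G i) g) where
  color _ := rfl
  T x y z := by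
    refine ⟨fun h => ?_, fun h => CosetTriangle.smul h g⟩
    have hinv : CosetTriangle G (g⁻¹ • g • x) (g⁻¹ • g • y) (g⁻¹ • g • z) :=
      CosetTriangle.smul h g⁻¹
    simp only [inv_smul_smul] at hinv
    exact hinv

/-- If a power of `g` fixes a vertex of a simply connected coset complex, then so does `g`. -/
theorem exists_conj_mem_of_pow {hG : NoSquare G} (hK : (cosetComplex hG).SimplyConnected) {g : A}
    {n : ℕ} (hn : n ≠ 0) {i : Fin 3} (h : g ^ n ∈ G i) : ∃ j k, k⁻¹ * g * k ∈ G j := by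
  have hv : (MulAction.toPermHom A (Σ i, A ⧸ G i) g ^ n) (vert G 1 i) = vert G 1 i := by
    rw [← map_pow]
    change vert G (g ^ n * 1) i = vert G 1 i
    rw [eq_comm, vert_eq_iff]
    simpa using h
  obtain ⟨x, hx⟩ := (isAut_toPerm hG g).exists_fixed hK hn hv
  obtain ⟨k, hk⟩ := exists_vert x
  rw [hk] at hx
  have h1 : vert G (g * k) x.1 = vert G k x.1 := hx
  rw [eq_comm, vert_eq_iff, ← mul_assoc] at h1
  exact ⟨x.1, k, h1⟩

end coset

variable {S : Type u} {M : S → S → ℕ∞}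

theorem standardParabolic_empty : StandardParabolic M ∅ = ⊥ := by
  rw [StandardParabolic, Set.image_empty, Subgroup.closure_empty]

theorem gen_zpow_eq_one_iff {s : S} {r : ℤ} : gen M s ^ r = 1 ↔ r = 0 := by
  refine ⟨fun h => ?_, fun h => by rw [h, zpow_zero]⟩
  have := congrArg (lengthHom M) h
  rw [map_zpow, lengthHom_gen, MonoidHom.map_one, ← ofAdd_zsmul, smul_eq_mul, mul_one] at this
  exact this

theorem gen_notMem_compl (hM : Large M) (s : S) : gen M s ∉ StandardParabolic M {s}ᶜ := by
  intro h
  have := standardParabolic_inter hM (gen_mem_standardParabolic (Set.mem_singleton s)) h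
  rw [Set.inter_compl_self, standardParabolic_empty, Subgroup.mem_bot, ← zpow_one (gen M s),
    gen_zpow_eq_one_iff] at this
  exact one_ne_zero this

theorem exists_mem_of_pow_mem [Finite S] (hM : Large M) {g : ArtinGroup M} {n : ℕ} (hn : n ≠ 0)
    {s : S} (h : g ^ n ∈ StandardParabolic M {s}ᶜ) :
    ∃ t k, k⁻¹ * g * k ∈ StandardParabolic M {t}ᶜ := by
  by_cases h3 : ∃ t r, s ≠ t ∧ s ≠ r ∧ t ≠ r
  · obtain ⟨t, r, hst, hsr, htr⟩ := h3
    have he : Function.Injective ![s, t, r] := by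
      intro i j
      fin_cases i <;> fin_cases j <;> simp [hst, hsr, htr, hst.symm, hsr.symm, htr.symm]
    obtain ⟨j, k, hk⟩ := exists_conj_mem_of_pow (i := 0)
      (simplyConnected_corank he (hM.noSquare_corank he)) hn h
    exact ⟨_, k, hk⟩
  push Not at h3
  by_cases h2 : ∃ t, s ≠ t
  · obtain ⟨t, hst⟩ := h2
    have huniv : ∀ u, u = s ∨ u = t := fun u => by
      by_cases hu : s = u
      · exact .inl hu.symm
      · exact .inr (h3 t u hst hu).symm
    rw [standardParabolic_compl_eq_zpowers huniv hst] at h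
    obtain ⟨k, hk⟩ := h
    obtain ⟨r, rfl⟩ := mem_zpowers_of_pow_eq_gen_zpow hM (fun u => (huniv u).symm) hst.symm hn
      hk.symm
    refine ⟨s, 1, ?_⟩
    rw [standardParabolic_compl_eq_zpowers huniv hst]
    simp
  · push Not at h2
    refine ⟨s, 1, ?_⟩
    have hempty : ({s}ᶜ : Set S) = ∅ := Set.eq_empty_of_forall_notMem fun t ht => ht (h2 t).symm
    rw [hempty, standardParabolic_empty, Subgroup.mem_bot] at h
    have hg : g ∈ StandardParabolic M Set.univ := by
      rw [standardParabolic_univ]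
      trivial
    rw [show (Set.univ : Set S) = {s} from Set.eq_singleton_iff_unique_mem.2
      ⟨trivial, fun t _ => (h2 t).symm⟩, StandardParabolic, Set.image_singleton,
      ← Subgroup.zpowers_eq_closure] at hg
    obtain ⟨r, rfl⟩ := hg
    have h' : gen M s ^ (r * n) = 1 := by rwa [zpow_mul, zpow_natCast]
    rw [gen_zpow_eq_one_iff, mul_eq_zero, or_iff_left (by exact_mod_cast hn)] at h'
    simp [h']

theorem conjSubgroup_mul {G : Type*} [Group G] (a b : G) (H : Subgroup G) :
    conjSubgroup a (conjSubgroup b H) = conjSubgroup (a * b) H := by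
  ext x
  simp only [mem_conjSubgroup]
  rw [mul_inv_rev]
  simp only [mul_assoc]

theorem conjSubgroup_one {G : Type*} [Group G] (H : Subgroup G) : conjSubgroup 1 H = H := by
  ext x
  simp [mem_conjSubgroup]

theorem conjSubgroup_mono {G : Type*} [Group G] (a : G) {H K : Subgroup G} (h : H ≤ K) :
    conjSubgroup a H ≤ conjSubgroup a K := Subgroup.map_mono h

theorem isParabolic_conj {P : Subgroup (ArtinGroup M)} (h : IsParabolic M P) (a : ArtinGroup M) :
    IsParabolic M (conjSubgroup a P) := by
  obtain ⟨g, X, rfl⟩ := h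
  exact ⟨a * g, X, conjSubgroup_mul _ _ _⟩

theorem isParabolicClosure_conj {x : ArtinGroup M} {P : Subgroup (ArtinGroup M)}
    (h : IsParabolicClosure M x P) (a : ArtinGroup M) :
    IsParabolicClosure M (a * x * a⁻¹) (conjSubgroup a P) := by
  obtain ⟨h1, h2, h3⟩ := h
  refine ⟨isParabolic_conj h1 a, mem_conjSubgroup.2 (by simpa [mul_assoc] using h2), fun Q hQ hx => ?_⟩
  have := conjSubgroup_mono a (h3 _ (isParabolic_conj hQ a⁻¹)
    (mem_conjSubgroup.2 (by simpa [mul_assoc] using hx)))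
  rwa [conjSubgroup_mul, mul_inv_cancel, conjSubgroup_one] at this

theorem map_conjSubgroup {G H : Type*} [Group G] [Group H] (f : G →* H) (a : G) (K : Subgroup G) :
    (conjSubgroup a K).map f = conjSubgroup (f a) (K.map f) := by
  ext x
  simp only [conjSubgroup, Subgroup.mem_map]
  constructor
  · rintro ⟨_, ⟨y, hy, rfl⟩, rfl⟩
    exact ⟨f y, ⟨y, hy, rfl⟩, by simp⟩
  · rintro ⟨_, ⟨y, hy, rfl⟩, rfl⟩
    exact ⟨a * y * a⁻¹, ⟨y, hy, by simp⟩, by simp⟩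

theorem isParabolicClosure_pow_eq [Finite S] (hM : Large M) {g : ArtinGroup M} {n : ℕ}
    (hn : n ≠ 0) {X : Set S} {Q : Subgroup (ArtinGroup M)}
    (hP : IsParabolicClosure M g (StandardParabolic M X)) (hQ : IsParabolicClosure M (g ^ n) Q) :
    StandardParabolic M X = Q := by
  have hle : Q ≤ StandardParabolic M X := hQ.2.2 _ hP.1 (pow_mem hP.2.1 n)
  obtain ⟨h, Y, hQY⟩ := hQ.1
  rw [hQY] at hle
  obtain ⟨a, Z, hZ⟩ := conj_le_standardParabolic hM hle
  rw [← hQY, ← map_incl_standardParabolic, ← map_conjSubgroup] at hZ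
  by_cases hZu : Z = Set.univ
  · rw [hZ, map_conjSubgroup, hZu, standardParabolic_univ, ← MonoidHom.range_eq_map, range_incl]
    have ha : incl M X a ∈ StandardParabolic M X := by
      rw [← range_incl]
      exact ⟨a, rfl⟩
    ext x
    rw [mem_conjSubgroup, Subgroup.mul_mem_cancel_right _ ha,
      Subgroup.mul_mem_cancel_left _ (inv_mem ha)]
  · exfalso
    obtain ⟨s, hs⟩ := (Set.ne_univ_iff_exists_notMem Z).1 hZu
    have hg := hP.2.1
    rw [← range_incl] at hg
    obtain ⟨b, hb⟩ := hg
    have hbn := hQ.2.1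
    rw [← hb, ← map_pow, hZ, Subgroup.mem_map_iff_mem (incl_injective hM X), mem_conjSubgroup]
      at hbn
    have hbn' : (a⁻¹ * b * a) ^ n ∈ StandardParabolic (restrict M X) {s}ᶜ := by
      have := conj_pow (a := a⁻¹) (b := b) (i := n)
      rw [inv_inv] at this
      rw [this]
      exact standardParabolic_mono (Set.subset_compl_singleton_iff.2 hs) hbn
    obtain ⟨t, k, hk⟩ := exists_mem_of_pow_mem (hM.restrict X) hn hbn'
    have hmem : b ∈ conjSubgroup (a * k) (StandardParabolic (restrict M X) {t}ᶜ) := by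
      rw [mem_conjSubgroup]
      convert hk using 1
      group
    have hmin := hP.2.2 ((conjSubgroup (a * k) (StandardParabolic (restrict M X) {t}ᶜ)).map
      (incl M X)) ⟨incl M X (a * k), _, by rw [map_conjSubgroup, map_incl_standardParabolic]⟩
      (by rw [← hb]; exact Subgroup.mem_map_of_mem _ hmem)
    rw [← range_incl, MonoidHom.range_eq_map,
      Subgroup.map_le_map_iff_of_injective (incl_injective hM X)] at hmin
    have h1 := hmin (Subgroup.mem_top ((a * k) * gen (restrict M X) t * (a * k)⁻¹))
    rw [mem_conjSubgroup] at h1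
    refine gen_notMem_compl (hM.restrict X) t ?_
    convert h1 using 1
    group

theorem isParabolicClosure_inv {x : ArtinGroup M} {P : Subgroup (ArtinGroup M)} :
    IsParabolicClosure M x⁻¹ P ↔ IsParabolicClosure M x P := by
  simp only [IsParabolicClosure, inv_mem_iff]

end Artin

/-- In a large-type Artin group of rank at least 2, the parabolic closure of `g` equals
the parabolic closure of `g ^ n` for any non-zero integer `n`. -/
theorem parabolic_closure_of_power {S : Type*} [Finite S] (M : S → S → ℕ∞)
    (hsymm : ∀ s t : S, M s t = M t s)
    (hlarge : ∀ s t : S, s ≠ t → 3 ≤ M s t)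
    (hrank : 2 ≤ Nat.card S)
    (g : ArtinGroup M) (n : ℤ) (hn : n ≠ 0)
    (P Q : Subgroup (ArtinGroup M))
    (hP : IsParabolicClosure M g P) (hQ : IsParabolicClosure M (g ^ n) Q) :
    P = Q := by
  have hQ' : IsParabolicClosure M (g ^ n.natAbs) Q := by
    rcases Int.natAbs_eq n with h | h
    · rw [h, zpow_natCast] at hQ
      exact hQ
    · rw [h, zpow_neg, zpow_natCast, Artin.isParabolicClosure_inv] at hQ
      exact hQ
  obtain ⟨h, X, rfl⟩ := hP.1
  have hP₁ := Artin.isParabolicClosure_conj hP h⁻¹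
  have hQ₁ := Artin.isParabolicClosure_conj hQ' h⁻¹
  rw [Artin.conjSubgroup_mul, inv_mul_cancel, Artin.conjSubgroup_one] at hP₁
  rw [← conj_pow] at hQ₁
  have := Artin.isParabolicClosure_pow_eq ⟨hsymm, hlarge⟩ (Int.natAbs_ne_zero.2 hn) hP₁ hQ₁
  rw [this, Artin.conjSubgroup_mul, mul_inv_cancel, Artin.conjSubgroup_one]
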